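/- arXiv:1508.00370 — 4 statements merged into one kernel-verified Lean document; each statement's English description precedes it below -/
import Mathlib

section
/- There exists a constant C = C(d,α) ≥ 1 such that for all t > 0 and x ∈ ℝ^d, C^{-1} · t/(t^{1/α} + |x|)^{d+α} ≤ p(t,x) ≤ C · t/(t^{1/α} + |x|)^{d+α}. -/
open MeasureTheory Real Filter
open scoped ENNReal RealInnerProductSpace

/-- The `α`-stable heat kernel `p(t,x) = (2π)^{-d} ∫ e^{-i x·ξ} e^{-t|ξ|^α} dξ` on `ℝ^d`
(the integral is real by symmetry, so we write it with a cosine). -/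
noncomputable def heatKer (d : ℕ) (α : ℝ) (t : ℝ) (x : EuclideanSpace ℝ (Fin d)) : ℝ :=
  (2 * Real.pi) ^ (-(d : ℝ)) *
    ∫ ξ : EuclideanSpace ℝ (Fin d), Real.cos ⟪x, ξ⟫ * Real.exp (-t * ‖ξ‖ ^ α)


lemma conv_pow_exists (ν : Measure ℝ) [IsFiniteMeasure ν] (hν : ∀ᵐ s ∂ν, 0 ≤ s) (k : ℕ) :
    ∃ μ : Measure ℝ, IsFiniteMeasure μ ∧ (∀ᵐ s ∂μ, 0 ≤ s) ∧
      ∀ l : ℝ, ∫⁻ s, ENNReal.ofReal (exp (-l * s)) ∂μ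
        = (∫⁻ s, ENNReal.ofReal (exp (-l * s)) ∂ν) ^ k := by
  induction k with
  | zero =>
    refine ⟨Measure.dirac 0, inferInstance, ?_, fun l => ?_⟩
    · exact (ae_dirac_iff (p := fun s : ℝ => 0 ≤ s) measurableSet_Ici).2 le_rfl
    · rw [lintegral_dirac' _ (by fun_prop)]; simp
  | succ k ih =>
    obtain ⟨μ, hf, h0, hl⟩ := ih
    have hm : Measurable (fun p : ℝ × ℝ => p.1 + p.2) := by fun_prop
    refine ⟨(μ.prod ν).map (fun p => p.1 + p.2), inferInstance, ?_, fun l => ?_⟩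
    · rw [ae_map_iff (p := fun s : ℝ => 0 ≤ s) hm.aemeasurable measurableSet_Ici]
      have h1 : ∀ᵐ p ∂(μ.prod ν), 0 ≤ p.1 := Measure.quasiMeasurePreserving_fst.ae h0
      have h2 : ∀ᵐ p ∂(μ.prod ν), 0 ≤ p.2 := Measure.quasiMeasurePreserving_snd.ae hν
      filter_upwards [h1, h2] with p a b using add_nonneg a b
    · rw [lintegral_map (by fun_prop) hm, pow_succ, ← hl,
        ← lintegral_prod_mul (by fun_prop) (by fun_prop)]
      refine lintegral_congr fun p => ?_
      rw [← ENNReal.ofReal_mul (exp_pos _).le, ← Real.exp_add]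
      congr 2; ring

lemma integrable_exp_of_nonneg (ν : Measure ℝ) [IsFiniteMeasure ν] (hν : ∀ᵐ s ∂ν, 0 ≤ s)
    {l : ℝ} (hl : 0 ≤ l) : Integrable (fun s => exp (-l * s)) ν := by
  refine Integrable.of_bound (by fun_prop) 1 ?_
  filter_upwards [hν] with s hs
  rw [Real.norm_eq_abs, abs_of_pos (exp_pos _)]
  exact Real.exp_le_one_iff.2 (by nlinarith [mul_nonneg hl hs])

lemma compound_poisson (ν : Measure ℝ) [IsFiniteMeasure ν] (hν : ∀ᵐ s ∂ν, 0 ≤ s) :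
    ∃ μ : Measure ℝ, IsProbabilityMeasure μ ∧ (∀ᵐ s ∂μ, 0 ≤ s) ∧
      ∀ l : ℝ, 0 ≤ l → ∫ s, exp (-l * s) ∂μ = exp (- ∫ s, (1 - exp (-l * s)) ∂ν) := by
  choose μ hμf hμ0 hμl using conv_pow_exists ν hν
  set m : ℝ := ν.real Set.univ
  let P : Measure ℝ := ENNReal.ofReal (exp (-m)) •
    Measure.sum (fun k => ENNReal.ofReal ((k.factorial : ℝ)⁻¹) • μ k)
  have key : ∀ l : ℝ, 0 ≤ l → ∫⁻ s, ENNReal.ofReal (exp (-l * s)) ∂P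
      = ENNReal.ofReal (exp (- ∫ s, (1 - exp (-l * s)) ∂ν)) := by
    intro l hl
    have hi := integrable_exp_of_nonneg ν hν hl
    have hL0 : 0 ≤ ∫ s, exp (-l * s) ∂ν := integral_nonneg fun s => (exp_pos _).le
    have e1 : ∫⁻ s, ENNReal.ofReal (exp (-l * s)) ∂ν = ENNReal.ofReal (∫ s, exp (-l * s) ∂ν) :=
      (ofReal_integral_eq_lintegral_ofReal hi (ae_of_all _ fun s => (exp_pos _).le)).symm
    have e2 : ∫ s, (1 - exp (-l * s)) ∂ν = m - ∫ s, exp (-l * s) ∂ν := by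
      rw [integral_sub (integrable_const _) hi]; simp [m]
    rw [e2]
    simp only [P, lintegral_smul_measure, lintegral_sum_measure, hμl, e1, smul_eq_mul]
    have e3 : ∀ k : ℕ, ENNReal.ofReal ((k.factorial : ℝ)⁻¹) *
        ENNReal.ofReal (∫ s, exp (-l * s) ∂ν) ^ k
        = ENNReal.ofReal ((k.factorial : ℝ)⁻¹ * (∫ s, exp (-l * s) ∂ν) ^ k) := by
      intro k
      rw [ENNReal.ofReal_mul (by positivity), ENNReal.ofReal_pow hL0]
    simp_rw [e3]
    have hs := NormedSpace.expSeries_div_hasSum_exp (𝔸 := ℝ) (∫ s, exp (-l * s) ∂ν)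
    rw [← congrFun Real.exp_eq_exp_ℝ _] at hs
    have hs' : HasSum (fun k : ℕ => (k.factorial : ℝ)⁻¹ * (∫ s, exp (-l * s) ∂ν) ^ k)
      (exp (∫ s, exp (-l * s) ∂ν)) := by
      have hfe : (fun k : ℕ => (k.factorial : ℝ)⁻¹ * (∫ s, exp (-l * s) ∂ν) ^ k)
          = fun k : ℕ => (∫ s, exp (-l * s) ∂ν) ^ k / (k.factorial : ℝ) := by
        funext k
        rw [div_eq_mul_inv, mul_comm]
      rw [hfe]
      exact hs
    rw [← ENNReal.ofReal_tsum_of_nonneg (fun k => by positivity) hs'.summable, hs'.tsum_eq,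
      ← ENNReal.ofReal_mul (exp_pos _).le, ← Real.exp_add]
    congr 2; ring
  refine ⟨P, ⟨?_⟩, ?_, fun l hl => ?_⟩
  · have := key 0 le_rfl
    simpa using this
  · refine Measure.ae_smul_measure ?_ _
    rw [Measure.ae_sum_iff]
    intro k
    exact Measure.ae_smul_measure (hμ0 k) _
  · rw [integral_eq_lintegral_of_nonneg_ae (ae_of_all _ fun s => (exp_pos _).le) (by fun_prop),
      key l hl, ENNReal.toReal_ofReal (exp_pos _).le]

lemma levy_bound {l s : ℝ} : 1 - exp (-l * s) ≤ l * s := by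
  have := Real.add_one_le_exp (-l * s); linarith

lemma levy_nonneg {l s : ℝ} (hl : 0 ≤ l) (hs : 0 ≤ s) : 0 ≤ 1 - exp (-l * s) := by
  have : exp (-l * s) ≤ 1 := Real.exp_le_one_iff.2 (by nlinarith [mul_nonneg hl hs])
  linarith

lemma levy_tail_integrable {β : ℝ} (h0 : 0 < β) {e : ℝ} (he : 0 < e) {l : ℝ} (hl : 0 ≤ l) :
    IntegrableOn (fun s : ℝ => (1 - exp (-l * s)) * s ^ (-1 - β)) (Set.Ioi e) := by
  have hi : IntegrableOn (fun s : ℝ => s ^ (-1 - β)) (Set.Ioi e) :=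
    integrableOn_Ioi_rpow_of_lt (by linarith) he
  refine Integrable.mono' hi (by fun_prop) ?_
  refine (ae_restrict_iff' measurableSet_Ioi).2 (ae_of_all _ fun s hs => ?_)
  have hs0 : 0 < s := he.trans hs
  have h1 := levy_nonneg hl hs0.le
  have h2 := exp_pos (-l * s)
  have h3 := rpow_pos_of_pos hs0 (-1 - β)
  rw [Real.norm_eq_abs, abs_of_nonneg (by positivity)]
  nlinarith

lemma levy_small_integrable' {β : ℝ} (h1 : β < 1) {e : ℝ} (he : 0 < e) :
    IntegrableOn (fun s : ℝ => s ^ (-β)) (Set.Ioc 0 e) := by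
  rw [← intervalIntegrable_iff_integrableOn_Ioc_of_le he.le]
  exact intervalIntegral.intervalIntegrable_rpow' (by linarith)

lemma levy_small_bound {β : ℝ} {l s : ℝ} (hs : 0 < s) :
    (1 - exp (-l * s)) * s ^ (-1 - β) ≤ l * s ^ (-β) := by
  have h3 := rpow_pos_of_pos hs (-1 - β)
  have h4 : s ^ (-β) = s * s ^ (-1 - β) := by
    rw [show -β = 1 + (-1 - β) by ring, rpow_add hs, rpow_one]
  rw [h4, ← mul_assoc]
  exact mul_le_mul_of_nonneg_right levy_bound h3.le

lemma levy_small_integrable {β : ℝ} (h1 : β < 1) {e : ℝ} (he : 0 < e) {l : ℝ} (hl : 0 ≤ l) :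
    IntegrableOn (fun s : ℝ => (1 - exp (-l * s)) * s ^ (-1 - β)) (Set.Ioc 0 e) := by
  refine Integrable.mono' ((levy_small_integrable' h1 he).const_mul l) (by fun_prop) ?_
  refine (ae_restrict_iff' measurableSet_Ioc).2 (ae_of_all _ fun s hs => ?_)
  have hs0 : 0 < s := hs.1
  have h1 := levy_nonneg hl hs0.le
  rw [Real.norm_eq_abs, abs_of_nonneg (by positivity)]
  exact levy_small_bound hs0

lemma levy_integrable {β : ℝ} (h0 : 0 < β) (h1 : β < 1) {l : ℝ} (hl : 0 ≤ l) :
    IntegrableOn (fun s : ℝ => (1 - exp (-l * s)) * s ^ (-1 - β)) (Set.Ioi 0) := by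
  rw [← Set.Ioc_union_Ioi_eq_Ioi zero_le_one]
  exact (levy_small_integrable h1 one_pos hl).union (levy_tail_integrable h0 one_pos hl)

lemma levy_scaling {β : ℝ} (h0 : 0 < β) {l : ℝ} (hl : 0 ≤ l) :
    ∫ s in Set.Ioi (0:ℝ), (1 - exp (-l * s)) * s ^ (-1 - β)
      = l ^ β * ∫ s in Set.Ioi (0:ℝ), (1 - exp (-1 * s)) * s ^ (-1 - β) := by
  rcases hl.eq_or_lt with rfl | hl
  · simp [zero_rpow h0.ne']
  have := integral_comp_mul_left_Ioi (fun s => (1 - exp (-1 * s)) * s ^ (-1 - β)) 0 hl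
  rw [mul_zero, smul_eq_mul] at this
  have e : ∫ s in Set.Ioi (0:ℝ), (1 - exp (-1 * (l * s))) * (l * s) ^ (-1 - β)
      = l ^ (-1 - β) * ∫ s in Set.Ioi (0:ℝ), (1 - exp (-l * s)) * s ^ (-1 - β) := by
    rw [← integral_const_mul]
    refine setIntegral_congr_fun measurableSet_Ioi fun s hs => ?_
    have hs0 : 0 < s := hs
    rw [mul_rpow hl.le hs0.le]; ring_nf
  rw [e] at this
  have h2 : l ^ β * l⁻¹ * l ^ (-β) * l = 1 := by
    rw [rpow_neg hl.le]; have := rpow_pos_of_pos hl β; field_simp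
  have h3 : l ^ (-1 - β) = l⁻¹ * l ^ (-β) := by
    rw [show -1 - β = (-1) + (-β) by ring, rpow_add hl, rpow_neg_one]
  have h4 := rpow_pos_of_pos hl β
  rw [h3, rpow_neg hl.le] at this
  field_simp at this
  simpa using this

lemma levy_const_pos {β : ℝ} (h0 : 0 < β) (h1 : β < 1) :
    0 < ∫ s in Set.Ioi (0:ℝ), (1 - exp (-1 * s)) * s ^ (-1 - β) := by
  have hp : ∀ s ∈ Set.Ioi (0:ℝ), 0 < (1 - exp (-1 * s)) * s ^ (-1 - β) := by
    intro s hs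
    have hs0 : 0 < s := hs
    have : exp (-1 * s) < 1 := by
      have := Real.exp_lt_exp.2 (show -1 * s < 0 by linarith)
      rwa [Real.exp_zero] at this
    have h3 := rpow_pos_of_pos hs0 (-1 - β)
    exact mul_pos (by linarith) h3
  rw [setIntegral_pos_iff_support_of_nonneg_ae _ (levy_integrable h0 h1 zero_le_one)]
  · refine lt_of_lt_of_le ?_ (measure_mono (s := Set.Ioi (0:ℝ)) ?_)
    · simp
    · intro s hs
      exact ⟨(hp s hs).ne', hs⟩
  · exact (ae_restrict_iff' measurableSet_Ioi).2 (ae_of_all _ fun s hs => (hp s hs).le)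

lemma levy_small_int {β : ℝ} (h1 : β < 1) {e : ℝ} (he : 0 < e) {l : ℝ} (hl : 0 ≤ l) :
    ∫ s in Set.Ioc 0 e, (1 - exp (-l * s)) * s ^ (-1 - β) ≤ l * (e ^ (1 - β) / (1 - β)) := by
  have : ∫ s in Set.Ioc 0 e, l * s ^ (-β) = l * (e ^ (1 - β) / (1 - β)) := by
    rw [integral_const_mul, ← intervalIntegral.integral_of_le he.le,
      integral_rpow (Or.inl (by linarith))]
    rw [show -β + 1 = 1 - β by ring, zero_rpow (by linarith), sub_zero]
  rw [← this]
  exact setIntegral_mono_on (levy_small_integrable h1 he hl)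
    ((levy_small_integrable' h1 he).const_mul l) measurableSet_Ioc
    fun s hs => levy_small_bound hs.1

lemma approx_measure {β : ℝ} (h0 : 0 < β) (h1 : β < 1) {δ : ℝ} (hδ : 0 < δ) :
    ∃ μ : Measure ℝ, IsProbabilityMeasure μ ∧ (∀ᵐ s ∂μ, δ ≤ s) ∧
      ∀ l : ℝ, 0 ≤ l → exp (-δ * l) * exp (-l ^ β) ≤ ∫ s, exp (-l * s) ∂μ ∧
        ∫ s, exp (-l * s) ∂μ ≤ exp (-l ^ β) := by
  set J : ℝ := ∫ s in Set.Ioi (0:ℝ), (1 - exp (-1 * s)) * s ^ (-1 - β) with hJ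
  have hJ0 : 0 < J := levy_const_pos h0 h1
  have h1' : 0 < 1 - β := by linarith
  set e : ℝ := (δ * (1 - β) * J) ^ (1 / (1 - β)) with he
  have he0 : 0 < e := rpow_pos_of_pos (by positivity) _
  have heδ : e ^ (1 - β) = δ * (1 - β) * J := by
    rw [he, ← rpow_mul (by positivity), one_div_mul_cancel h1'.ne', rpow_one]
  let w : ℝ → ℝ := fun s => s ^ (-1 - β) / J
  have hwm : Measurable w := by fun_prop
  have hw0 : ∀ s ∈ Set.Ioi e, 0 ≤ w s := fun s hs => by
    have : 0 < s := he0.trans hs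
    positivity
  have hwi : IntegrableOn w (Set.Ioi e) :=
    (integrableOn_Ioi_rpow_of_lt (by linarith) he0).div_const _
  let ν : Measure ℝ := (volume.restrict (Set.Ioi e)).withDensity (fun s => ENNReal.ofReal (w s))
  have hνf : IsFiniteMeasure ν := isFiniteMeasure_withDensity_ofReal hwi.2
  have hν0 : ∀ᵐ s ∂ν, 0 ≤ s := by
    refine (withDensity_absolutelyContinuous _ _).ae_le ?_
    exact (ae_restrict_iff' measurableSet_Ioi).2 (ae_of_all _ fun s hs => (he0.trans hs).le)
  have hνi : ∀ l : ℝ, ∫ s, (1 - exp (-l * s)) ∂ν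
      = (∫ s in Set.Ioi e, (1 - exp (-l * s)) * s ^ (-1 - β)) / J := by
    intro l
    rw [integral_withDensity_eq_integral_toReal_smul (by fun_prop) (ae_of_all _ fun s => by simp),
      ← integral_div]
    refine setIntegral_congr_fun measurableSet_Ioi fun s hs => ?_
    simp only [smul_eq_mul, ENNReal.toReal_ofReal (hw0 s hs), w]
    ring
  have hsplit : ∀ l : ℝ, 0 ≤ l → l ^ β - δ * l ≤ ∫ s, (1 - exp (-l * s)) ∂ν ∧
      ∫ s, (1 - exp (-l * s)) ∂ν ≤ l ^ β := by
    intro l hl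
    have hs : ∫ s in Set.Ioi (0:ℝ), (1 - exp (-l * s)) * s ^ (-1 - β)
        = (∫ s in Set.Ioc 0 e, (1 - exp (-l * s)) * s ^ (-1 - β))
          + ∫ s in Set.Ioi e, (1 - exp (-l * s)) * s ^ (-1 - β) := by
      rw [← Set.Ioc_union_Ioi_eq_Ioi he0.le]
      exact setIntegral_union (Set.Ioc_disjoint_Ioi le_rfl) measurableSet_Ioi
        (levy_small_integrable h1 he0 hl) (levy_tail_integrable h0 he0 hl)
    rw [levy_scaling h0 hl, ← hJ] at hs
    have hb := levy_small_int h1 he0 hl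
    have hp : 0 ≤ ∫ s in Set.Ioc 0 e, (1 - exp (-l * s)) * s ^ (-1 - β) :=
      setIntegral_nonneg measurableSet_Ioc fun s hs =>
        mul_nonneg (levy_nonneg hl hs.1.le) (rpow_nonneg hs.1.le _)
    have h5 : l * (e ^ (1 - β) / (1 - β)) = δ * l * J := by
      rw [heδ]; field_simp
    rw [h5] at hb
    rw [hνi, div_le_iff₀ hJ0, le_div_iff₀ hJ0]
    constructor <;> linarith
  obtain ⟨μ, hμp, hμ0, hμl⟩ := compound_poisson ν hν0
  have hm : Measurable (fun s : ℝ => s + δ) := by fun_prop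
  refine ⟨μ.map (fun s => s + δ), Measure.isProbabilityMeasure_map hm.aemeasurable, ?_, ?_⟩
  · rw [ae_map_iff (p := fun s : ℝ => δ ≤ s) hm.aemeasurable measurableSet_Ici]
    filter_upwards [hμ0] with s hs using by linarith
  · intro l hl
    have : ∫ s, exp (-l * s) ∂(μ.map (fun s => s + δ))
        = exp (-δ * l) * exp (- ∫ s, (1 - exp (-l * s)) ∂ν) := by
      rw [integral_map hm.aemeasurable (by fun_prop), ← hμl l hl, ← integral_const_mul]
      refine integral_congr_ae (ae_of_all _ fun s => ?_)
      simp only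
      rw [← Real.exp_add]; ring_nf
    obtain ⟨ha, hb⟩ := hsplit l hl
    rw [this, ← Real.exp_add, ← Real.exp_add]
    constructor <;> apply Real.exp_le_exp.2 <;> linarith

lemma gauss_fourier {d : ℕ} (y : EuclideanSpace ℝ (Fin d)) {s : ℝ} (hs : 0 < s) :
    ∫ ξ : EuclideanSpace ℝ (Fin d), Real.cos ⟪y, ξ⟫ * exp (-‖ξ‖ ^ 2 * s)
      = (π / s) ^ ((d : ℝ) / 2) * exp (-‖y‖ ^ 2 / (4 * s)) := by
  have hb : 0 < (s : ℂ).re := by simpa using hs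
  have h := GaussianFourier.integral_cexp_neg_mul_sq_norm_add hb Complex.I y
  have hi := GaussianFourier.integrable_cexp_neg_mul_sq_norm_add hb Complex.I y
  have h2 := congrArg Complex.re h
  have e1 : ∀ ξ : EuclideanSpace ℝ (Fin d),
      (Complex.exp (-(s : ℂ) * ‖ξ‖ ^ 2 + Complex.I * (⟪y, ξ⟫ : ℝ))).re
      = Real.cos ⟪y, ξ⟫ * exp (-‖ξ‖ ^ 2 * s) := by
    intro ξ
    rw [Complex.exp_re]
    have a1 : (-(s : ℂ) * ‖ξ‖ ^ 2 + Complex.I * (⟪y, ξ⟫ : ℝ)).re = -‖ξ‖ ^ 2 * s := by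
      simp [← Complex.ofReal_pow]; ring
    have a2 : (-(s : ℂ) * ‖ξ‖ ^ 2 + Complex.I * (⟪y, ξ⟫ : ℝ)).im = ⟪y, ξ⟫ := by
      simp [← Complex.ofReal_pow]
    rw [a1, a2, mul_comm]
  have e2 : ((π / s : ℂ) ^ (Module.finrank ℝ (EuclideanSpace ℝ (Fin d)) / 2 : ℂ) *
      Complex.exp (Complex.I ^ 2 * ‖y‖ ^ 2 / (4 * s))) =
      (((π / s) ^ ((d : ℝ) / 2) * exp (-‖y‖ ^ 2 / (4 * s)) : ℝ) : ℂ) := by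
    have hps : 0 ≤ π / s := by positivity
    push_cast [Complex.ofReal_cpow hps]
    simp
  rw [e2, Complex.ofReal_re, ← RCLike.re_eq_complex_re, ← integral_re hi] at h2
  rw [← h2]
  refine integral_congr_ae (ae_of_all _ fun ξ => ?_)
  simp only [RCLike.re_eq_complex_re]
  exact (e1 ξ).symm

lemma gauss_integrable {d : ℕ} {δ : ℝ} (hδ : 0 < δ) :
    Integrable (fun ξ : EuclideanSpace ℝ (Fin d) => exp (-‖ξ‖ ^ 2 * δ)) := by
  have hb : 0 < (δ : ℂ).re := by simpa using hδ
  have hi := (GaussianFourier.integrable_cexp_neg_mul_sq_norm_add hb 0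
    (0 : EuclideanSpace ℝ (Fin d))).norm
  refine hi.congr (ae_of_all _ fun ξ => ?_)
  simp only [Complex.norm_exp]
  congr 1
  simp [← Complex.ofReal_pow]; ring

lemma mixture_fourier {d : ℕ} (y : EuclideanSpace ℝ (Fin d)) (μ : Measure ℝ)
    [IsProbabilityMeasure μ] {δ : ℝ} (hδ : 0 < δ) (hμ : ∀ᵐ s ∂μ, δ ≤ s) :
    ∫ ξ : EuclideanSpace ℝ (Fin d), Real.cos ⟪y, ξ⟫ * ∫ s, exp (-‖ξ‖ ^ 2 * s) ∂μ
      = ∫ s, (π / s) ^ ((d : ℝ) / 2) * exp (-‖y‖ ^ 2 / (4 * s)) ∂μ := by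
  simp_rw [← integral_const_mul]
  rw [integral_integral_swap]
  · refine integral_congr_ae ?_
    filter_upwards [hμ] with s hs using gauss_fourier y (hδ.trans_le hs)
  · have hg : Integrable (fun p : EuclideanSpace ℝ (Fin d) × ℝ => exp (-‖p.1‖ ^ 2 * δ) * 1)
        (volume.prod μ) := (gauss_integrable hδ).mul_prod (integrable_const (1:ℝ))
    refine Integrable.mono' hg ?_ ?_
    · apply Continuous.aestronglyMeasurable
      simp only [Function.uncurry_def]
      fun_prop
    · have h2 : ∀ᵐ p ∂((volume : Measure (EuclideanSpace ℝ (Fin d))).prod μ), δ ≤ p.2 :=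
        Measure.quasiMeasurePreserving_snd.ae hμ
      filter_upwards [h2] with p hp
      simp only [Function.uncurry_def, norm_mul, Real.norm_eq_abs, abs_exp, mul_one]
      have c1 := Real.abs_cos_le_one ⟪y, p.1⟫
      have c2 : exp (-‖p.1‖ ^ 2 * p.2) ≤ exp (-‖p.1‖ ^ 2 * δ) :=
        Real.exp_le_exp.2 (by nlinarith [sq_nonneg ‖p.1‖])
      calc _ ≤ 1 * exp (-‖p.1‖ ^ 2 * p.2) := by gcongr
        _ ≤ _ := by rw [one_mul]; exact c2

lemma stable_integrable {d : ℕ} (hd : 1 ≤ d) {α : ℝ} (hα : 0 < α) :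
    Integrable (fun ξ : EuclideanSpace ℝ (Fin d) => exp (-‖ξ‖ ^ α)) := by
  have hd0 : 0 < d := hd
  have : Nontrivial (EuclideanSpace ℝ (Fin d)) := by
    exact Module.nontrivial_of_finrank_pos (R := ℝ) (by simpa using hd0)
  have := (integrable_fun_norm_addHaar (volume : Measure (EuclideanSpace ℝ (Fin d)))
    (f := fun r : ℝ => exp (-r ^ α))).2 ?_
  · exact this
  · have h := integrableOn_rpow_mul_exp_neg_rpow (p := α) (s := (d - 1 : ℕ))
      (by have : (0:ℝ) ≤ ((d-1 : ℕ) : ℝ) := Nat.cast_nonneg _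
          linarith) hα
    refine h.congr_fun (fun r hr => ?_) measurableSet_Ioi
    simp [rpow_natCast]

/-- The profile integral. -/
noncomputable def profI (d : ℕ) (α : ℝ) (y : EuclideanSpace ℝ (Fin d)) : ℝ :=
  ∫ ξ : EuclideanSpace ℝ (Fin d), Real.cos ⟪y, ξ⟫ * exp (-‖ξ‖ ^ α)

lemma approx_seq (d : ℕ) (hd : 1 ≤ d) {α : ℝ} (h0 : 0 < α) (h2 : α < 2) :
    ∃ μ : ℕ → Measure ℝ, (∀ n, IsProbabilityMeasure (μ n)) ∧
      (∀ n, ∃ δ : ℝ, 0 < δ ∧ ∀ᵐ s ∂(μ n), δ ≤ s) ∧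
      (∀ l : ℝ, 0 ≤ l → Tendsto (fun n => ∫ s, exp (-l * s) ∂(μ n)) atTop
        (nhds (exp (-l ^ (α / 2))))) ∧
      ∀ y : EuclideanSpace ℝ (Fin d), Tendsto (fun n =>
        ∫ s, (π / s) ^ ((d : ℝ) / 2) * exp (-‖y‖ ^ 2 / (4 * s)) ∂(μ n)) atTop
          (nhds (profI d α y)) := by
  have hδ : ∀ n : ℕ, (0:ℝ) < 1 / ((n : ℝ) + 1) := fun n => by positivity
  choose μ hp hs hl using fun n : ℕ =>
    approx_measure (β := α / 2) (by linarith) (by linarith) (hδ n)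
  have hT : ∀ l : ℝ, 0 ≤ l → Tendsto (fun n => ∫ s, exp (-l * s) ∂(μ n)) atTop
        (nhds (exp (-l ^ (α / 2)))) := by
    intro l h
    refine tendsto_of_tendsto_of_tendsto_of_le_of_le ?_ tendsto_const_nhds
      (fun n => (hl n l h).1) (fun n => (hl n l h).2)
    have t1 : Tendsto (fun n : ℕ => exp (-(1 / ((n : ℝ) + 1)) * l) * exp (-l ^ (α / 2))) atTop
        (nhds (exp (-0 * l) * exp (-l ^ (α / 2)))) := by
      refine Tendsto.mul_const _ ?_
      refine (Real.continuous_exp.tendsto _).comp ?_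
      exact (tendsto_one_div_add_atTop_nhds_zero_nat.neg).mul_const _
    simpa using t1
  refine ⟨μ, hp, fun n => ⟨_, hδ n, hs n⟩, hT, fun y => ?_⟩
  have hpow : ∀ ξ : EuclideanSpace ℝ (Fin d), (‖ξ‖ ^ 2) ^ (α / 2) = ‖ξ‖ ^ α := by
    intro ξ
    rw [← rpow_natCast, ← rpow_mul (norm_nonneg _)]
    congr 1; push_cast; ring
  have hc : ∀ n, ∫ s, (π / s) ^ ((d : ℝ) / 2) * exp (-‖y‖ ^ 2 / (4 * s)) ∂(μ n) =
      ∫ ξ : EuclideanSpace ℝ (Fin d), Real.cos ⟪y, ξ⟫ * ∫ s, exp (-‖ξ‖ ^ 2 * s) ∂(μ n) :=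
    fun n => (mixture_fourier y (μ n) (hδ n) (hs n)).symm
  simp_rw [hc]
  unfold profI
  refine tendsto_integral_of_dominated_convergence
    (fun ξ : EuclideanSpace ℝ (Fin d) => exp (-‖ξ‖ ^ α)) ?_ (stable_integrable hd h0) ?_ ?_
  · intro n
    refine AEStronglyMeasurable.mul (by fun_prop) ?_
    apply StronglyMeasurable.aestronglyMeasurable
    refine StronglyMeasurable.integral_prod_right'
      (f := fun p : EuclideanSpace ℝ (Fin d) × ℝ => exp (-‖p.1‖ ^ 2 * p.2)) ?_
    apply Continuous.stronglyMeasurable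
    fun_prop
  · intro n
    refine ae_of_all _ fun ξ => ?_
    have a := (hl n (‖ξ‖ ^ 2) (by positivity)).2
    rw [hpow] at a
    have b : 0 ≤ ∫ s, exp (-‖ξ‖ ^ 2 * s) ∂(μ n) := integral_nonneg fun s => (exp_pos _).le
    rw [norm_mul, Real.norm_eq_abs, Real.norm_eq_abs, abs_of_nonneg b]
    calc _ ≤ 1 * ∫ s, exp (-‖ξ‖ ^ 2 * s) ∂(μ n) := by
          gcongr; exact Real.abs_cos_le_one _
      _ ≤ _ := by rw [one_mul]; exact a
  · refine ae_of_all _ fun ξ => ?_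
    have := hT (‖ξ‖ ^ 2) (by positivity)
    rw [hpow] at this
    exact this.const_mul _

lemma one_sub_exp_lower {x : ℝ} (hx : 0 ≤ x) : x / (1 + x) ≤ 1 - exp (-x) := by
  have h := Real.add_one_le_exp x
  have h1 : exp (-x) ≤ 1 / (1 + x) := by
    rw [Real.exp_neg, ← one_div]
    exact one_div_le_one_div_of_le (by linarith) (by linarith)
  have : x / (1 + x) = 1 - 1 / (1 + x) := by field_simp; ring
  linarith

lemma rpow_mul_exp_bdd {p b : ℝ} (hp : 0 < p) (hb : 0 < b) {v : ℝ} (hv : 0 ≤ v) :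
    v ^ p ≤ (p / b) ^ p * exp (b * v) := by
  have h : v ≤ (p / b) * exp (b * v / p) := by
    have := Real.add_one_le_exp (b * v / p)
    have h2 : v = (p / b) * (b * v / p) := by field_simp
    calc v = (p / b) * (b * v / p) := h2
      _ ≤ _ := by gcongr; linarith
  calc v ^ p ≤ ((p / b) * exp (b * v / p)) ^ p := rpow_le_rpow hv h hp.le
    _ = _ := by
      rw [mul_rpow (by positivity) (exp_pos _).le, ← Real.exp_mul]
      congr 2; field_simp

lemma kernel_upper (d : ℕ) (hd : 1 ≤ d) : ∃ C : ℝ, 0 < C ∧ ∀ u : ℝ, 0 < u →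
    (π / u) ^ ((d : ℝ) / 2) * exp (-1 / (4 * u)) ≤ C * (1 - exp (-u)) := by
  have hd0 : (0:ℝ) < d := by exact_mod_cast hd
  set p : ℝ := (d : ℝ) / 2 with hp
  have hp0 : 0 < p := by positivity
  refine ⟨π ^ p * ((p / (1/4)) ^ p + ((p + 1) / (1/4)) ^ (p + 1)), by positivity, fun u hu => ?_⟩
  have h1 := one_sub_exp_lower hu.le
  have hv : 0 < u⁻¹ := inv_pos.2 hu
  have b1 := rpow_mul_exp_bdd hp0 (show (0:ℝ) < 1/4 by norm_num) hv.le
  have b2 := rpow_mul_exp_bdd (show 0 < p + 1 by linarith) (show (0:ℝ) < 1/4 by norm_num) hv.le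
  rw [rpow_add hv, rpow_one] at b2
  have e1 : exp (-1 / (4 * u)) = (exp (1 / 4 * u⁻¹))⁻¹ := by
    rw [← Real.exp_neg]; congr 1; field_simp
  have hE := exp_pos (1 / 4 * u⁻¹)
  rw [div_eq_mul_inv, mul_rpow pi_pos.le hv.le, e1]
  have hpi := rpow_pos_of_pos pi_pos p
  have e2 : u / (1 + u) = (1 + u⁻¹)⁻¹ := by field_simp; ring
  have key : (u⁻¹) ^ p * (exp (1 / 4 * u⁻¹))⁻¹ ≤
      ((p / (1/4)) ^ p + ((p + 1) / (1/4)) ^ (p + 1)) * (u / (1 + u)) := by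
    rw [e2]
    generalize exp (1 / 4 * u⁻¹) = E at b1 b2 hE ⊢
    rw [← div_eq_mul_inv _ E, ← div_eq_mul_inv _ (1 + u⁻¹), div_le_div_iff₀ hE (by positivity)]
    nlinarith
  calc π ^ p * (u⁻¹) ^ p * (exp (1 / 4 * u⁻¹))⁻¹
      = π ^ p * ((u⁻¹) ^ p * (exp (1 / 4 * u⁻¹))⁻¹) := by ring
    _ ≤ π ^ p * (((p / (1/4)) ^ p + ((p + 1) / (1/4)) ^ (p + 1)) * (u / (1 + u))) := by gcongr
    _ ≤ π ^ p * (((p / (1/4)) ^ p + ((p + 1) / (1/4)) ^ (p + 1)) * (1 - exp (-u))) := by gcongr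
    _ = _ := by ring

lemma kernel_lower (d : ℕ) (hd : 1 ≤ d) {M e : ℝ} (hM : 0 < M) (he : 0 < e) :
    ∃ C : ℝ, 0 < C ∧ ∀ u : ℝ, 0 < u →
    (1 - exp (-u)) - (1 - exp (-(e * u))) - (1 - exp (-(M * u))) / M ≤
      C * ((π / u) ^ ((d : ℝ) / 2) * exp (-1 / (4 * u))) := by
  have hd0 : (0:ℝ) < d := by exact_mod_cast hd
  set p : ℝ := (d : ℝ) / 2 with hp
  have hp0 : 0 < p := by positivity
  set a : ℝ := e / (e ^ 2 + M) with ha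
  have ha0 : 0 < a := by positivity
  refine ⟨(p / e) ^ p * (π ^ p)⁻¹ * exp (1 / (4 * a)), by positivity, fun u hu => ?_⟩
  have hpi := rpow_pos_of_pos pi_pos p
  rcases le_total u a with hua | hua
  · have l1 := Real.add_one_le_exp (-u)
    have l0 : ∀ x : ℝ, 0 ≤ x → x - x ^ 2 ≤ 1 - exp (-x) := by
      intro x hx
      refine le_trans ?_ (one_sub_exp_lower hx)
      rw [le_div_iff₀ (by linarith)]
      nlinarith [pow_nonneg hx 3]
    have l2 := l0 (e * u) (by positivity)
    have l3 := l0 (M * u) (by positivity)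
    have l4 : u - M * u ^ 2 ≤ (1 - exp (-(M * u))) / M := by
      rw [le_div_iff₀ hM]; nlinarith
    have l5 : u * (e ^ 2 + M) ≤ e := by
      rw [ha, le_div_iff₀ (by positivity)] at hua; exact hua
    have l6 : u * (u * (e ^ 2 + M)) ≤ u * e := mul_le_mul_of_nonneg_left l5 hu.le
    have : (1 - exp (-u)) - (1 - exp (-(e * u))) - (1 - exp (-(M * u))) / M ≤ 0 := by nlinarith
    exact this.trans (by positivity)
  · have b1 := rpow_mul_exp_bdd hp0 he hu.le
    have hup := rpow_pos_of_pos hu p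
    have f1 : exp (-(e * u)) ≤ (p / e) ^ p * (u ^ p)⁻¹ := by
      rw [Real.exp_neg, ← div_eq_mul_inv, inv_eq_one_div, div_le_div_iff₀ (exp_pos _) hup]
      linarith
    have f2 : exp (-(1 / (4 * a))) ≤ exp (-1 / (4 * u)) := by
      apply Real.exp_le_exp.2
      rw [neg_div]
      apply neg_le_neg
      apply one_div_le_one_div_of_le (by positivity)
      linarith
    have f3 : 0 ≤ (1 - exp (-(M * u))) / M := by
      apply div_nonneg _ hM.le
      have : exp (-(M * u)) ≤ 1 := Real.exp_le_one_iff.2 (by nlinarith [mul_pos hM hu])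
      linarith
    have f4 := exp_pos (-u)
    calc _ ≤ exp (-(e * u)) := by linarith
      _ ≤ (p / e) ^ p * (u ^ p)⁻¹ := f1
      _ = (p / e) ^ p * (π ^ p)⁻¹ * exp (1 / (4 * a)) *
          ((π / u) ^ p * exp (-(1 / (4 * a)))) := by
        rw [div_rpow pi_pos.le hu.le, Real.exp_neg]
        have := exp_pos (1 / (4 * a))
        field_simp
      _ ≤ _ := by gcongr

lemma kernel_scale (d : ℕ) {R s : ℝ} (hR : 0 < R) (hs : 0 < s) :
    (π / s) ^ ((d : ℝ) / 2) * exp (-R ^ 2 / (4 * s)) =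
     R ^ (-(d : ℝ)) * ((π / ((R ^ 2)⁻¹ * s)) ^ ((d : ℝ) / 2) *
        exp (-1 / (4 * ((R ^ 2)⁻¹ * s)))) := by
  have e1 : π / ((R ^ 2)⁻¹ * s) = (π / s) * R ^ 2 := by field_simp
  have e2 : (R ^ 2) ^ ((d : ℝ) / 2) = R ^ (d : ℝ) := by
    rw [← rpow_natCast, ← rpow_mul hR.le]; congr 1; push_cast; ring
  have e3 : -1 / (4 * ((R ^ 2)⁻¹ * s)) = -R ^ 2 / (4 * s) := by field_simp
  rw [e1, e3, mul_rpow (by positivity) (by positivity), e2, rpow_neg hR.le]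
  have := rpow_pos_of_pos hR (d : ℝ)
  field_simp

lemma kernel_integrable (d : ℕ) (R : ℝ) (μ : Measure ℝ) [IsProbabilityMeasure μ] {δ : ℝ}
    (hδ : 0 < δ) (hμ : ∀ᵐ s ∂μ, δ ≤ s) :
    Integrable (fun s => (π / s) ^ ((d : ℝ) / 2) * exp (-R ^ 2 / (4 * s))) μ := by
  refine Integrable.of_bound (by fun_prop) ((π / δ) ^ ((d : ℝ) / 2)) ?_
  filter_upwards [hμ] with s hs
  have hs0 : 0 < s := hδ.trans_le hs
  rw [Real.norm_eq_abs, abs_of_nonneg (by positivity)]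
  have h1 : exp (-R ^ 2 / (4 * s)) ≤ 1 := by
    apply Real.exp_le_one_iff.2
    rw [neg_div]
    have : 0 ≤ R ^ 2 / (4 * s) := by positivity
    linarith
  calc _ ≤ (π / δ) ^ ((d : ℝ) / 2) * 1 := by gcongr
    _ = _ := mul_one _

lemma profI_anti (d : ℕ) (hd : 1 ≤ d) {α : ℝ} (h0 : 0 < α) (h2 : α < 2)
    {y z : EuclideanSpace ℝ (Fin d)} (h : ‖y‖ ≤ ‖z‖) : profI d α z ≤ profI d α y := by
  obtain ⟨μ, hp, hs, hT, hI⟩ := approx_seq d hd h0 h2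
  refine le_of_tendsto_of_tendsto' (hI z) (hI y) fun n => ?_
  obtain ⟨δ, hδ, hsn⟩ := hs n
  have := hp n
  refine integral_mono_ae (kernel_integrable d _ _ hδ hsn) (kernel_integrable d _ _ hδ hsn) ?_
  filter_upwards [hsn] with s hs
  have hs0 : 0 < s := hδ.trans_le hs
  have : -‖z‖ ^ 2 / (4 * s) ≤ -‖y‖ ^ 2 / (4 * s) := by gcongr
  gcongr

lemma inv_sq_rpow {R α : ℝ} (hR : 0 < R) : ((R ^ 2)⁻¹) ^ (α / 2) = R ^ (-α) := by
  rw [rpow_neg hR.le, inv_rpow (by positivity), ← rpow_natCast, ← rpow_mul hR.le]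
  congr 2; push_cast; ring

lemma profI_upper (d : ℕ) (hd : 1 ≤ d) {α : ℝ} (h0 : 0 < α) (h2 : α < 2) :
    ∃ C : ℝ, 0 < C ∧ ∀ y : EuclideanSpace ℝ (Fin d), 0 < ‖y‖ →
      profI d α y ≤ C * ‖y‖ ^ (-((d : ℝ) + α)) := by
  obtain ⟨C, hC, hk⟩ := kernel_upper d hd
  refine ⟨C, hC, fun y hy => ?_⟩
  obtain ⟨μ, hp, hs, hT, hI⟩ := approx_seq d hd h0 h2
  set R := ‖y‖ with hR
  set l : ℝ := (R ^ 2)⁻¹ with hl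
  have hl0 : 0 < l := by positivity
  have hlim : Tendsto (fun n => R ^ (-(d:ℝ)) * (C * (1 - ∫ s, exp (-l * s) ∂(μ n)))) atTop
      (nhds (R ^ (-(d:ℝ)) * (C * (1 - exp (-l ^ (α / 2)))))) :=
    ((hT l hl0.le).const_sub 1).const_mul C |>.const_mul _
  have hle := le_of_tendsto_of_tendsto' (hI y) hlim fun n => by
    obtain ⟨δ, hδ, hsn⟩ := hs n
    have := hp n
    have hs0 : ∀ᵐ s ∂(μ n), 0 ≤ s := by filter_upwards [hsn] with s h using hδ.le.trans h
    have hi := integrable_exp_of_nonneg (μ n) hs0 hl0.le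
    have e : R ^ (-(d:ℝ)) * (C * (1 - ∫ s, exp (-l * s) ∂(μ n)))
        = ∫ s, R ^ (-(d:ℝ)) * (C * (1 - exp (-l * s))) ∂(μ n) := by
      rw [integral_const_mul, integral_const_mul, integral_sub (integrable_const _) hi]
      simp
    rw [e]
    refine integral_mono_ae (kernel_integrable d _ _ hδ hsn)
      ((((integrable_const _).sub hi).const_mul C).const_mul _) ?_
    filter_upwards [hsn] with s hs
    have hs0 : 0 < s := hδ.trans_le hs
    rw [kernel_scale d hy hs0, neg_mul]
    exact mul_le_mul_of_nonneg_left (hk _ (mul_pos hl0 hs0)) (by positivity)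
  refine hle.trans ?_
  rw [inv_sq_rpow hy]
  have h3 := Real.add_one_le_exp (-R ^ (-α))
  have h4 : 1 - exp (-R ^ (-α)) ≤ R ^ (-α) := by linarith
  rw [show -((d:ℝ) + α) = -(d:ℝ) + -α by ring, rpow_add hy]
  calc _ ≤ R ^ (-(d:ℝ)) * (C * R ^ (-α)) := by gcongr
    _ = _ := by ring

lemma profI_lower (d : ℕ) (hd : 1 ≤ d) {α : ℝ} (h0 : 0 < α) (h2 : α < 2) :
    ∃ c : ℝ, 0 < c ∧ ∀ y : EuclideanSpace ℝ (Fin d), 1 ≤ ‖y‖ →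
      c * ‖y‖ ^ (-((d : ℝ) + α)) ≤ profI d α y := by
  set b : ℝ := α / 2 with hb
  have hb0 : 0 < b := by positivity
  have hb1 : 0 < 1 - b := by rw [hb]; linarith
  set M : ℝ := (8:ℝ) ^ (1 / (1 - b)) with hMdef
  set e : ℝ := (1/8:ℝ) ^ (1 / b) with hedef
  have hM : 0 < M := by positivity
  have he : 0 < e := by positivity
  have heb : e ^ b = 1/8 := by
    rw [hedef, ← rpow_mul (by norm_num), one_div_mul_cancel hb0.ne', rpow_one]
  have hM8 : M ^ (1 - b) = 8 := by
    rw [hMdef, ← rpow_mul (by norm_num), one_div_mul_cancel hb1.ne', rpow_one]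
  have hMb : M ^ b / M = 1/8 := by
    rw [rpow_sub hM, rpow_one] at hM8
    have := rpow_pos_of_pos hM b
    field_simp at hM8 ⊢
    linarith
  obtain ⟨C, hC, hk⟩ := kernel_lower d hd hM he
  refine ⟨(4 * C)⁻¹, by positivity, fun y hy1 => ?_⟩
  have hy : 0 < ‖y‖ := by linarith
  obtain ⟨μ, hp, hs, hT, hI⟩ := approx_seq d hd h0 h2
  set R := ‖y‖ with hR
  set l : ℝ := (R ^ 2)⁻¹ with hl
  have hl0 : 0 < l := by positivity
  have hel0 : 0 < e * l := by positivity
  have hMl0 : 0 < M * l := by positivity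
  have hlim : Tendsto (fun n => R ^ (-(d:ℝ)) * (C⁻¹ * ((1 - ∫ s, exp (-l * s) ∂(μ n))
      - (1 - ∫ s, exp (-(e * l) * s) ∂(μ n)) - (1 - ∫ s, exp (-(M * l) * s) ∂(μ n)) / M))) atTop
      (nhds (R ^ (-(d:ℝ)) * (C⁻¹ * ((1 - exp (-l ^ (α / 2))) - (1 - exp (-(e * l) ^ (α / 2)))
        - (1 - exp (-(M * l) ^ (α / 2))) / M)))) :=
    ((((hT l hl0.le).const_sub 1).sub ((hT _ hel0.le).const_sub 1)).sub
      (((hT _ hMl0.le).const_sub 1).div_const M)).const_mul C⁻¹ |>.const_mul _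
  have hle := le_of_tendsto_of_tendsto' hlim (hI y) fun n => by
    obtain ⟨δ, hδ, hsn⟩ := hs n
    have := hp n
    have hs0 : ∀ᵐ s ∂(μ n), 0 ≤ s := by filter_upwards [hsn] with s h using hδ.le.trans h
    have hi1 : Integrable (fun s => 1 - exp (-l * s)) (μ n) :=
      (integrable_const (1:ℝ)).sub (integrable_exp_of_nonneg (μ n) hs0 hl0.le)
    have hi2 : Integrable (fun s => 1 - exp (-(e * l) * s)) (μ n) :=
      (integrable_const (1:ℝ)).sub (integrable_exp_of_nonneg (μ n) hs0 hel0.le)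
    have hi3 : Integrable (fun s => (1 - exp (-(M * l) * s)) / M) (μ n) :=
      ((integrable_const (1:ℝ)).sub
      (integrable_exp_of_nonneg (μ n) hs0 hMl0.le)).div_const M
    have hone : ∀ l' : ℝ, 0 < l' → ∫ s, (1 - exp (-l' * s)) ∂(μ n)
        = 1 - ∫ s, exp (-l' * s) ∂(μ n) := by
      intro l' h'
      rw [integral_sub (integrable_const _) (integrable_exp_of_nonneg (μ n) hs0 h'.le)]
      simp
    have hi12 : Integrable (fun s => (1 - exp (-l * s)) - (1 - exp (-(e * l) * s))) (μ n) :=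
      hi1.sub hi2
    rw [← hone l hl0, ← hone _ hel0, ← hone _ hMl0, ← integral_div, ← integral_sub hi1 hi2,
      ← integral_sub hi12 hi3, ← integral_const_mul, ← integral_const_mul]
    refine integral_mono_ae (((hi12.sub hi3).const_mul _).const_mul _)
      (kernel_integrable d _ _ hδ hsn) ?_
    filter_upwards [hsn] with s hs
    have hs0 : 0 < s := hδ.trans_le hs
    rw [kernel_scale d hy hs0]
    refine mul_le_mul_of_nonneg_left ?_ (by positivity)
    rw [inv_mul_le_iff₀ hC]
    have := hk _ (mul_pos hl0 hs0)
    simpa only [neg_mul, mul_assoc] using this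
  refine le_trans ?_ hle
  rw [mul_rpow he.le hl0.le, mul_rpow hM.le hl0.le, ← hb, heb, hl, hb, inv_sq_rpow hy, ← hb]
  set z : ℝ := R ^ (-α) with hz
  have hz0 : 0 < z := rpow_pos_of_pos hy _
  have hz1 : z ≤ 1 := rpow_le_one_of_one_le_of_nonpos hy1 (by linarith)
  have g1 := one_sub_exp_lower hz0.le
  have g1' : z / 2 ≤ z / (1 + z) := by gcongr; linarith
  have g2 := Real.add_one_le_exp (-(1 / 8 * z))
  have g3 := Real.add_one_le_exp (-(M ^ b * z))
  have g4 : (1 - exp (-(M ^ b * z))) / M ≤ 1 / 8 * z := by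
    rw [← hMb, div_mul_eq_mul_div]
    gcongr; linarith
  have g5 : z / 4 ≤ (1 - exp (-z)) - (1 - exp (-(1 / 8 * z)))
      - (1 - exp (-(M ^ b * z))) / M := by linarith
  rw [show -((d:ℝ) + α) = -(d:ℝ) + -α by ring, rpow_add hy, ← hz]
  calc _ = R ^ (-(d:ℝ)) * (C⁻¹ * (z / 4)) := by rw [mul_inv]; ring
    _ ≤ _ := by gcongr

lemma profI_bounds (d : ℕ) (hd : 1 ≤ d) {α : ℝ} (h0 : 0 < α) (h2 : α < 2) :
    ∃ c C : ℝ, 0 < c ∧ 0 < C ∧ ∀ y : EuclideanSpace ℝ (Fin d),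
      c * (1 + ‖y‖) ^ (-((d : ℝ) + α)) ≤ profI d α y ∧
      profI d α y ≤ C * (1 + ‖y‖) ^ (-((d : ℝ) + α)) := by
  obtain ⟨c, hc, hlow⟩ := profI_lower d hd h0 h2
  obtain ⟨C, hC, hup⟩ := profI_upper d hd h0 h2
  set q : ℝ := (d : ℝ) + α with hq
  have hq0 : 0 < q := by positivity
  have hd0 : 0 < d := hd
  let y1 : EuclideanSpace ℝ (Fin d) := EuclideanSpace.single ⟨0, hd0⟩ (1:ℝ)
  have hy1 : ‖y1‖ = 1 := by simp [y1]
  have hbase := hlow y1 hy1.ge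
  rw [hy1, one_rpow, mul_one] at hbase
  have hP0 : 0 < profI d α 0 :=
    (hc.trans_le hbase).trans_le (profI_anti d hd h0 h2 (by simp))
  refine ⟨c, 2 ^ q * (C + profI d α 0), hc, by positivity, fun y => ⟨?_, ?_⟩⟩
  · rcases le_total 1 ‖y‖ with h | h
    · refine le_trans ?_ (hlow y h)
      have : (1 + ‖y‖) ^ (-q) ≤ ‖y‖ ^ (-q) :=
        rpow_le_rpow_of_nonpos (by linarith) (by linarith) (by linarith)
      gcongr
    · refine le_trans ?_ (hbase.trans (profI_anti d hd h0 h2 (by rw [hy1]; exact h)))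
      have : (1 + ‖y‖) ^ (-q) ≤ 1 :=
        rpow_le_one_of_one_le_of_nonpos (by linarith [norm_nonneg y]) (by linarith)
      nlinarith
  · have h2q : (2:ℝ) ^ q * 2 ^ (-q) = 1 := by
      rw [← rpow_add two_pos]; simp
    have h2p : (0:ℝ) < 2 ^ q := by positivity
    rcases le_total 1 ‖y‖ with h | h
    · have hy : 0 < ‖y‖ := by linarith
      refine (hup y hy).trans ?_
      have h3 : (2 * ‖y‖) ^ (-q) ≤ (1 + ‖y‖) ^ (-q) :=
        rpow_le_rpow_of_nonpos (by linarith) (by linarith) (by linarith)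
      rw [mul_rpow (by norm_num) hy.le] at h3
      calc C * ‖y‖ ^ (-q) = 2 ^ q * C * (2 ^ (-q) * ‖y‖ ^ (-q)) := by
            linear_combination (-(C * ‖y‖ ^ (-q))) * h2q
        _ ≤ 2 ^ q * (C + profI d α 0) * (1 + ‖y‖) ^ (-q) := by
            gcongr; linarith
    · refine (profI_anti d hd h0 h2 (y := 0) (by simp)).trans ?_
      have h3 : (2:ℝ) ^ (-q) ≤ (1 + ‖y‖) ^ (-q) :=
        rpow_le_rpow_of_nonpos (by linarith [norm_nonneg y]) (by linarith) (by linarith)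
      calc profI d α 0 = 2 ^ q * profI d α 0 * 2 ^ (-q) := by
            linear_combination (-(profI d α 0)) * h2q
        _ ≤ 2 ^ q * (C + profI d α 0) * (1 + ‖y‖) ^ (-q) := by
            gcongr; linarith

lemma heatKer_eq (d : ℕ) {α : ℝ} (hα : 0 < α) {t : ℝ} (ht : 0 < t)
    (x : EuclideanSpace ℝ (Fin d)) :
    heatKer d α t x = (2 * Real.pi) ^ (-(d : ℝ)) *
      ((t ^ (1 / α)) ^ (-(d : ℝ)) * profI d α ((t ^ (1 / α))⁻¹ • x)) := by
  unfold heatKer profI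
  congr 1
  set r : ℝ := t ^ (1 / α) with hr
  have hr0 : 0 < r := rpow_pos_of_pos ht _
  have hrt : r ^ α = t := by
    rw [hr, ← rpow_mul ht.le, one_div_mul_cancel hα.ne', rpow_one]
  have h := Measure.integral_comp_smul_of_nonneg (volume : Measure (EuclideanSpace ℝ (Fin d)))
    (fun ξ => Real.cos ⟪r⁻¹ • x, ξ⟫ * exp (-‖ξ‖ ^ α)) r (hR := hr0.le)
  rw [finrank_euclideanSpace_fin, smul_eq_mul] at h
  rw [rpow_neg hr0.le, rpow_natCast, ← h]
  refine integral_congr_ae (ae_of_all _ fun ξ => ?_)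
  simp only [inner_smul_left, inner_smul_right, norm_smul, Real.norm_eq_abs, abs_of_pos hr0]
  rw [mul_rpow hr0.le (norm_nonneg _), hrt]
  congr 2
  · simp; field_simp
  · ring

/-- Two-sided sharp estimate of the stable heat kernel:
`p(t,x) ≈ t/(t^{1/α}+|x|)^{d+α}`. -/
theorem heatKer_two_sided_estimate (d : ℕ) (hd : 1 ≤ d) (α : ℝ) (hα : α ∈ Set.Ioo (1:ℝ) 2) :
    ∃ C : ℝ, 1 ≤ C ∧ ∀ t, 0 < t → ∀ x : EuclideanSpace ℝ (Fin d),
      C⁻¹ * (t / (t ^ (1 / α) + ‖x‖) ^ ((d : ℝ) + α)) ≤ heatKer d α t x ∧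
      heatKer d α t x ≤ C * (t / (t ^ (1 / α) + ‖x‖) ^ ((d : ℝ) + α)) := by
  have h0 : 0 < α := by linarith [hα.1]
  obtain ⟨c, C, hc, hC, hb⟩ := profI_bounds d hd h0 hα.2
  set K : ℝ := (2 * Real.pi) ^ (-(d : ℝ)) with hK
  have hK0 : 0 < K := rpow_pos_of_pos (by positivity) _
  refine ⟨max 1 (max (K * C) (K * c)⁻¹), le_max_left _ _, fun t ht x => ?_⟩
  set D := max 1 (max (K * C) (K * c)⁻¹) with hD
  have hD0 : 0 < D := lt_of_lt_of_le one_pos (le_max_left _ _)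
  have hDC : K * C ≤ D := (le_max_left _ _).trans (le_max_right _ _)
  have hDc : D⁻¹ ≤ K * c := by
    rw [inv_le_comm₀ hD0 (by positivity)]
    exact (le_max_right _ _).trans (le_max_right _ _)
  set r : ℝ := t ^ (1 / α) with hr
  have hr0 : 0 < r := rpow_pos_of_pos ht _
  have hrt : r ^ α = t := by
    rw [hr, ← rpow_mul ht.le, one_div_mul_cancel h0.ne', rpow_one]
  have hmain : t / (r + ‖x‖) ^ ((d : ℝ) + α)
      = r ^ (-(d : ℝ)) * (1 + ‖r⁻¹ • x‖) ^ (-((d : ℝ) + α)) := by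
    have e1 : r + ‖x‖ = r * (1 + ‖r⁻¹ • x‖) := by
      rw [norm_smul, norm_inv, Real.norm_eq_abs, abs_of_pos hr0]; field_simp
    have hp : 0 < 1 + ‖r⁻¹ • x‖ := by positivity
    rw [e1, mul_rpow hr0.le hp.le, rpow_add hr0, hrt, rpow_neg hp.le, rpow_neg hr0.le]
    have := rpow_pos_of_pos hp ((d : ℝ) + α)
    have := rpow_pos_of_pos hr0 (d : ℝ)
    field_simp
  rw [heatKer_eq d h0 ht x, ← hr, ← hK, hmain]
  obtain ⟨b1, b2⟩ := hb (r⁻¹ • x)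
  set Q : ℝ := (1 + ‖r⁻¹ • x‖) ^ (-((d : ℝ) + α)) with hQ
  have hQ0 : 0 < Q := rpow_pos_of_pos (by positivity) _
  have hrd : 0 < r ^ (-(d : ℝ)) := rpow_pos_of_pos hr0 _
  constructor
  · calc D⁻¹ * (r ^ (-(d : ℝ)) * Q) ≤ K * c * (r ^ (-(d : ℝ)) * Q) := by gcongr
      _ = K * (r ^ (-(d : ℝ)) * (c * Q)) := by ring
      _ ≤ _ := by gcongr
  · calc _ ≤ K * (r ^ (-(d : ℝ)) * (C * Q)) := by gcongr
      _ = K * C * (r ^ (-(d : ℝ)) * Q) := by ring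
      _ ≤ _ := by gcongr
end

section
/- There exists a constant C = C(d,α) ≥ 1 such that for all t > 0 and x ∈ ℝ^d, C^{-1} · t|x|/(t^{1/α} + |x|)^{d+2+α} ≤ |∇_x p(t,x)| ≤ C · t|x|/(t^{1/α} + |x|)^{d+2+α}, where ∇_x p(t,x) denotes the spatial gradient of the kernel and |·| the Euclidean norm. -/
open MeasureTheory Real Filter
open scoped ENNReal RealInnerProductSpace

lemma hk_integrable_w (d : ℕ) (hd : 1 ≤ d) (α b : ℝ) (hα : 0 < α) (hb : 0 < b) (k : ℕ) :
    Integrable (fun ξ : EuclideanSpace ℝ (Fin d) => ‖ξ‖ ^ k * Real.exp (-b * ‖ξ‖ ^ α)) := by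
  have : Nonempty (Fin d) := ⟨⟨0, hd⟩⟩
  have : Nontrivial (EuclideanSpace ℝ (Fin d)) := inferInstance
  rw [integrable_fun_norm_addHaar volume (f := fun r : ℝ => r ^ k * Real.exp (-b * r ^ α))]
  have h := integrableOn_rpow_mul_exp_neg_mul_rpow (p := α) (s := ((d - 1 + k : ℕ) : ℝ)) (b := b)
    (by have : (0:ℝ) ≤ ((d - 1 + k : ℕ) : ℝ) := Nat.cast_nonneg _
        linarith) hα hb
  refine h.congr_fun ?_ measurableSet_Ioi
  intro y hy
  simp only [smul_eq_mul, finrank_euclideanSpace, Fintype.card_fin, Real.rpow_natCast]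
  rw [pow_add]; ring

lemma hk_grad (d : ℕ) (w : (EuclideanSpace ℝ (Fin d)) → ℝ) (h0 : Integrable w) (h1 : Integrable (fun ξ => ‖ξ‖ * w ξ))
    (x : EuclideanSpace ℝ (Fin d)) :
    HasGradientAt (fun x : EuclideanSpace ℝ (Fin d) => ∫ ξ, Real.cos ⟪x, ξ⟫ * w ξ)
      (-∫ ξ, (Real.sin ⟪x, ξ⟫ * w ξ) • ξ) x := by
  rw [hasGradientAt_iff_hasFDerivAt]
  have hI : Integrable (fun ξ : EuclideanSpace ℝ (Fin d) => (Real.sin ⟪x, ξ⟫ * w ξ) • ξ) := by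
    refine h1.norm.mono' ?_ ?_
    · refine AEStronglyMeasurable.smul (AEStronglyMeasurable.mul ?_ h0.1) (by fun_prop)
      exact Continuous.aestronglyMeasurable (by fun_prop)
    · refine Eventually.of_forall fun ξ => ?_
      simp only [norm_smul, norm_mul, Real.norm_eq_abs, abs_norm]
      have := Real.abs_sin_le_one ⟪x, ξ⟫
      have h2 : 0 ≤ |w ξ| * ‖ξ‖ := by positivity
      nlinarith
  have key := hasFDerivAt_integral_of_dominated_of_fderiv_le (𝕜 := ℝ) (μ := (volume : Measure (EuclideanSpace ℝ (Fin d))))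
    (F := fun (x ξ : EuclideanSpace ℝ (Fin d)) => Real.cos ⟪x, ξ⟫ * w ξ)
    (F' := fun (x ξ : EuclideanSpace ℝ (Fin d)) => -((InnerProductSpace.toDual ℝ (EuclideanSpace ℝ (Fin d))) ((Real.sin ⟪x, ξ⟫ * w ξ) • ξ)))
    (x₀ := x) (s := Set.univ) (bound := fun ξ => ‖‖ξ‖ * w ξ‖) Filter.univ_mem ?_ ?_ ?_ ?_ h1.norm ?_
  · refine key.congr_fderiv ?_
    rw [integral_neg, map_neg]
    congr 1
    exact ((InnerProductSpace.toDual ℝ (EuclideanSpace ℝ (Fin d))).toContinuousLinearEquiv.toContinuousLinearMap.integral_comp_comm hI)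
  · refine Eventually.of_forall fun y => ?_
    refine AEStronglyMeasurable.mul ?_ h0.1
    exact Continuous.aestronglyMeasurable (by fun_prop)
  · refine h0.norm.mono' ?_ ?_
    · refine AEStronglyMeasurable.mul ?_ h0.1
      exact Continuous.aestronglyMeasurable (by fun_prop)
    · refine Eventually.of_forall fun ξ => ?_
      simp only [norm_mul, Real.norm_eq_abs]
      have := Real.abs_cos_le_one ⟪x, ξ⟫
      have h2 : 0 ≤ |w ξ| := by positivity
      nlinarith
  · refine AEStronglyMeasurable.neg ?_
    exact (InnerProductSpace.toDual ℝ (EuclideanSpace ℝ (Fin d))).continuous.comp_aestronglyMeasurable hI.1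
  · refine Eventually.of_forall fun ξ y _ => ?_
    rw [norm_neg, LinearIsometryEquiv.norm_map]
    simp only [norm_smul, norm_mul, Real.norm_eq_abs, abs_norm]
    have := Real.abs_sin_le_one ⟪y, ξ⟫
    have h2 : 0 ≤ |w ξ| * ‖ξ‖ := by positivity
    nlinarith
  · refine Eventually.of_forall fun ξ y _ => ?_
    have hin : HasFDerivAt (fun y : EuclideanSpace ℝ (Fin d) => ⟪y, ξ⟫) (innerSL ℝ ξ) y := by
      have := (innerSL ℝ ξ).hasFDerivAt (x := y)
      refine this.congr_of_eventuallyEq (Eventually.of_forall fun z => ?_)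
      simp [real_inner_comm]
    refine (hin.cos.mul_const (w ξ)).congr_fderiv ?_
    ext v
    simp
    ring

lemma hk_gauss (d : ℕ) (s : ℝ) (hs : 0 < s) (x : EuclideanSpace ℝ (Fin d)) :
    ∫ ξ : EuclideanSpace ℝ (Fin d), Real.cos ⟪x, ξ⟫ * Real.exp (-s * ‖ξ‖ ^ 2) =
      (π / s) ^ ((d : ℝ) / 2) * Real.exp (-‖x‖ ^ 2 / (4 * s)) := by
  have h := GaussianFourier.integral_cexp_neg_mul_sq_norm_add (b := (s : ℂ)) (by simpa using hs) Complex.I x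
  have h1 : ∀ v : EuclideanSpace ℝ (Fin d), (Complex.exp (-(s:ℂ) * ‖v‖ ^ 2 + Complex.I * ⟪x, v⟫)).re =
      Real.cos ⟪x, v⟫ * Real.exp (-s * ‖v‖ ^ 2) := by
    intro v
    rw [Complex.exp_re]
    have e1 : (-(s:ℂ) * ‖v‖ ^ 2 + Complex.I * ⟪x, v⟫).re = -s * ‖v‖ ^ 2 := by
      simp [← Complex.ofReal_pow]
    have e2 : (-(s:ℂ) * ‖v‖ ^ 2 + Complex.I * ⟪x, v⟫).im = ⟪x, v⟫ := by
      simp [← Complex.ofReal_pow]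
    rw [e1, e2, mul_comm]
  have hIntg : Integrable (fun v : EuclideanSpace ℝ (Fin d) => Complex.exp (-(s:ℂ) * ‖v‖ ^ 2 + Complex.I * ⟪x, v⟫)) :=
    GaussianFourier.integrable_cexp_neg_mul_sq_norm_add (by simpa using hs) _ _
  have h2 : (∫ v : EuclideanSpace ℝ (Fin d), Complex.exp (-(s:ℂ) * ‖v‖ ^ 2 + Complex.I * ⟪x, v⟫)).re =
      ∫ v : EuclideanSpace ℝ (Fin d), Real.cos ⟪x, v⟫ * Real.exp (-s * ‖v‖ ^ 2) := by
    have := integral_re hIntg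
    simp only [RCLike.re_eq_complex_re] at this
    rw [← this]
    exact integral_congr_ae (Eventually.of_forall fun v => (h1 v))
  rw [← h2, h]
  have e3 : ((π : ℂ) / (s:ℂ)) ^ ((Module.finrank ℝ (EuclideanSpace ℝ (Fin d)) : ℂ) / 2) =
      (((π / s) ^ ((d : ℝ) / 2) : ℝ) : ℂ) := by
    rw [Complex.ofReal_cpow (by positivity)]
    simp
  have e4 : Complex.exp (Complex.I ^ 2 * (‖x‖:ℂ) ^ 2 / (4 * (s:ℂ))) =
      ((Real.exp (-‖x‖ ^ 2 / (4 * s)) : ℝ) : ℂ) := by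
    simp [Complex.I_sq]
  rw [e3, e4, ← Complex.ofReal_mul, Complex.ofReal_re]

lemma hk_gauss_grad (d : ℕ) (hd : 1 ≤ d) (s : ℝ) (hs : 0 < s) (x : EuclideanSpace ℝ (Fin d)) :
    ∫ ξ : EuclideanSpace ℝ (Fin d), (Real.sin ⟪x, ξ⟫ * Real.exp (-s * ‖ξ‖ ^ 2)) • ξ =
      ((π / s) ^ ((d : ℝ) / 2) * Real.exp (-‖x‖ ^ 2 / (4 * s)) / (2 * s)) • x := by
  have i0 := hk_integrable_w d hd 2 s (by norm_num) hs 0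
  have i1 := hk_integrable_w d hd 2 s (by norm_num) hs 1
  simp only [Real.rpow_two, pow_zero, one_mul, pow_one] at i0 i1
  have h := hk_grad d _ i0 i1 x
  have hf : (fun x : EuclideanSpace ℝ (Fin d) => ∫ ξ : EuclideanSpace ℝ (Fin d), Real.cos ⟪x, ξ⟫ * Real.exp (-s * ‖ξ‖ ^ 2)) =
      fun x => (π / s) ^ ((d : ℝ) / 2) * Real.exp (-‖x‖ ^ 2 / (4 * s)) := by
    funext y; exact hk_gauss d s hs y
  rw [hf] at h
  have h2 : HasGradientAt (fun x : EuclideanSpace ℝ (Fin d) => (π / s) ^ ((d : ℝ) / 2) * Real.exp (-‖x‖ ^ 2 / (4 * s)))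
      (-(((π / s) ^ ((d : ℝ) / 2) * Real.exp (-‖x‖ ^ 2 / (4 * s)) / (2 * s)) • x)) x := by
    rw [hasGradientAt_iff_hasFDerivAt]
    have hn : HasFDerivAt (fun y : EuclideanSpace ℝ (Fin d) => ‖y‖ ^ 2) (2 • innerSL ℝ x) x :=
      (hasStrictFDerivAt_norm_sq x).hasFDerivAt
    have h3 : HasFDerivAt (fun y : EuclideanSpace ℝ (Fin d) => -‖y‖ ^ 2 / (4 * s)) ((4 * s)⁻¹ • (-(2 • innerSL ℝ x) : (EuclideanSpace ℝ (Fin d)) →L[ℝ] ℝ)) x := by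
      have := hn.neg.const_mul (4 * s)⁻¹
      refine this.congr_of_eventuallyEq (Eventually.of_forall fun z => ?_)
      simp only [Pi.neg_apply]
      ring
    refine (h3.exp.const_mul ((π / s) ^ ((d : ℝ) / 2))).congr_fderiv ?_
    ext v
    simp
    field_simp
    ring
  exact neg_injective (h.unique h2)

noncomputable def hkN (δ : ℝ) (ν : Measure ℝ) : ℕ → Measure ℝ
  | 0 => Measure.dirac δ
  | n + 1 => Measure.conv ν (hkN δ ν n)

lemma hkN_fin (δ : ℝ) (ν : Measure ℝ) [IsFiniteMeasure ν] : ∀ n, IsFiniteMeasure (hkN δ ν n)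
  | 0 => by unfold hkN; infer_instance
  | n + 1 => by
    have := hkN_fin δ ν n
    unfold hkN; infer_instance

lemma hkN_supp (δ : ℝ) (ν : Measure ℝ) [IsFiniteMeasure ν] (hν : ∀ᵐ s ∂ν, 0 ≤ s) (n : ℕ) :
    ∀ᵐ s ∂(hkN δ ν n), δ ≤ s := by
  induction n with
  | zero => unfold hkN; rw [ae_dirac_iff measurableSet_Ici]
  | succ n ih =>
    have := hkN_fin δ ν n
    unfold hkN
    have hms : MeasurableSet {s : ℝ | ¬ δ ≤ s} := by
      simp only [not_le]; exact measurableSet_Iio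
    rw [ae_iff, ← lintegral_indicator_one hms,
      Measure.lintegral_conv (measurable_one.indicator hms)]
    rw [← lintegral_zero (μ := ν)]
    refine lintegral_congr_ae ?_
    filter_upwards [hν] with x hx
    rw [← lintegral_zero (μ := hkN δ ν n)]
    refine lintegral_congr_ae ?_
    filter_upwards [ih] with y hy
    simp; linarith

lemma hkN_lap (δ : ℝ) (ν : Measure ℝ) [IsFiniteMeasure ν] (l : ℝ) (n : ℕ) :
    ∫⁻ s, ENNReal.ofReal (Real.exp (-l * s)) ∂(hkN δ ν n) =
      ENNReal.ofReal (Real.exp (-l * δ)) *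
        (∫⁻ s, ENNReal.ofReal (Real.exp (-l * s)) ∂ν) ^ n := by
  induction n with
  | zero => unfold hkN; rw [lintegral_dirac' _ (by fun_prop)]; simp
  | succ n ih =>
    have := hkN_fin δ ν n
    unfold hkN
    rw [Measure.lintegral_conv (by fun_prop)]
    have : ∀ x y : ℝ, ENNReal.ofReal (Real.exp (-l * (x + y))) =
        ENNReal.ofReal (Real.exp (-l * x)) * ENNReal.ofReal (Real.exp (-l * y)) := by
      intro x y
      rw [← ENNReal.ofReal_mul (by positivity), ← Real.exp_add]; ring_nf
    simp_rw [this]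
    simp_rw [lintegral_const_mul' _ _ ENNReal.ofReal_ne_top, ih]
    rw [lintegral_mul_const _ (by fun_prop)]
    ring

lemma hk_int_exp (ν : Measure ℝ) [IsFiniteMeasure ν] (hν : ∀ᵐ s ∂ν, 0 ≤ s) (l : ℝ) (hl : 0 ≤ l) :
    Integrable (fun s => Real.exp (-l * s)) ν := by
  refine (integrable_const (1:ℝ)).mono' (by fun_prop) ?_
  filter_upwards [hν] with s hs
  rw [Real.norm_eq_abs, abs_of_pos (Real.exp_pos _)]
  apply Real.exp_le_one_iff.2
  nlinarith [mul_nonneg hl hs]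

lemma hk_cp (δ : ℝ) (hδ : 0 < δ) (ν : Measure ℝ) [IsFiniteMeasure ν] (hν : ∀ᵐ s ∂ν, 0 ≤ s) :
    ∃ η : Measure ℝ, (∀ᵐ s ∂η, 0 < s) ∧ ∀ l : ℝ, 0 ≤ l →
      ∫⁻ s, ENNReal.ofReal (Real.exp (-l * s)) ∂η =
        ENNReal.ofReal (Real.exp (-(δ * l + ∫ s, (1 - Real.exp (-l * s)) ∂ν))) := by
  set m := ν.real Set.univ with hm
  refine ⟨Measure.sum (fun n => ENNReal.ofReal (Real.exp (-m) / (n.factorial : ℝ)) • hkN δ ν n), ?_, ?_⟩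
  · rw [Measure.ae_sum_iff]
    intro n
    refine Measure.ae_smul_measure ?_ _
    filter_upwards [hkN_supp δ ν hν n] with s hs
    linarith
  · intro l hl
    have hI := hk_int_exp ν hν l hl
    rw [lintegral_sum_measure]
    simp_rw [lintegral_smul_measure, hkN_lap]
    set ℓ := ∫ s, Real.exp (-l * s) ∂ν with hℓ
    have hℓ0 : 0 ≤ ℓ := integral_nonneg fun s => (Real.exp_pos _).le
    rw [← ofReal_integral_eq_lintegral_ofReal hI (Eventually.of_forall fun s => (Real.exp_pos _).le)]
    have e1 : ∫ s, (1 - Real.exp (-l * s)) ∂ν = m - ℓ := by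
      rw [integral_sub (integrable_const _) hI]; simp [hm, hℓ]
    rw [e1]
    have e2 : ∀ n : ℕ, ENNReal.ofReal (Real.exp (-m) / (n.factorial : ℝ)) • (ENNReal.ofReal (Real.exp (-l * δ)) * ENNReal.ofReal ℓ ^ n)
        = ENNReal.ofReal ((Real.exp (-m) * Real.exp (-l * δ)) * (ℓ ^ n / (n.factorial : ℝ))) := by
      intro n
      rw [smul_eq_mul, ← ENNReal.ofReal_pow hℓ0, ← ENNReal.ofReal_mul (by positivity), ← ENNReal.ofReal_mul (by positivity)]
      congr 1; ring
    rw [tsum_congr e2]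
    have hs := (NormedSpace.expSeries_div_hasSum_exp (𝔸 := ℝ) ℓ)
    rw [← Real.exp_eq_exp_ℝ] at hs
    have hs2 := hs.mul_left (Real.exp (-m) * Real.exp (-l * δ))
    rw [← ENNReal.ofReal_tsum_of_nonneg (fun n => by positivity) hs2.summable, hs2.tsum_eq,
      ← Real.exp_add, ← Real.exp_add]
    congr 2; ring

lemma hk_rp (b : ℝ) (s : ℝ) (hs : 0 < s) : s * s ^ (-1 - b) = s ^ (-b) := by
  rw [show -b = 1 + (-1 - b) by ring, Real.rpow_add hs, Real.rpow_one]

lemma hk_one_sub (l s : ℝ) : 1 - Real.exp (-l * s) ≤ l * s := by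
  have := Real.add_one_le_exp (-l * s); linarith

lemma hk_one_sub_nonneg (l s : ℝ) (hl : 0 ≤ l) (hs : 0 ≤ s) : 0 ≤ 1 - Real.exp (-l * s) := by
  have : Real.exp (-l * s) ≤ 1 := Real.exp_le_one_iff.2 (by nlinarith [mul_nonneg hl hs])
  linarith

lemma hk_levy_int (b : ℝ) (hb : 0 < b) (hb1 : b < 1) (l : ℝ) (hl : 0 ≤ l) :
    IntegrableOn (fun s : ℝ => (1 - Real.exp (-l * s)) * s ^ (-1 - b)) (Set.Ioi 0) := by
  have hmeas : ∀ S : Set ℝ, AEStronglyMeasurable (fun s : ℝ => (1 - Real.exp (-l * s)) * s ^ (-1 - b)) (volume.restrict S) :=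
    fun S => Measurable.aestronglyMeasurable (by fun_prop)
  rw [← Set.Ioc_union_Ioi_eq_Ioi (zero_le_one' ℝ)]
  refine IntegrableOn.union ?_ ?_
  · have h1 : IntegrableOn (fun s : ℝ => l * s ^ (-b)) (Set.Ioc 0 1) :=
      ((intervalIntegrable_iff_integrableOn_Ioc_of_le zero_le_one).1
        (intervalIntegral.intervalIntegrable_rpow' (by linarith))).const_mul l
    refine h1.mono' (hmeas _) ?_
    filter_upwards [ae_restrict_mem measurableSet_Ioc] with s hs
    have hs0 : 0 < s := hs.1
    rw [Real.norm_eq_abs, abs_of_nonneg (mul_nonneg (hk_one_sub_nonneg l s hl hs0.le) (by positivity)),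
      ← hk_rp b s hs0, ← mul_assoc]
    exact mul_le_mul_of_nonneg_right (hk_one_sub l s) (by positivity)
  · have h1 : IntegrableOn (fun s : ℝ => s ^ (-1 - b)) (Set.Ioi 1) :=
      integrableOn_Ioi_rpow_of_lt (by linarith) one_pos
    refine h1.mono' (hmeas _) ?_
    filter_upwards [ae_restrict_mem measurableSet_Ioi] with s hs
    have hs0 : 0 < s := lt_trans one_pos hs
    rw [Real.norm_eq_abs, abs_of_nonneg (mul_nonneg (hk_one_sub_nonneg l s hl hs0.le) (by positivity))]
    have : 0 < Real.exp (-l * s) := Real.exp_pos _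
    have h3 : 0 < s ^ (-1 - b) := by positivity
    nlinarith

lemma hk_levy_scale (b : ℝ) (hb : 0 < b) (l : ℝ) (hl : 0 ≤ l) :
    ∫ s in Set.Ioi (0:ℝ), (1 - Real.exp (-l * s)) * s ^ (-1 - b) =
      l ^ b * ∫ s in Set.Ioi (0:ℝ), (1 - Real.exp (-s)) * s ^ (-1 - b) := by
  rcases hl.eq_or_lt with rfl | hl
  · simp [Real.zero_rpow hb.ne']
  have h := integral_comp_mul_left_Ioi (fun s : ℝ => (1 - Real.exp (-s)) * s ^ (-1 - b)) 0 hl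
  rw [mul_zero, smul_eq_mul] at h
  have e : l ^ b * l⁻¹ = l ^ (1 + b) * (l⁻¹ * l⁻¹) := by
    rw [Real.rpow_add hl, Real.rpow_one]; field_simp
  have e2 : l ^ b = l ^ (1 + b) * l⁻¹ := by
    rw [Real.rpow_add hl, Real.rpow_one]; field_simp
  rw [e2, mul_assoc, ← h, ← integral_const_mul]
  refine setIntegral_congr_fun measurableSet_Ioi fun s hs => ?_
  have hs0 : 0 < s := hs
  rw [Real.mul_rpow hl.le hs0.le, neg_mul]
  have e3 : l ^ (1 + b) * l ^ (-1 - b) = 1 := by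
    rw [← Real.rpow_add hl]; ring_nf; simp
  linear_combination (-(1 - Real.exp (-(l * s))) * s ^ (-1 - b)) * e3

lemma hk_levy_pos (b : ℝ) (hb : 0 < b) (hb1 : b < 1) :
    0 < ∫ s in Set.Ioi (0:ℝ), (1 - Real.exp (-s)) * s ^ (-1 - b) := by
  have hI := hk_levy_int b hb hb1 1 zero_le_one
  simp only [neg_mul, one_mul] at hI
  have hpos : ∀ s ∈ Set.Ioi (0:ℝ), 0 < (1 - Real.exp (-s)) * s ^ (-1 - b) := by
    intro s hs
    have hs0 : 0 < s := hs
    have : Real.exp (-s) < 1 := by simpa using hs0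
    have h3 : 0 < s ^ (-1 - b) := by positivity
    exact mul_pos (by linarith) h3
  rw [setIntegral_pos_iff_support_of_nonneg_ae ?_ hI]
  · have : (Function.support fun s : ℝ => (1 - Real.exp (-s)) * s ^ (-1 - b)) ∩ Set.Ioi 0 = Set.Ioi 0 := by
      ext s; simp only [Set.mem_inter_iff, Function.mem_support, and_iff_right_iff_imp]
      exact fun hs => (hpos s hs).ne'
    rw [this]; simp
  · filter_upwards [ae_restrict_mem measurableSet_Ioi] with s hs
    exact (hpos s hs).le

lemma hk_sub_eps (b : ℝ) (hb : 0 < b) (hb1 : b < 1) : ∃ K : ℝ, ∀ ε : ℝ, 0 < ε →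
    ∃ (φ : ℝ → ℝ) (η : Measure ℝ), (∀ᵐ s ∂η, 0 < s) ∧ ∀ l : ℝ, 0 ≤ l →
      (∫⁻ s, ENNReal.ofReal (Real.exp (-l * s)) ∂η = ENNReal.ofReal (Real.exp (-φ l))) ∧
      l ^ b ≤ φ l ∧ φ l ≤ l ^ b + K * ε ^ (1 - b) * l := by
  set A := ∫ s in Set.Ioi (0:ℝ), (1 - Real.exp (-s)) * s ^ (-1 - b) with hA
  have hA0 : 0 < A := hk_levy_pos b hb hb1
  refine ⟨1 / (A * (1 - b)), fun ε hε => ?_⟩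
  set δ := 1 / (A * (1 - b)) * ε ^ (1 - b) with hδ
  have hδ0 : 0 < δ := by
    have : 0 < 1 - b := by linarith
    positivity
  have hδA : ∫ s in Set.Ioc 0 ε, s ^ (-b) = A * δ := by
    rw [← intervalIntegral.integral_of_le hε.le, integral_rpow (Or.inl (by linarith)), Real.zero_rpow (by linarith)]
    have : 1 - b ≠ 0 := by linarith
    rw [hδ, show -b + 1 = 1 - b by ring]
    field_simp; ring
  have hnu : Integrable (fun s : ℝ => s ^ (-1 - b) / A) (volume.restrict (Set.Ioi ε)) :=
    (integrableOn_Ioi_rpow_of_lt (by linarith) hε).div_const A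
  set ν : Measure ℝ := (volume.restrict (Set.Ioi ε)).withDensity (fun s => ENNReal.ofReal (s ^ (-1 - b) / A)) with hν
  have hfin : IsFiniteMeasure ν := isFiniteMeasure_withDensity_ofReal hnu.2
  have hsupp : ∀ᵐ s ∂ν, 0 ≤ s := by
    refine (withDensity_absolutelyContinuous _ _).ae_le ?_
    filter_upwards [ae_restrict_mem measurableSet_Ioi] with s hs
    exact (lt_trans hε hs).le
  obtain ⟨η, h1, h2⟩ := hk_cp δ hδ0 ν hsupp
  refine ⟨fun l => δ * l + ∫ s, (1 - Real.exp (-l * s)) ∂ν, η, h1, fun l hl => ⟨h2 l hl, ?_⟩⟩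
  have e1 : ∫ s, (1 - Real.exp (-l * s)) ∂ν = (∫ s in Set.Ioi ε, (1 - Real.exp (-l * s)) * s ^ (-1 - b)) / A := by
    rw [hν, integral_withDensity_eq_integral_toReal_smul (by fun_prop) (by simp), ← integral_div]
    refine setIntegral_congr_fun measurableSet_Ioi fun s hs => ?_
    have hs0 : 0 < s := lt_trans hε hs
    simp only [smul_eq_mul]
    rw [ENNReal.toReal_ofReal (by positivity)]; ring
  have hI := hk_levy_int b hb hb1 l hl
  have e2 : l ^ b * A = (∫ s in Set.Ioc 0 ε, (1 - Real.exp (-l * s)) * s ^ (-1 - b)) +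
      ∫ s in Set.Ioi ε, (1 - Real.exp (-l * s)) * s ^ (-1 - b) := by
    rw [← hk_levy_scale b hb l hl, ← Set.Ioc_union_Ioi_eq_Ioi hε.le]
    refine setIntegral_union ?_ measurableSet_Ioi ?_ ?_
    · exact Set.Ioc_disjoint_Ioi le_rfl
    · exact hI.mono_set Set.Ioc_subset_Ioi_self
    · exact hI.mono_set (Set.Ioi_subset_Ioi hε.le)
  have e3 : 0 ≤ ∫ s in Set.Ioc 0 ε, (1 - Real.exp (-l * s)) * s ^ (-1 - b) := by
    refine setIntegral_nonneg measurableSet_Ioc fun s hs => ?_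
    have hs0 : 0 < s := hs.1
    exact mul_nonneg (hk_one_sub_nonneg l s hl hs0.le) (by positivity)
  have e4 : ∫ s in Set.Ioc 0 ε, (1 - Real.exp (-l * s)) * s ^ (-1 - b) ≤ l * (A * δ) := by
    rw [← hδA, ← integral_const_mul]
    refine setIntegral_mono_on (hI.mono_set Set.Ioc_subset_Ioi_self) ?_ measurableSet_Ioc fun s hs => ?_
    · exact ((intervalIntegrable_iff_integrableOn_Ioc_of_le hε.le).1
        (intervalIntegral.intervalIntegrable_rpow' (by linarith))).const_mul l
    · have hs0 : 0 < s := hs.1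
      rw [← hk_rp b s hs0, ← mul_assoc]
      exact mul_le_mul_of_nonneg_right (hk_one_sub l s) (by positivity)
  simp only [e1]
  set X := ∫ s in Set.Ioc 0 ε, (1 - Real.exp (-l * s)) * s ^ (-1 - b)
  set Y := ∫ s in Set.Ioi ε, (1 - Real.exp (-l * s)) * s ^ (-1 - b)
  have e5 : l ^ b = X / A + Y / A := by
    rw [← add_div, ← e2]; field_simp
  have e6 : X / A ≤ l * δ := by
    rw [div_le_iff₀ hA0]; linarith
  have e7 : 0 ≤ X / A := by positivity
  constructor <;> linarith

lemma hk_sub (b : ℝ) (hb : 0 < b) (hb1 : b < 1) :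
    ∃ (φ : ℕ → ℝ → ℝ) (η : ℕ → Measure ℝ), (∀ n, ∀ᵐ s ∂(η n), 0 < s) ∧
      (∀ n, ∀ l : ℝ, 0 ≤ l →
        ∫⁻ s, ENNReal.ofReal (Real.exp (-l * s)) ∂(η n) = ENNReal.ofReal (Real.exp (-φ n l))) ∧
      (∀ n, ∀ l : ℝ, 0 ≤ l → l ^ b ≤ φ n l) ∧
      ∀ l : ℝ, 0 ≤ l → Tendsto (fun n => φ n l) atTop (nhds (l ^ b)) := by
  obtain ⟨K, hK⟩ := hk_sub_eps b hb hb1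
  choose φ η h1 h2 using fun n : ℕ => hK (1 / ((n : ℝ) + 1)) Nat.one_div_pos_of_nat
  refine ⟨φ, η, h1, fun n l hl => (h2 n l hl).1, fun n l hl => (h2 n l hl).2.1, fun l hl => ?_⟩
  refine tendsto_of_tendsto_of_tendsto_of_le_of_le tendsto_const_nhds ?_
    (fun n => (h2 n l hl).2.1) (fun n => (h2 n l hl).2.2)
  have t1 : Tendsto (fun n : ℕ => (1 / ((n : ℝ) + 1)) ^ (1 - b)) atTop (nhds 0) := by
    have := (tendsto_one_div_add_atTop_nhds_zero_nat (𝕜 := ℝ)).rpow_const (p := 1 - b) (Or.inr (by linarith))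
    rwa [Real.zero_rpow (by linarith)] at this
  have t2 := ((t1.const_mul K).mul_const l).const_add (l ^ b)
  simpa using t2

lemma hk_lap_facts (η : Measure ℝ) (φ : ℝ → ℝ) (hs : ∀ᵐ s ∂η, 0 < s)
    (hl : ∀ l : ℝ, 0 ≤ l →
      ∫⁻ s, ENNReal.ofReal (Real.exp (-l * s)) ∂η = ENNReal.ofReal (Real.exp (-φ l))) :
    IsFiniteMeasure η ∧ (∀ l : ℝ, 0 ≤ l → Integrable (fun s => Real.exp (-l * s)) η) ∧
    (∀ l : ℝ, 0 ≤ l → ∫ s, Real.exp (-l * s) ∂η = Real.exp (-φ l)) ∧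
    ∀ l : ℝ, 0 ≤ l → Integrable (fun s => 1 - Real.exp (-l * s)) η ∧
      ∫ s, (1 - Real.exp (-l * s)) ∂η = Real.exp (-φ 0) - Real.exp (-φ l) := by
  have h0 := hl 0 le_rfl
  simp only [neg_zero, zero_mul, Real.exp_zero, ENNReal.ofReal_one, lintegral_one] at h0
  have hfin : IsFiniteMeasure η := ⟨by rw [h0]; exact ENNReal.ofReal_lt_top⟩
  have hI : ∀ l : ℝ, 0 ≤ l → Integrable (fun s => Real.exp (-l * s)) η :=
    fun l hl => hk_int_exp η (hs.mono fun s h => h.le) l hl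
  have hV : ∀ l : ℝ, 0 ≤ l → ∫ s, Real.exp (-l * s) ∂η = Real.exp (-φ l) := by
    intro l h
    rw [integral_eq_lintegral_of_nonneg_ae (Eventually.of_forall fun s => (Real.exp_pos _).le)
      (by fun_prop), hl l h, ENNReal.toReal_ofReal (Real.exp_pos _).le]
  refine ⟨hfin, hI, hV, fun l h => ⟨(integrable_const _).sub (hI l h), ?_⟩⟩
  rw [integral_sub (integrable_const _) (hI l h), hV l h]
  have := hV 0 le_rfl
  simp only [neg_zero, zero_mul, Real.exp_zero] at this
  rw [this]

lemma hk_fub (d : ℕ) (hd : 1 ≤ d) (b : ℝ) (hb : 0 < b) (η : Measure ℝ) (φ : ℝ → ℝ)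
    (hs : ∀ᵐ s ∂η, 0 < s)
    (hl : ∀ l : ℝ, 0 ≤ l →
      ∫⁻ s, ENNReal.ofReal (Real.exp (-l * s)) ∂η = ENNReal.ofReal (Real.exp (-φ l)))
    (hφ : ∀ l : ℝ, 0 ≤ l → l ^ b ≤ φ l) (x : EuclideanSpace ℝ (Fin d)) (hx : x ≠ 0) :
    AEStronglyMeasurable (fun ξ : EuclideanSpace ℝ (Fin d) => (Real.sin ⟪x, ξ⟫ * Real.exp (-φ (‖ξ‖ ^ 2))) • ξ) volume ∧
    Integrable (fun s : ℝ => (π / s) ^ ((d : ℝ) / 2) * Real.exp (-‖x‖ ^ 2 / (4 * s)) / (2 * s)) η ∧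
    ∫ ξ : EuclideanSpace ℝ (Fin d), (Real.sin ⟪x, ξ⟫ * Real.exp (-φ (‖ξ‖ ^ 2))) • ξ =
      (∫ s, (π / s) ^ ((d : ℝ) / 2) * Real.exp (-‖x‖ ^ 2 / (4 * s)) / (2 * s) ∂η) • x := by
  obtain ⟨hfin, hI, hV, -⟩ := hk_lap_facts η φ hs hl
  set F : (EuclideanSpace ℝ (Fin d)) → ℝ → (EuclideanSpace ℝ (Fin d)) := fun ξ s => (Real.sin ⟪x, ξ⟫ * Real.exp (-‖ξ‖ ^ 2 * s)) • ξ with hF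
  have hmeas : AEStronglyMeasurable (Function.uncurry F) (volume.prod η) := by
    refine Continuous.aestronglyMeasurable ?_
    simp only [hF, Function.uncurry_def]; fun_prop
  have hn : ∀ ξ s, ‖F ξ s‖ = (|Real.sin ⟪x, ξ⟫| * ‖ξ‖) * Real.exp (-‖ξ‖ ^ 2 * s) := by
    intro ξ s
    simp only [hF, norm_smul, norm_mul, Real.norm_eq_abs, abs_of_pos (Real.exp_pos _)]; ring
  have hIntg : Integrable (Function.uncurry F) (volume.prod η) := by
    rw [integrable_prod_iff hmeas]
    constructor
    · refine Eventually.of_forall fun ξ => ?_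
      simp only [Function.uncurry_apply_pair, hF]
      exact ((hI _ (sq_nonneg _)).const_mul _).smul_const ξ
    · have hm2 := hmeas.norm.integral_prod_right'
      refine (hk_integrable_w d hd (2 * b) 1 (by linarith) one_pos 1).mono' hm2 ?_
      refine Eventually.of_forall fun ξ => ?_
      simp only [Function.uncurry_apply_pair, hn]
      rw [integral_const_mul, hV _ (sq_nonneg _), Real.norm_eq_abs, abs_of_nonneg (by positivity)]
      have h1 : Real.exp (-φ (‖ξ‖ ^ 2)) ≤ Real.exp (-1 * ‖ξ‖ ^ (2 * b)) := by
        apply Real.exp_le_exp.2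
        have := hφ (‖ξ‖ ^ 2) (sq_nonneg _)
        rw [← Real.rpow_natCast, ← Real.rpow_mul (norm_nonneg _)] at this
        push_cast at this
        rw [← Real.rpow_natCast]; push_cast; linarith
      have h2 : |Real.sin ⟪x, ξ⟫| * ‖ξ‖ ≤ ‖ξ‖ ^ 1 := by
        rw [pow_one]
        exact mul_le_of_le_one_left (norm_nonneg _) (Real.abs_sin_le_one _)
      exact mul_le_mul h2 h1 (Real.exp_pos _).le (by positivity)
  have hleft : ∀ ξ, ∫ s, F ξ s ∂η = (Real.sin ⟪x, ξ⟫ * Real.exp (-φ (‖ξ‖ ^ 2))) • ξ := by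
    intro ξ
    simp only [hF]
    rw [integral_smul_const, integral_const_mul, hV _ (sq_nonneg _)]
  have hright : ∀ᵐ s ∂η, ∫ ξ, F ξ s = ((π / s) ^ ((d : ℝ) / 2) * Real.exp (-‖x‖ ^ 2 / (4 * s)) / (2 * s)) • x := by
    filter_upwards [hs] with s hs0
    rw [← hk_gauss_grad d hd s hs0 x]
    simp only [hF]
    congr 1; funext ξ; rw [show -‖ξ‖ ^ 2 * s = -s * ‖ξ‖ ^ 2 by ring]
  refine ⟨?_, ?_, ?_⟩
  · have := hIntg.integral_prod_left.1
    simpa only [Function.uncurry_apply_pair, hleft] using this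
  · have := hIntg.integral_prod_right
    simp only [Function.uncurry_apply_pair] at this
    exact (integrable_smul_const hx).1 (this.congr hright)
  · simp_rw [← hleft]
    rw [integral_integral_swap hIntg, integral_congr_ae hright, integral_smul_const]

lemma hk_min (τ : ℝ) (h : 0 < τ) : min τ 1 / 2 ≤ 1 - Real.exp (-τ) := by
  have h1 := Real.add_one_le_exp τ
  have h2 : Real.exp (-τ) ≤ 1 / (1 + τ) := by
    rw [Real.exp_neg, ← one_div]
    exact one_div_le_one_div_of_le (by linarith) (by linarith)
  have h3 : min τ 1 / 2 ≤ 1 - 1 / (1 + τ) := by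
    have : 1 - 1 / (1 + τ) = τ / (1 + τ) := by field_simp; ring
    rw [this, le_div_iff₀ (by linarith)]
    rcases le_total τ 1 with h | h
    · rw [min_eq_left h]; nlinarith
    · rw [min_eq_right h]; nlinarith
  linarith

lemma hk_G_upper (q : ℝ) (hq : 0 < q) : ∃ C : ℝ, 0 < C ∧ ∀ τ : ℝ, 0 < τ →
    τ ^ (-q) * Real.exp (-1 / (4 * τ)) ≤ C * (1 - Real.exp (-τ)) := by
  obtain ⟨N, hN⟩ := exists_nat_ge (q + 1)
  refine ⟨2 * (4 ^ N * N.factorial), by positivity, fun τ hτ => ?_⟩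
  have hm := hk_min τ hτ
  have hone : (1:ℝ) ≤ 4 ^ N * N.factorial := by
    have h1 : (1:ℝ) ≤ 4 ^ N := one_le_pow₀ (by norm_num)
    have h2 : (1:ℝ) ≤ N.factorial := by exact_mod_cast N.factorial_pos
    nlinarith
  set B : ℝ := 4 ^ N * N.factorial with hB
  rcases le_total 1 τ with h | h
  · rw [min_eq_right h] at hm
    have h1 : τ ^ (-q) ≤ 1 := Real.rpow_le_one_of_one_le_of_nonpos h (by linarith)
    have h2 : Real.exp (-1 / (4 * τ)) ≤ 1 := Real.exp_le_one_iff.2 (div_nonpos_of_nonpos_of_nonneg (by norm_num) (by positivity))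
    have h3 : τ ^ (-q) * Real.exp (-1 / (4 * τ)) ≤ 1 := mul_le_one₀ h1 (Real.exp_pos _).le h2
    nlinarith
  · rw [min_eq_left h] at hm
    have h1 : τ ^ (-q) ≤ τ * (τ ^ N)⁻¹ := by
      have : τ * (τ ^ N)⁻¹ = τ ^ (1 - (N:ℝ)) := by
        rw [Real.rpow_sub hτ, Real.rpow_one, Real.rpow_natCast]; rfl
      rw [this]
      exact Real.rpow_le_rpow_of_exponent_ge hτ h (by linarith)
    have h2 := Real.pow_div_factorial_le_exp (1 / (4 * τ)) (by positivity) N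
    have h3 : (τ ^ N)⁻¹ * Real.exp (-1 / (4 * τ)) ≤ B := by
      rw [neg_div, Real.exp_neg, ← mul_inv, inv_le_comm₀ (by positivity) (by positivity)]
      calc B⁻¹ = τ ^ N * ((1 / (4 * τ)) ^ N / N.factorial) := by
            rw [hB, div_pow, mul_pow]; field_simp; simp
        _ ≤ _ := by gcongr
    calc τ ^ (-q) * Real.exp (-1 / (4 * τ)) ≤ τ * (τ ^ N)⁻¹ * Real.exp (-1 / (4 * τ)) := by gcongr
      _ = τ * ((τ ^ N)⁻¹ * Real.exp (-1 / (4 * τ))) := by ring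
      _ ≤ τ * B := by gcongr
      _ ≤ 2 * B * (1 - Real.exp (-τ)) := by nlinarith

lemma hk_G_lower (q M : ℝ) (hq : 0 < q) (hM : 1 ≤ M) (τ : ℝ) (hτ : 0 < τ) :
    (M ^ (-q) * Real.exp (-M / 4)) * ((1 - Real.exp (-τ)) - 2 / M * (1 - Real.exp (-(M * τ)))
      - 2 * (1 - Real.exp (-(τ / M)))) ≤ τ ^ (-q) * Real.exp (-1 / (4 * τ)) := by
  have hM0 : 0 < M := by linarith
  have a1 := hk_min (M * τ) (by positivity)
  have a2 := hk_min (τ / M) (by positivity)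
  have p1 : 0 ≤ 1 - Real.exp (-(M * τ)) := by
    have : 0 ≤ min (M * τ) 1 := by positivity
    linarith
  have p2 : 0 ≤ 1 - Real.exp (-(τ / M)) := by
    have : 0 ≤ min (τ / M) 1 := by positivity
    linarith
  have p3 : 0 ≤ 2 / M * (1 - Real.exp (-(M * τ))) := by positivity
  have e0 := Real.exp_pos (-τ)
  have e1 : 1 - Real.exp (-τ) ≤ τ := by have := Real.add_one_le_exp (-τ); linarith
  have hc : 0 < M ^ (-q) * Real.exp (-M / 4) := by positivity
  have hG : 0 < τ ^ (-q) * Real.exp (-1 / (4 * τ)) := by positivity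
  by_cases h1 : M * τ ≤ 1
  · rw [min_eq_left h1] at a1
    have : τ ≤ 2 / M * (1 - Real.exp (-(M * τ))) := by
      calc τ = 2 / M * (M * τ / 2) := by field_simp
        _ ≤ _ := by gcongr
    refine le_trans (mul_nonpos_of_nonneg_of_nonpos hc.le (by linarith)) hG.le
  by_cases h2 : M ≤ τ
  · rw [min_eq_right ((one_le_div hM0).2 h2)] at a2
    refine le_trans (mul_nonpos_of_nonneg_of_nonpos hc.le (by linarith)) hG.le
  push Not at h1 h2
  have h3 : M ^ (-q) ≤ τ ^ (-q) := Real.rpow_le_rpow_of_nonpos hτ h2.le (by linarith)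
  have h4 : Real.exp (-M / 4) ≤ Real.exp (-1 / (4 * τ)) := by
    apply Real.exp_le_exp.2
    rw [div_le_div_iff₀ (by norm_num) (by positivity)]; nlinarith
  calc _ ≤ (M ^ (-q) * Real.exp (-M / 4)) * 1 := by gcongr; linarith
    _ ≤ _ := by rw [mul_one]; gcongr

lemma hk_g_eq (p s R : ℝ) (hs : 0 < s) (hR : 0 < R) :
    (π / s) ^ p * Real.exp (-R / (4 * s)) / (2 * s) =
      (π ^ p / 2 * R ^ (-(p + 1))) * ((s / R) ^ (-(p + 1)) * Real.exp (-1 / (4 * (s / R)))) := by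
  rw [Real.div_rpow hs.le hR.le, Real.div_rpow Real.pi_pos.le hs.le]
  have e1 : -1 / (4 * (s / R)) = -R / (4 * s) := by field_simp
  have e2 : s ^ (-(p + 1)) = (s ^ p)⁻¹ * s⁻¹ := by
    rw [Real.rpow_neg hs.le, Real.rpow_add hs, Real.rpow_one, mul_inv]
  have e3 : 0 < R ^ (-(p + 1)) := by positivity
  have e4 : 0 < s ^ p := by positivity
  rw [e1, e2]
  field_simp

noncomputable def hkV (d : ℕ) (a t : ℝ) (x : EuclideanSpace ℝ (Fin d)) : EuclideanSpace ℝ (Fin d) :=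
  ∫ ξ : EuclideanSpace ℝ (Fin d), (Real.sin ⟪x, ξ⟫ * Real.exp (-t * ‖ξ‖ ^ a)) • ξ

lemma hk_lim (d : ℕ) (hd : 1 ≤ d) (b : ℝ) (hb : 0 < b) (η : ℕ → Measure ℝ) (φ : ℕ → ℝ → ℝ)
    (hs : ∀ n, ∀ᵐ s ∂(η n), 0 < s)
    (hl : ∀ n, ∀ l : ℝ, 0 ≤ l →
      ∫⁻ s, ENNReal.ofReal (Real.exp (-l * s)) ∂(η n) = ENNReal.ofReal (Real.exp (-φ n l)))
    (hφ : ∀ n, ∀ l : ℝ, 0 ≤ l → l ^ b ≤ φ n l)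
    (ht : ∀ l : ℝ, 0 ≤ l → Tendsto (fun n => φ n l) atTop (nhds (l ^ b))) (x : EuclideanSpace ℝ (Fin d)) (hx : x ≠ 0) :
    Tendsto (fun n => (∫ s, (π / s) ^ ((d : ℝ) / 2) * Real.exp (-‖x‖ ^ 2 / (4 * s)) / (2 * s) ∂(η n)) * ‖x‖)
      atTop (nhds ‖hkV d (2 * b) 1 x‖) := by
  have hf := fun n => hk_fub d hd b hb (η n) (φ n) (hs n) (hl n) (hφ n) x hx
  have hpow : ∀ ξ : EuclideanSpace ℝ (Fin d), (‖ξ‖ ^ 2) ^ b = ‖ξ‖ ^ (2 * b) := by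
    intro ξ
    rw [← Real.rpow_natCast, ← Real.rpow_mul (norm_nonneg _)]; push_cast; rfl
  have key : Tendsto (fun n => ∫ ξ : EuclideanSpace ℝ (Fin d), (Real.sin ⟪x, ξ⟫ * Real.exp (-φ n (‖ξ‖ ^ 2))) • ξ) atTop
      (nhds (hkV d (2 * b) 1 x)) := by
    unfold hkV
    refine tendsto_integral_of_dominated_convergence
      (fun ξ : EuclideanSpace ℝ (Fin d) => ‖ξ‖ ^ 1 * Real.exp (-1 * ‖ξ‖ ^ (2 * b))) (fun n => (hf n).1)
      (hk_integrable_w d hd (2 * b) 1 (by linarith) one_pos 1) (fun n => ?_) ?_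
    · refine Eventually.of_forall fun ξ => ?_
      rw [norm_smul, norm_mul, Real.norm_eq_abs, Real.norm_eq_abs, abs_of_pos (Real.exp_pos _), pow_one,
        mul_comm ‖ξ‖]
      have h1 : Real.exp (-φ n (‖ξ‖ ^ 2)) ≤ Real.exp (-1 * ‖ξ‖ ^ (2 * b)) := by
        apply Real.exp_le_exp.2
        have := hφ n (‖ξ‖ ^ 2) (sq_nonneg _)
        rw [hpow] at this; linarith
      have h2 := Real.abs_sin_le_one ⟪x, ξ⟫
      have h3 := Real.exp_pos (-φ n (‖ξ‖ ^ 2))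
      refine mul_le_mul_of_nonneg_right ?_ (norm_nonneg _)
      nlinarith
    · refine Eventually.of_forall fun ξ => ?_
      have h1 := ht (‖ξ‖ ^ 2) (sq_nonneg _)
      rw [hpow] at h1
      have h2 := ((Real.continuous_exp.tendsto _).comp h1.neg)
      rw [neg_one_mul]
      exact (h2.const_mul _).smul_const ξ
  refine key.norm.congr fun n => ?_
  rw [(hf n).2.2, norm_smul, Real.norm_eq_abs, abs_of_nonneg]
  refine integral_nonneg_of_ae ?_
  filter_upwards [hs n] with s hs0
  have := Real.pi_pos
  simp only [Pi.zero_apply]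
  positivity

lemma hk_core_upper (d : ℕ) (hd : 1 ≤ d) (b : ℝ) (hb : 0 < b) (hb1 : b < 1) :
    ∃ C : ℝ, 0 < C ∧ ∀ x : EuclideanSpace ℝ (Fin d), x ≠ 0 →
      ‖hkV d (2 * b) 1 x‖ ≤ C * (‖x‖ ^ 2) ^ (-((d : ℝ) / 2 + 1)) * (‖x‖ ^ 2) ^ (-b) * ‖x‖ := by
  obtain ⟨φ, η, hs, hl, hφ, ht⟩ := hk_sub b hb hb1
  obtain ⟨C, hC, hG⟩ := hk_G_upper ((d : ℝ) / 2 + 1) (by positivity)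
  refine ⟨π ^ ((d : ℝ) / 2) / 2 * C, by positivity, fun x hx => ?_⟩
  set R := ‖x‖ ^ 2 with hR
  have hx0 : 0 < ‖x‖ := norm_pos_iff.2 hx
  have hR0 : 0 < R := by positivity
  have hlim := hk_lim d hd b hb η φ hs hl hφ ht x hx
  set P := π ^ ((d : ℝ) / 2) / 2 * R ^ (-((d : ℝ) / 2 + 1)) with hP
  have hP0 : 0 < P := by positivity
  have hlr : 0 ≤ 1 / R := by positivity
  have hub : Tendsto (fun n => P * C * (Real.exp (-φ n 0) - Real.exp (-φ n (1 / R))) * ‖x‖) atTop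
      (nhds (P * C * (Real.exp (-(0:ℝ) ^ b) - Real.exp (-(1 / R) ^ b)) * ‖x‖)) := by
    have t0 := ((Real.continuous_exp.tendsto _).comp (ht 0 le_rfl).neg)
    have t1 := ((Real.continuous_exp.tendsto _).comp (ht (1 / R) hlr).neg)
    exact ((t0.sub t1).const_mul _).mul_const _
  have hle := le_of_tendsto_of_tendsto' hlim hub fun n => by
    obtain ⟨-, -, -, hD⟩ := hk_lap_facts (η n) (φ n) (hs n) (hl n)
    obtain ⟨hD1, hD2⟩ := hD (1 / R) hlr
    refine mul_le_mul_of_nonneg_right ?_ hx0.le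
    rw [← hD2, ← integral_const_mul]
    refine integral_mono_ae (hk_fub d hd b hb (η n) (φ n) (hs n) (hl n) (hφ n) x hx).2.1
      (hD1.const_mul _) ?_
    filter_upwards [hs n] with s hs0
    rw [hk_g_eq _ s R hs0 hR0, mul_assoc P]
    refine mul_le_mul_of_nonneg_left ?_ hP0.le
    refine (hG (s / R) (by positivity)).trans_eq ?_
    congr 3; field_simp
  refine hle.trans ?_
  rw [Real.zero_rpow hb.ne', neg_zero, Real.exp_zero]
  have h1 : 1 - Real.exp (-(1 / R) ^ b) ≤ R ^ (-b) := by
    have := Real.add_one_le_exp (-(1 / R) ^ b)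
    have e : (1 / R) ^ b = R ^ (-b) := by rw [one_div, Real.inv_rpow hR0.le, Real.rpow_neg hR0.le]
    linarith
  calc P * C * (1 - Real.exp (-(1 / R) ^ b)) * ‖x‖ ≤ P * C * R ^ (-b) * ‖x‖ := by gcongr
    _ = _ := by rw [hP]; ring

lemma hk_exists_M (b : ℝ) (hb : 0 < b) (hb1 : b < 1) :
    ∃ M : ℝ, 1 ≤ M ∧ M ^ (-(1 - b)) ≤ 1 / 16 ∧ M ^ (-b) ≤ 1 / 16 := by
  have h1 := (tendsto_rpow_neg_atTop (y := 1 - b) (by linarith)).eventually_le_const (show (0:ℝ) < 1 / 16 by norm_num)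
  have h2 := (tendsto_rpow_neg_atTop (y := b) hb).eventually_le_const (show (0:ℝ) < 1 / 16 by norm_num)
  obtain ⟨M, hM⟩ := ((eventually_ge_atTop (1:ℝ)).and (h1.and h2)).exists
  exact ⟨M, hM⟩

lemma hk_core_lower (d : ℕ) (hd : 1 ≤ d) (b : ℝ) (hb : 0 < b) (hb1 : b < 1) :
    ∃ c : ℝ, 0 < c ∧ ∀ x : EuclideanSpace ℝ (Fin d), x ≠ 0 →
      c * ((1 + ‖x‖) ^ 2) ^ (-((d : ℝ) / 2 + 1)) * ((1 + ‖x‖) ^ 2) ^ (-b) * ‖x‖ ≤ ‖hkV d (2 * b) 1 x‖ := by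
  obtain ⟨φ, η, hs, hl, hφ, ht⟩ := hk_sub b hb hb1
  obtain ⟨M, hM1, hMa, hMb⟩ := hk_exists_M b hb hb1
  have hM0 : 0 < M := by linarith
  set K := M ^ (-((d : ℝ) / 2 + 1)) * Real.exp (-M / 4) with hK
  have hK0 : 0 < K := by positivity
  refine ⟨π ^ ((d : ℝ) / 2) / 2 * K / 4, by positivity, fun x hx => ?_⟩
  have hx0 : 0 < ‖x‖ := norm_pos_iff.2 hx
  set R := (1 + ‖x‖) ^ 2 with hR
  have hR1 : 1 ≤ R := by nlinarith
  have hR0 : 0 < R := by positivity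
  have hxR : ‖x‖ ^ 2 ≤ R := by nlinarith
  have hlim := hk_lim d hd b hb η φ hs hl hφ ht x hx
  set P := π ^ ((d : ℝ) / 2) / 2 * R ^ (-((d : ℝ) / 2 + 1)) with hP
  have hP0 : 0 < P := by positivity
  have hl1 : 0 ≤ 1 / R := by positivity
  have hl2 : 0 ≤ M / R := by positivity
  have hl3 : 0 ≤ 1 / (R * M) := by positivity
  set u : ℕ → ℝ → ℝ := fun n l => Real.exp (-φ n 0) - Real.exp (-φ n l) with hu
  have hut : ∀ l, 0 ≤ l → Tendsto (fun n => u n l) atTop (nhds (1 - Real.exp (-l ^ b))) := by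
    intro l h
    have t0 := ((Real.continuous_exp.tendsto _).comp (ht 0 le_rfl).neg)
    have t1 := ((Real.continuous_exp.tendsto _).comp (ht l h).neg)
    rw [Real.zero_rpow hb.ne', neg_zero, Real.exp_zero] at t0
    exact t0.sub t1
  have hlb : Tendsto (fun n => P * K * (u n (1 / R) - 2 / M * u n (M / R) - 2 * u n (1 / (R * M))) * ‖x‖) atTop
      (nhds (P * K * ((1 - Real.exp (-(1 / R) ^ b)) - 2 / M * (1 - Real.exp (-(M / R) ^ b))
        - 2 * (1 - Real.exp (-(1 / (R * M)) ^ b))) * ‖x‖)) :=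
    ((((hut _ hl1).sub ((hut _ hl2).const_mul _)).sub ((hut _ hl3).const_mul _)).const_mul _).mul_const _
  have hle := le_of_tendsto_of_tendsto' hlb hlim fun n => by
    obtain ⟨-, -, -, hD⟩ := hk_lap_facts (η n) (φ n) (hs n) (hl n)
    obtain ⟨hA1, hA2⟩ := hD (1 / R) hl1
    obtain ⟨hB1, hB2⟩ := hD (M / R) hl2
    obtain ⟨hC1, hC2⟩ := hD (1 / (R * M)) hl3
    have hAB : Integrable (fun s : ℝ => (1 - Real.exp (-(1 / R) * s)) -
        2 / M * (1 - Real.exp (-(M / R) * s))) (η n) := hA1.sub (hB1.const_mul _)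
    refine mul_le_mul_of_nonneg_right ?_ hx0.le
    simp only [hu]
    rw [← hA2, ← hB2, ← hC2, ← integral_const_mul, ← integral_const_mul,
      ← integral_sub hA1 (hB1.const_mul _), ← integral_sub hAB (hC1.const_mul _),
      ← integral_const_mul]
    refine integral_mono_ae ((hAB.sub (hC1.const_mul _)).const_mul _)
      (hk_fub d hd b hb (η n) (φ n) (hs n) (hl n) (hφ n) x hx).2.1 ?_
    filter_upwards [hs n] with s hs0
    have hmono : (π / s) ^ ((d : ℝ) / 2) * Real.exp (-R / (4 * s)) / (2 * s) ≤
        (π / s) ^ ((d : ℝ) / 2) * Real.exp (-‖x‖ ^ 2 / (4 * s)) / (2 * s) := by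
      have := Real.pi_pos
      gcongr
    refine le_trans ?_ hmono
    rw [hk_g_eq _ s R hs0 hR0, mul_assoc P]
    refine mul_le_mul_of_nonneg_left ?_ hP0.le
    refine le_trans (le_of_eq ?_) (hk_G_lower ((d : ℝ) / 2 + 1) M (by positivity) hM1 (s / R) (by positivity))
    rw [show -(1 / R) * s = -(s / R) by ring, show -(M / R) * s = -(M * (s / R)) by ring,
      show -(1 / (R * M)) * s = -(s / R / M) by field_simp]
  refine le_trans ?_ hle
  have e1 : (1 / R) ^ b = R ^ (-b) := by rw [one_div, Real.inv_rpow hR0.le, Real.rpow_neg hR0.le]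
  have e2 : (M / R) ^ b = M ^ b * R ^ (-b) := by
    rw [Real.div_rpow hM0.le hR0.le, Real.rpow_neg hR0.le]; rfl
  have e3 : (1 / (R * M)) ^ b = R ^ (-b) * M ^ (-b) := by
    rw [one_div, Real.inv_rpow (by positivity), Real.mul_rpow hR0.le hM0.le, mul_inv,
      Real.rpow_neg hR0.le, Real.rpow_neg hM0.le]
  have e4 : 1 / M * M ^ b = M ^ (-(1 - b)) := by
    rw [show -(1 - b) = b - 1 by ring, Real.rpow_sub hM0, Real.rpow_one]; ring
  have hLb : 0 < R ^ (-b) := by positivity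
  have hL1 : R ^ (-b) ≤ 1 := Real.rpow_le_one_of_one_le_of_nonpos hR1 (by linarith)
  have m1 := hk_min (R ^ (-b)) hLb
  rw [min_eq_left hL1] at m1
  have m2 := Real.add_one_le_exp (-(M ^ b * R ^ (-b)))
  have m3 := Real.add_one_le_exp (-(R ^ (-b) * M ^ (-b)))
  rw [e1, e2, e3]
  have n2 : 2 / M * (1 - Real.exp (-(M ^ b * R ^ (-b)))) ≤ R ^ (-b) / 8 := by
    calc 2 / M * (1 - Real.exp (-(M ^ b * R ^ (-b)))) ≤ 2 / M * (M ^ b * R ^ (-b)) := by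
          gcongr; linarith
      _ = 2 * (1 / M * M ^ b) * R ^ (-b) := by ring
      _ ≤ 2 * (1 / 16) * R ^ (-b) := by rw [e4]; gcongr
      _ = _ := by ring
  have n3 : 2 * (1 - Real.exp (-(R ^ (-b) * M ^ (-b)))) ≤ R ^ (-b) / 8 := by
    nlinarith
  have n4 : R ^ (-b) / 4 ≤ (1 - Real.exp (-R ^ (-b))) - 2 / M * (1 - Real.exp (-(M ^ b * R ^ (-b))))
      - 2 * (1 - Real.exp (-(R ^ (-b) * M ^ (-b)))) := by linarith
  calc π ^ ((d : ℝ) / 2) / 2 * K / 4 * R ^ (-((d : ℝ) / 2 + 1)) * R ^ (-b) * ‖x‖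
      = P * K * (R ^ (-b) / 4) * ‖x‖ := by rw [hP]; ring
    _ ≤ _ := by gcongr

lemma hk_small_upper (d : ℕ) (hd : 1 ≤ d) (a : ℝ) (ha : 0 < a) :
    ∃ C : ℝ, 0 ≤ C ∧ ∀ x : EuclideanSpace ℝ (Fin d), ‖hkV d a 1 x‖ ≤ C * ‖x‖ := by
  have hI := hk_integrable_w d hd a 1 ha one_pos 2
  refine ⟨∫ ξ : EuclideanSpace ℝ (Fin d), ‖ξ‖ ^ 2 * Real.exp (-1 * ‖ξ‖ ^ a), integral_nonneg fun ξ => by positivity, fun x => ?_⟩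
  unfold hkV
  rw [← integral_mul_const]
  refine norm_integral_le_of_norm_le (hI.mul_const _) (Eventually.of_forall fun ξ => ?_)
  rw [norm_smul, norm_mul, Real.norm_eq_abs, Real.norm_eq_abs, abs_of_pos (Real.exp_pos _)]
  have h1 : |Real.sin ⟪x, ξ⟫| ≤ ‖x‖ * ‖ξ‖ := (Real.abs_sin_le_abs).trans (abs_real_inner_le_norm x ξ)
  calc |Real.sin ⟪x, ξ⟫| * Real.exp (-1 * ‖ξ‖ ^ a) * ‖ξ‖ ≤ (‖x‖ * ‖ξ‖) * Real.exp (-1 * ‖ξ‖ ^ a) * ‖ξ‖ := by gcongr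
    _ = _ := by ring

lemma hk_pow_sq (r p q : ℝ) (hr : 0 < r) : (r ^ 2) ^ (-p) * (r ^ 2) ^ (-q) = (r ^ (2 * p + 2 * q))⁻¹ := by
  rw [← Real.rpow_natCast, ← Real.rpow_mul hr.le, ← Real.rpow_mul hr.le, ← Real.rpow_add hr,
    ← Real.rpow_neg hr.le]
  congr 1; push_cast; ring

lemma hk_one (d : ℕ) (hd : 1 ≤ d) (α : ℝ) (hα : α ∈ Set.Ioo (1:ℝ) 2) :
    ∃ c C : ℝ, 0 < c ∧ 0 < C ∧ ∀ x : EuclideanSpace ℝ (Fin d), x ≠ 0 →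
      c * (‖x‖ / (1 + ‖x‖) ^ ((d : ℝ) + 2 + α)) ≤ ‖hkV d α 1 x‖ ∧
      ‖hkV d α 1 x‖ ≤ C * (‖x‖ / (1 + ‖x‖) ^ ((d : ℝ) + 2 + α)) := by
  obtain ⟨ha1, ha2⟩ := hα
  obtain ⟨c, hc, hlow⟩ := hk_core_lower d hd (α / 2) (by linarith) (by linarith)
  obtain ⟨C1, hC1, hup⟩ := hk_core_upper d hd (α / 2) (by linarith) (by linarith)
  obtain ⟨C2, hC2, hsm⟩ := hk_small_upper d hd α (by linarith)
  have e0 : 2 * (α / 2) = α := by ring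
  have e1 : 2 * ((d : ℝ) / 2 + 1) + 2 * (α / 2) = (d : ℝ) + 2 + α := by ring
  rw [e0] at hlow hup
  set e := (d : ℝ) + 2 + α with he
  have he0 : 0 < e := by positivity
  refine ⟨c, (C1 + C2) * 2 ^ e, hc, by positivity, fun x hx => ?_⟩
  have hx0 : 0 < ‖x‖ := norm_pos_iff.2 hx
  have h1x : 0 < 1 + ‖x‖ := by positivity
  constructor
  · refine le_trans (le_of_eq ?_) (hlow x hx)
    rw [mul_assoc c, hk_pow_sq _ _ _ h1x, e1]; ring
  · have hp : 0 < (1 + ‖x‖) ^ e := by positivity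
    rcases le_total ‖x‖ 1 with h | h
    · refine (hsm x).trans ?_
      have h2 : (1 + ‖x‖) ^ e ≤ 2 ^ e := Real.rpow_le_rpow h1x.le (by linarith) he0.le
      rw [mul_div_assoc', le_div_iff₀ hp]
      calc C2 * ‖x‖ * (1 + ‖x‖) ^ e ≤ C2 * ‖x‖ * 2 ^ e := by gcongr
        _ ≤ (C1 + C2) * ‖x‖ * 2 ^ e := by gcongr; linarith
        _ = _ := by ring
    · refine (hup x hx).trans ?_
      rw [mul_assoc C1, hk_pow_sq _ _ _ hx0, e1]
      have h2 : (1 + ‖x‖) ^ e ≤ 2 ^ e * ‖x‖ ^ e := by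
        rw [← Real.mul_rpow (by norm_num) hx0.le]
        exact Real.rpow_le_rpow h1x.le (by linarith) he0.le
      have hq : 0 < ‖x‖ ^ e := by positivity
      rw [mul_div_assoc', le_div_iff₀ hp]
      calc C1 * (‖x‖ ^ e)⁻¹ * ‖x‖ * (1 + ‖x‖) ^ e ≤ C1 * (‖x‖ ^ e)⁻¹ * ‖x‖ * (2 ^ e * ‖x‖ ^ e) := by gcongr
        _ = C1 * 2 ^ e * ‖x‖ := by field_simp
        _ ≤ (C1 + C2) * 2 ^ e * ‖x‖ := by gcongr; linarith

lemma hk_scale (d : ℕ) (a t : ℝ) (ha : 0 < a) (ht : 0 < t) (x : EuclideanSpace ℝ (Fin d)) :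
    hkV d a t x = (t ^ (-(1 / a))) ^ (d + 1) • hkV d a 1 (t ^ (-(1 / a)) • x) := by
  set k := t ^ (-(1 / a)) with hk
  have hk0 : 0 < k := by positivity
  have hka : t * k ^ a = 1 := by
    rw [hk, ← Real.rpow_mul ht.le, show -(1 / a) * a = -1 by field_simp, Real.rpow_neg_one]
    field_simp
  have h := Measure.integral_comp_smul (volume : Measure (EuclideanSpace ℝ (Fin d)))
    (fun ξ : EuclideanSpace ℝ (Fin d) => (Real.sin ⟪x, ξ⟫ * Real.exp (-t * ‖ξ‖ ^ a)) • ξ) k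
  have h2 : ∀ ξ : EuclideanSpace ℝ (Fin d), (Real.sin ⟪x, k • ξ⟫ * Real.exp (-t * ‖k • ξ‖ ^ a)) • (k • ξ) =
      k • ((Real.sin ⟪k • x, ξ⟫ * Real.exp (-1 * ‖ξ‖ ^ a)) • ξ) := by
    intro ξ
    rw [norm_smul, Real.norm_eq_abs, abs_of_pos hk0, Real.mul_rpow hk0.le (norm_nonneg _),
      real_inner_smul_left, real_inner_smul_right, smul_comm k]
    congr 3
    linear_combination (-‖ξ‖ ^ a) * hka
  simp only [h2] at h
  rw [integral_smul, finrank_euclideanSpace, Fintype.card_fin, abs_of_pos (by positivity)] at h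
  unfold hkV
  rw [pow_succ, mul_smul, h, smul_smul, mul_inv_cancel₀ (by positivity), one_smul]

lemma hk_gradient (d : ℕ) (hd : 1 ≤ d) (α t : ℝ) (hα : 0 < α) (ht : 0 < t) (x : EuclideanSpace ℝ (Fin d)) :
    ‖gradient (heatKer d α t) x‖ = (2 * Real.pi) ^ (-(d : ℝ)) * ‖hkV d α t x‖ := by
  have i0 := hk_integrable_w d hd α t hα ht 0
  have i1 := hk_integrable_w d hd α t hα ht 1
  simp only [pow_zero, one_mul, pow_one] at i0 i1
  have h := hk_grad d _ i0 i1 x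
  rw [hasGradientAt_iff_hasFDerivAt] at h
  have h2 : HasGradientAt (heatKer d α t) ((2 * Real.pi) ^ (-(d : ℝ)) • (-hkV d α t x)) x := by
    rw [hasGradientAt_iff_hasFDerivAt]
    refine (h.const_mul ((2 * Real.pi) ^ (-(d : ℝ)))).congr_fderiv ?_
    rw [map_smul]; rfl
  rw [h2.gradient, norm_smul, norm_neg, Real.norm_eq_abs, abs_of_pos (by positivity)]

/-- Two-sided sharp estimate of the spatial gradient of the stable heat kernel:
`|∇_x p(t,x)| ≈ t|x|/(t^{1/α}+|x|)^{d+2+α}`. -/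
theorem heatKer_gradient_two_sided_estimate (d : ℕ) (hd : 1 ≤ d)
    (α : ℝ) (hα : α ∈ Set.Ioo (1:ℝ) 2) :
    ∃ C : ℝ, 1 ≤ C ∧ ∀ t, 0 < t → ∀ x : EuclideanSpace ℝ (Fin d),
      C⁻¹ * (t * ‖x‖ / (t ^ (1 / α) + ‖x‖) ^ ((d : ℝ) + 2 + α)) ≤ ‖gradient (heatKer d α t) x‖ ∧
      ‖gradient (heatKer d α t) x‖ ≤ C * (t * ‖x‖ / (t ^ (1 / α) + ‖x‖) ^ ((d : ℝ) + 2 + α)) := by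
  obtain ⟨c, K, hc, hK, hone⟩ := hk_one d hd α hα
  have hα0 : 0 < α := lt_trans one_pos hα.1
  set A : ℝ := (2 * Real.pi) ^ (-(d : ℝ)) with hA
  have hA0 : 0 < A := by positivity
  refine ⟨max 1 (max (A * c)⁻¹ (A * K)), le_max_left _ _, fun t ht x => ?_⟩
  set C := max 1 (max (A * c)⁻¹ (A * K)) with hC
  have hC1 : (A * c)⁻¹ ≤ C := (le_max_left _ _).trans (le_max_right _ _)
  have hC2 : A * K ≤ C := (le_max_right _ _).trans (le_max_right _ _)
  rw [hk_gradient d hd α t hα0 ht x, ← hA]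
  by_cases hx : x = 0
  · subst hx
    simp [hkV]
  have hx0 : 0 < ‖x‖ := norm_pos_iff.2 hx
  set k := t ^ (-(1 / α)) with hk
  have hk0 : 0 < k := by positivity
  have hkx : k • x ≠ 0 := smul_ne_zero hk0.ne' hx
  obtain ⟨h1, h2⟩ := hone (k • x) hkx
  rw [hk_scale d α t hα0 ht x, ← hk, norm_smul, Real.norm_eq_abs, abs_of_pos (by positivity)]
  rw [norm_smul, Real.norm_eq_abs, abs_of_pos hk0] at h1 h2
  set W := ‖hkV d α 1 (k • x)‖
  set e := (d : ℝ) + 2 + α with he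
  set T := t ^ (1 / α) with hT
  have hT0 : 0 < T := by positivity
  have hkT : k * T = 1 := by
    rw [hk, hT, ← Real.rpow_add ht]; simp
  have hka : t * k ^ α = 1 := by
    rw [hk, ← Real.rpow_mul ht.le, show -(1 / α) * α = -1 by field_simp, Real.rpow_neg_one]
    field_simp
  set Q := t * ‖x‖ / (T + ‖x‖) ^ e with hQ
  have hQ0 : 0 < Q := by positivity
  have hQe : k ^ (d + 1) * (k * ‖x‖ / (1 + k * ‖x‖) ^ e) = Q := by
    have a1 : (1 + k * ‖x‖) ^ e = k ^ e * (T + ‖x‖) ^ e := by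
      rw [← Real.mul_rpow hk0.le (by positivity), mul_add, hkT]
    have a2 : k ^ e = k ^ (d + 1) * k * k ^ α := by
      rw [he, Real.rpow_add hk0, ← pow_succ, ← Real.rpow_natCast]; push_cast; ring_nf
    have a3 : 0 < k ^ α := by positivity
    have a4 : 0 < (T + ‖x‖) ^ e := by positivity
    rw [a1, a2, hQ]
    rw [mul_div_assoc', div_eq_div_iff (by positivity) (by positivity)]
    linear_combination (-(k ^ (d + 1) * k * ‖x‖ * (T + ‖x‖) ^ e)) * hka
  constructor
  · calc C⁻¹ * Q ≤ (A * c) * Q := by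
          gcongr
          exact inv_le_of_inv_le₀ (by positivity) hC1
      _ = A * (k ^ (d + 1) * (c * (k * ‖x‖ / (1 + k * ‖x‖) ^ e))) := by rw [← hQe]; ring
      _ ≤ A * (k ^ (d + 1) * W) := by gcongr
  · calc A * (k ^ (d + 1) * W) ≤ A * (k ^ (d + 1) * (K * (k * ‖x‖ / (1 + k * ‖x‖) ^ e))) := by gcongr
      _ = (A * K) * Q := by rw [← hQe]; ring
      _ ≤ C * Q := by gcongr
end

section
/- For every constant vector b ∈ ℝ^d there exists a constant C = C(d,α,b) > 0 such that for all t > 0 and x, y ∈ ℝ^d, |b · ∇_y p(t, x − y)| ≤ C t^{-1/α} p(t, x − y). -/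
open MeasureTheory Real Filter
open scoped ENNReal RealInnerProductSpace

namespace HKB
open scoped Topology

/-- Integrable functions whose cosine transform satisfies a Harnack (log-Lipschitz) bound. -/
def KK {d : ℕ} (l : ℝ) (f : EuclideanSpace ℝ (Fin d) → ℝ) : Prop :=
  Integrable f ∧ ∀ x y : EuclideanSpace ℝ (Fin d),
    ∫ ξ, Real.cos ⟪x, ξ⟫ * f ξ ≤ Real.exp (l * ‖x - y‖) * ∫ ξ, Real.cos ⟪y, ξ⟫ * f ξ

/-- Multipliers of `KK`. -/
def PP {d : ℕ} (l : ℝ) (ψ : EuclideanSpace ℝ (Fin d) → ℝ) : Prop :=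
  ∀ f, KK l f → KK l (fun ξ => ψ ξ * f ξ)

variable {d : ℕ} {l : ℝ}

lemma cos_mul_integrable {f : EuclideanSpace ℝ (Fin d) → ℝ} (hf : Integrable f)
    (x : EuclideanSpace ℝ (Fin d)) : Integrable (fun ξ => Real.cos ⟪x, ξ⟫ * f ξ) := by
  refine hf.bdd_mul (c := 1) (by fun_prop) ?_
  exact Eventually.of_forall fun ξ => by simpa using Real.abs_cos_le_one _

lemma KK.add {f g : EuclideanSpace ℝ (Fin d) → ℝ} (hf : KK l f) (hg : KK l g) :
    KK l (fun ξ => f ξ + g ξ) := by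
  refine ⟨hf.1.add hg.1, fun x y => ?_⟩
  have h := fun x => integral_add (cos_mul_integrable hf.1 x) (cos_mul_integrable hg.1 x)
  simp only [mul_add] at *
  rw [h, h, mul_add]
  exact add_le_add (hf.2 x y) (hg.2 x y)

lemma KK.smul {f : EuclideanSpace ℝ (Fin d) → ℝ} (hf : KK l f) {c : ℝ} (hc : 0 ≤ c) :
    KK l (fun ξ => c * f ξ) := by
  refine ⟨hf.1.const_mul c, fun x y => ?_⟩
  simp only [mul_left_comm _ c, integral_const_mul]
  exact mul_le_mul_of_nonneg_left (hf.2 x y) hc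

lemma PP.mul {f g : EuclideanSpace ℝ (Fin d) → ℝ} (hf : PP l f) (hg : PP l g) :
    PP l (fun ξ => f ξ * g ξ) := by
  intro h hh
  simpa only [mul_assoc] using hf _ (hg _ hh)

lemma PP.add {f g : EuclideanSpace ℝ (Fin d) → ℝ} (hf : PP l f) (hg : PP l g) :
    PP l (fun ξ => f ξ + g ξ) := by
  intro h hh
  simpa only [add_mul] using (hf _ hh).add (hg _ hh)

lemma PP.const {c : ℝ} (hc : 0 ≤ c) : PP l (fun _ : EuclideanSpace ℝ (Fin d) => c) :=
  fun _ hh => hh.smul hc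

lemma PP.pow {f : EuclideanSpace ℝ (Fin d) → ℝ} (hf : PP l f) (n : ℕ) :
    PP l (fun ξ => f ξ ^ n) := by
  induction n with
  | zero => simpa using PP.const zero_le_one
  | succ n ih => simpa only [pow_succ] using ih.mul hf

lemma PP.cos (z : EuclideanSpace ℝ (Fin d)) : PP l (fun ξ => Real.cos ⟪z, ξ⟫) := by
  intro f hf
  refine ⟨cos_mul_integrable hf.1 z, fun x y => ?_⟩
  have key : ∀ x : EuclideanSpace ℝ (Fin d), ∫ ξ, Real.cos ⟪x, ξ⟫ * (Real.cos ⟪z, ξ⟫ * f ξ)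
      = (1/2) * ((∫ ξ, Real.cos ⟪x + z, ξ⟫ * f ξ) + ∫ ξ, Real.cos ⟪x - z, ξ⟫ * f ξ) := by
    intro x
    rw [← integral_add (cos_mul_integrable hf.1 _) (cos_mul_integrable hf.1 _),
      ← integral_const_mul]
    congr 1; ext ξ
    rw [inner_add_left, inner_sub_left, Real.cos_add, Real.cos_sub]; ring
  rw [key, key]
  have h1 := hf.2 (x + z) (y + z)
  have h2 := hf.2 (x - z) (y - z)
  rw [add_sub_add_right_eq_sub] at h1
  rw [sub_sub_sub_cancel_right] at h2
  linarith

/-- Bounded pointwise limits. -/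
lemma PP.lim {F : ℕ → EuclideanSpace ℝ (Fin d) → ℝ} {g : EuclideanSpace ℝ (Fin d) → ℝ}
    (hF : ∀ᶠ n in atTop, PP l (F n)) (hb : ∀ᶠ n in atTop, ∀ ξ, |F n ξ| ≤ 1)
    (hl : ∀ ξ, Tendsto (fun n => F n ξ) atTop (𝓝 (g ξ))) : PP l g := by
  intro f hf
  have hconv : ∀ x : EuclideanSpace ℝ (Fin d), Tendsto (fun n => ∫ ξ, Real.cos ⟪x, ξ⟫ * (F n ξ * f ξ))
      atTop (𝓝 (∫ ξ, Real.cos ⟪x, ξ⟫ * (g ξ * f ξ))) := by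
    intro x
    refine tendsto_integral_filter_of_dominated_convergence (fun ξ => ‖f ξ‖) ?_ ?_ hf.1.norm ?_
    · filter_upwards [hF] with n hn
      exact (cos_mul_integrable (hn f hf).1 x).aestronglyMeasurable
    · filter_upwards [hb] with n hn
      refine Eventually.of_forall fun ξ => ?_
      rw [norm_mul, norm_mul]
      have := Real.abs_cos_le_one ⟪x, ξ⟫
      have h2 := hn ξ
      rw [Real.norm_eq_abs, Real.norm_eq_abs]
      calc _ ≤ 1 * (1 * ‖f ξ‖) := by gcongr
        _ = _ := by ring
    · exact Eventually.of_forall fun ξ => ((hl ξ).mul_const _).const_mul _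
  refine ⟨?_, fun x y => ?_⟩
  · have hm : AEStronglyMeasurable (fun ξ => g ξ * f ξ) volume := by
      obtain ⟨N, hN⟩ := eventually_atTop.1 hF
      refine aestronglyMeasurable_of_tendsto_ae atTop (f := fun n ξ => F (n + N) ξ * f ξ)
        (fun n => (hN (n+N) (by omega) f hf).1.aestronglyMeasurable) ?_
      exact Eventually.of_forall fun ξ =>
        (((hl ξ).comp (tendsto_add_atTop_nat N)).mul_const _)
    refine hf.1.mono hm (Eventually.of_forall fun ξ => ?_)
    rw [norm_mul, Real.norm_eq_abs]
    have : |g ξ| ≤ 1 := le_of_tendsto (hl ξ).abs (hb.mono fun n hn => hn ξ)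
    exact mul_le_of_le_one_left (norm_nonneg _) this
  · refine le_of_tendsto_of_tendsto (hconv x) ((hconv y).const_mul _) ?_
    filter_upwards [hF] with n hn
    exact (hn f hf).2 x y

/-- Mixtures. -/
lemma PP.mix {Ω : Type*} [MeasurableSpace Ω] {ν : Measure Ω} [SFinite ν]
    {ψ : Ω → EuclideanSpace ℝ (Fin d) → ℝ} {w : Ω → ℝ}
    (hm : Measurable (Function.uncurry ψ)) (hw : Integrable w ν) (hw0 : ∀ᵐ ω ∂ν, 0 ≤ w ω)
    (hP : ∀ᵐ ω ∂ν, PP l (ψ ω)) (hb : ∀ ω ξ, |ψ ω ξ| ≤ 1) :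
    PP l (fun ξ => ∫ ω, w ω * ψ ω ξ ∂ν) := by
  intro f hf
  have hint : ∀ x : EuclideanSpace ℝ (Fin d), Integrable (Function.uncurry
      fun ω ξ => (Real.cos ⟪x, ξ⟫ * ψ ω ξ) * (w ω * f ξ)) (ν.prod volume) := by
    intro x
    refine (hw.mul_prod hf.1).bdd_mul (c := 1) ?_ (Eventually.of_forall fun p => ?_)
    · refine Measurable.aestronglyMeasurable ?_
      exact Measurable.mul (by fun_prop) hm
    · rw [Real.norm_eq_abs, abs_mul]
      exact mul_le_one₀ (Real.abs_cos_le_one _) (abs_nonneg _) (hb _ _)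
  have key : ∀ x : EuclideanSpace ℝ (Fin d), ∫ ξ, Real.cos ⟪x, ξ⟫ * ((∫ ω, w ω * ψ ω ξ ∂ν) * f ξ)
      = ∫ ω, w ω * (∫ ξ, Real.cos ⟪x, ξ⟫ * (ψ ω ξ * f ξ)) ∂ν := by
    intro x
    have h := integral_integral_swap (hint x)
    rw [show (fun ω => w ω * ∫ ξ, Real.cos ⟪x, ξ⟫ * (ψ ω ξ * f ξ)) = 
      fun ω => ∫ ξ, (Real.cos ⟪x, ξ⟫ * ψ ω ξ) * (w ω * f ξ) from ?_, h]
    · congr 1; ext ξ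
      rw [← integral_mul_const, ← integral_const_mul]
      congr 1; ext ω; ring
    · ext ω
      rw [← integral_const_mul]
      congr 1; ext ω; ring
  have hI : ∀ x : EuclideanSpace ℝ (Fin d),
      Integrable (fun ω => w ω * ∫ ξ, Real.cos ⟪x, ξ⟫ * (ψ ω ξ * f ξ)) ν := by
    intro x
    have h := (hint x).integral_prod_left
    refine h.congr (Eventually.of_forall fun ω => ?_)
    simp only [Function.uncurry]
    rw [← integral_const_mul]
    congr 1; ext ω; ring
  refine ⟨?_, fun x y => ?_⟩
  · have h := (hint 0).integral_prod_right
    refine h.congr (Eventually.of_forall fun ξ => ?_)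
    simp only [Function.uncurry, inner_zero_left, Real.cos_zero, one_mul]
    rw [← integral_mul_const]
    congr 1; ext ω; ring
  · rw [key, key, ← integral_const_mul]
    refine integral_mono_ae (hI x) ((hI y).const_mul _) ?_
    filter_upwards [hw0, hP] with ω h0 hp
    have := mul_le_mul_of_nonneg_left ((hp f hf).2 x y) h0
    linarith

lemma gauss_cos {s : ℝ} (hs : 0 < s) (x : EuclideanSpace ℝ (Fin d)) :
    ∫ ξ : EuclideanSpace ℝ (Fin d), Real.cos ⟪x, ξ⟫ * Real.exp (-s * ‖ξ‖ ^ 2)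
      = (π / s) ^ ((d : ℝ) / 2) * Real.exp (-(‖x‖ ^ 2 / (4 * s))) := by
  have h := GaussianFourier.integral_cexp_neg_mul_sq_norm_add (b := (s : ℂ)) (by simpa using hs)
    Complex.I x
  have hi := GaussianFourier.integrable_cexp_neg_mul_sq_norm_add (b := (s : ℂ)) (by simpa using hs)
    Complex.I x
  have h2 := congrArg Complex.re h
  rw [show (∫ v, Complex.exp (-(s:ℂ) * ‖v‖ ^ 2 + Complex.I * ⟪x, v⟫)).re
    = ∫ v, (Complex.exp (-(s:ℂ) * ‖v‖ ^ 2 + Complex.I * ⟪x, v⟫)).re from (integral_re hi).symm] at h2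
  have e1 : ∀ v : EuclideanSpace ℝ (Fin d), (Complex.exp (-(s:ℂ) * ‖v‖ ^ 2 + Complex.I * ⟪x, v⟫)).re =
      Real.cos ⟪x, v⟫ * Real.exp (-s * ‖v‖ ^ 2) := by
    intro v
    rw [Complex.exp_re]
    have r1 : (-(s:ℂ) * ‖v‖ ^ 2 + Complex.I * ⟪x, v⟫).re = -s * ‖v‖ ^ 2 := by
      simp [← Complex.ofReal_pow]
    have r2 : (-(s:ℂ) * ‖v‖ ^ 2 + Complex.I * ⟪x, v⟫).im = ⟪x, v⟫ := by
      simp [← Complex.ofReal_pow]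
    rw [r1, r2, mul_comm]
  simp only [e1] at h2
  rw [h2]
  have : (π / (s:ℂ)) ^ ((Module.finrank ℝ (EuclideanSpace ℝ (Fin d)) : ℂ) / 2) *
      Complex.exp (Complex.I ^ 2 * ‖x‖ ^ 2 / (4 * s)) =
      (((π / s) ^ ((d : ℝ) / 2) * Real.exp (-(‖x‖ ^ 2 / (4 * s))) : ℝ) : ℂ) := by
    push_cast [Complex.ofReal_cpow (div_nonneg pi_pos.le hs.le)]
    simp [neg_div]
  rw [this, Complex.ofReal_re]

lemma gauss_int {s : ℝ} (hs : 0 < s) :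
    Integrable (fun ξ : EuclideanSpace ℝ (Fin d) => Real.exp (-s * ‖ξ‖ ^ 2)) := by
  have hi := GaussianFourier.integrable_cexp_neg_mul_sq_norm_add (b := (s : ℂ)) (by simpa using hs)
    0 (0 : EuclideanSpace ℝ (Fin d))
  refine hi.norm.congr (Eventually.of_forall fun ξ => ?_)
  simp [Complex.norm_exp, ← Complex.ofReal_pow]

lemma PP.gauss {s : ℝ} (hs : 0 < s) :
    PP l (fun ξ : EuclideanSpace ℝ (Fin d) => Real.exp (-s * ‖ξ‖ ^ 2)) := by
  have hs' : 0 < 1 / (4 * s) := by positivity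
  have h := PP.mix (l := l) (ν := (volume : Measure (EuclideanSpace ℝ (Fin d))))
    (ψ := fun z ξ => Real.cos ⟪z, ξ⟫) (w := fun z => Real.exp (-(1 / (4 * s)) * ‖z‖ ^ 2))
    (by fun_prop) (gauss_int hs') (Eventually.of_forall fun z => (Real.exp_pos _).le)
    (Eventually.of_forall fun z => PP.cos z) (fun _ _ => Real.abs_cos_le_one _)
  have h2 := (PP.const (l := l) (d := d) (c := ((π / (1 / (4 * s))) ^ ((d : ℝ) / 2))⁻¹) (by positivity)).mul h
  convert h2 using 2 with ξ
  have h3 := gauss_cos hs' ξ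
  rw [show (fun z => rexp (-(1 / (4 * s)) * ‖z‖ ^ 2) * Real.cos ⟪z, ξ⟫) =
    fun z => Real.cos ⟪ξ, z⟫ * rexp (-(1 / (4 * s)) * ‖z‖ ^ 2) from ?_, h3]
  · rw [inv_mul_cancel_left₀ (by positivity)]
    congr 1; field_simp
  · ext z; rw [mul_comm, real_inner_comm]

/-- The constant of the Bernstein representation of `u ^ a`. -/
noncomputable def II (a : ℝ) : ℝ := ∫ s in Set.Ioi (0:ℝ), (1 - Real.exp (-s)) * s ^ (-1 - a)

lemma stable_int {a u : ℝ} (ha : 0 < a) (ha1 : a < 1) (hu : 0 ≤ u) :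
    IntegrableOn (fun s => (1 - Real.exp (-(s * u))) * s ^ (-1 - a)) (Set.Ioi 0) := by
  have hmeas : Measurable (fun s : ℝ => (1 - Real.exp (-(s * u))) * s ^ (-1 - a)) := by fun_prop
  rw [← Set.Ioc_union_Ioi_eq_Ioi (zero_le_one' ℝ)]
  refine IntegrableOn.union ?_ ?_
  · have h : IntegrableOn (fun s : ℝ => u * s ^ (-a)) (Set.Ioc 0 1) := by
      have := (intervalIntegral.intervalIntegrable_rpow' (a := 0) (b := 1) (r := -a) (by linarith))
      rw [intervalIntegrable_iff_integrableOn_Ioc_of_le zero_le_one] at this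
      exact this.const_mul u
    refine Integrable.mono' h hmeas.aestronglyMeasurable ?_
    refine (ae_restrict_iff' measurableSet_Ioc).2 (Eventually.of_forall fun s hs => ?_)
    have hs0 : 0 < s := hs.1
    have h1 : 1 - Real.exp (-(s * u)) ≤ s * u := by linarith [Real.add_one_le_exp (-(s * u))]
    have h0 : 0 ≤ 1 - Real.exp (-(s * u)) := by
      have : Real.exp (-(s * u)) ≤ 1 := Real.exp_le_one_iff.2 (by nlinarith)
      linarith
    rw [Real.norm_eq_abs, abs_of_nonneg (by positivity)]
    calc _ ≤ (s * u) * s ^ (-1 - a) := by gcongr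
      _ = u * s ^ (-a) := by
        rw [show -a = 1 + (-1 - a) by ring, Real.rpow_add hs0, Real.rpow_one]; ring
  · have h := integrableOn_Ioi_rpow_of_lt (a := -1 - a) (c := 1) (by linarith) one_pos
    refine Integrable.mono' h hmeas.aestronglyMeasurable ?_
    refine (ae_restrict_iff' measurableSet_Ioi).2 (Eventually.of_forall fun s hs => ?_)
    have hs0 : 0 < s := lt_trans one_pos hs
    have h0 : 0 ≤ 1 - Real.exp (-(s * u)) := by
      have : Real.exp (-(s * u)) ≤ 1 := Real.exp_le_one_iff.2 (by nlinarith)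
      linarith
    rw [Real.norm_eq_abs, abs_of_nonneg (by positivity)]
    have h1 : 1 - Real.exp (-(s * u)) ≤ 1 := by linarith [Real.exp_pos (-(s * u))]
    exact mul_le_of_le_one_left (by positivity) h1

lemma II_pos {a : ℝ} (ha : 0 < a) (ha1 : a < 1) : 0 < II a := by
  have hi := stable_int ha ha1 zero_le_one
  simp only [mul_one] at hi
  have hp : ∀ s ∈ Set.Ioi (0:ℝ), 0 < (1 - Real.exp (-s)) * s ^ (-1 - a) := by
    intro s hs
    have hs0 : 0 < s := hs
    have : Real.exp (-s) < 1 := Real.exp_lt_one_iff.2 (by linarith)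
    have : 0 < 1 - Real.exp (-s) := by linarith
    positivity
  unfold II
  rw [setIntegral_pos_iff_support_of_nonneg_ae]
  · have : Set.Ioi (0:ℝ) ⊆ Function.support (fun s : ℝ => (1 - Real.exp (-s)) * s ^ (-1 - a)) :=
      fun s hs => (hp s hs).ne'
    rw [Set.inter_eq_self_of_subset_right this]
    simp
  · exact (ae_restrict_iff' measurableSet_Ioi).2 (Eventually.of_forall fun s hs => (hp s hs).le)
  · exact hi

lemma stable_val {a u : ℝ} (ha : 0 < a) (hu : 0 ≤ u) :
    ∫ s in Set.Ioi (0:ℝ), (1 - Real.exp (-(s * u))) * s ^ (-1 - a) = u ^ a * II a := by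
  rcases hu.eq_or_lt with rfl | hu
  · simp [Real.zero_rpow ha.ne']
  have h := integral_comp_mul_left_Ioi (fun s => (1 - Real.exp (-s)) * s ^ (-1 - a)) 0 hu
  rw [mul_zero, smul_eq_mul] at h
  unfold II
  have h2 : ∫ s in Set.Ioi (0:ℝ), (1 - Real.exp (-(s * u))) * s ^ (-1 - a) =
      u ^ (1 + a) * ∫ s in Set.Ioi (0:ℝ), (1 - Real.exp (-(u * s))) * (u * s) ^ (-1 - a) := by
    rw [← integral_const_mul]
    refine setIntegral_congr_fun measurableSet_Ioi fun s hs => ?_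
    have hs0 : 0 < s := hs
    rw [Real.mul_rpow hu.le hs0.le, mul_comm s u]
    have : u ^ (1 + a) * u ^ (-1 - a) = 1 := by
      rw [← Real.rpow_add hu]; simp
    linear_combination (-(1 - Real.exp (-(u * s))) * s ^ (-1 - a)) * this
  rw [h2, h, Real.rpow_add hu, Real.rpow_one]
  field_simp

lemma log_val {m u : ℝ} (hm : 0 < m) (hu : 0 ≤ u)
    (hint : IntegrableOn (fun s => (1 - Real.exp (-(s * u))) * (Real.exp (-(m * s)) / s)) (Set.Ioi 0)) :
    ∫ s in Set.Ioi (0:ℝ), (1 - Real.exp (-(s * u))) * (Real.exp (-(m * s)) / s)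
      = Real.log ((m + u) / m) := by
  have he : (fun s => (1 - Real.exp (-(s * u))) * (Real.exp (-(m * s)) / s)) =
      fun s => s⁻¹ • (Real.exp (-(m * s)) - Real.exp (-((m + u) * s))) := by
    ext s
    rw [show -((m + u) * s) = -(m * s) + -(s * u) by ring, Real.exp_add, smul_eq_mul]
    ring
  rw [he] at hint ⊢
  have h := Frullani.integral_Ioi_eq (f := fun x : ℝ => Real.exp (-x)) (a := m) (b := m + u)
    (L := 1) (R := 0) ?_ hm (by linarith) ?_ ?_ hint
  · rw [h]; simp
  · exact (Continuous.locallyIntegrable (by fun_prop)).locallyIntegrableOn _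
  · have : ContinuousAt (fun x : ℝ => Real.exp (-x)) 0 := by fun_prop
    have h := this.tendsto
    simp only [neg_zero, Real.exp_zero] at h
    exact h.mono_left nhdsWithin_le_nhds
  · exact Real.tendsto_exp_neg_atTop_nhds_zero

lemma schlomilch {l β : ℝ} (hl : 0 < l) (hβ : 0 ≤ β) :
    ∫ x in Set.Ioi (0:ℝ), Real.exp (-(l * x - β / x) ^ 2) = √π / (2 * l) := by
  rcases hβ.eq_or_lt with rfl | hβ
  · have h := integral_gaussian_Ioi (l ^ 2)
    rw [Real.sqrt_div pi_pos.le, Real.sqrt_sq hl.le] at h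
    rw [show √π / (2 * l) = √π / l / 2 by field_simp, ← h]
    congr 1; ext x
    congr 1; ring
  set φ : ℝ → ℝ := fun x => l * x - β / x with hφ
  have hd : ∀ x ∈ Set.Ioi (0:ℝ), HasDerivWithinAt φ (l + β / x ^ 2) (Set.Ioi 0) x := by
    intro x hx
    have hx0 : x ≠ 0 := ne_of_gt hx
    have h1 : HasDerivAt φ (l * 1 - β * (-(x ^ 2)⁻¹)) x := by
      simp only [hφ, div_eq_mul_inv]
      exact ((hasDerivAt_id x).const_mul l).sub ((hasDerivAt_inv hx0).const_mul β)
    refine (h1.congr_deriv ?_).hasDerivWithinAt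
    field_simp
    ring
  have hmono : StrictMonoOn φ (Set.Ioi 0) := by
    intro x hx y hy hxy
    have hx0 : 0 < x := hx
    have : β / y < β / x := by gcongr
    have : l * x < l * y := by gcongr
    simp only [hφ]; linarith
  have himg : φ '' (Set.Ioi 0) = Set.univ := by
    refine Set.eq_univ_of_forall fun v => ?_
    have hD : 0 ≤ v ^ 2 + 4 * l * β := by positivity
    have hs := Real.sq_sqrt hD
    have hgt : |v| < √(v ^ 2 + 4 * l * β) := by
      rw [← Real.sqrt_sq_eq_abs]
      exact Real.sqrt_lt_sqrt (sq_nonneg _) (by nlinarith [mul_pos hl hβ])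
    have hpos : 0 < v + √(v ^ 2 + 4 * l * β) := by
      have := neg_abs_le v
      linarith
    refine ⟨(v + √(v ^ 2 + 4 * l * β)) / (2 * l), by simp only [Set.mem_Ioi]; positivity, ?_⟩
    simp only [hφ]
    generalize √(v ^ 2 + 4 * l * β) = S at *
    have hne : v + S ≠ 0 := hpos.ne'
    field_simp
    linear_combination hs
  have hG : Integrable (fun v : ℝ => Real.exp (-v ^ 2)) := by
    simpa using integrable_exp_neg_mul_sq (b := 1) one_pos
  have h1 := integral_image_eq_integral_abs_deriv_smul measurableSet_Ioi hd hmono.injOn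
    (fun v : ℝ => Real.exp (-v ^ 2))
  have h1i := (integrableOn_image_iff_integrableOn_abs_deriv_smul measurableSet_Ioi hd hmono.injOn
    (fun v : ℝ => Real.exp (-v ^ 2))).1 hG.integrableOn
  rw [himg, Measure.restrict_univ] at h1
  have hgauss : ∫ v : ℝ, Real.exp (-v ^ 2) = √π := by simpa using integral_gaussian 1
  rw [hgauss] at h1
  have hmφ : Measurable φ := by simp only [hφ]; fun_prop
  -- integrability of the two pieces
  have hi1 : IntegrableOn (fun x => l * Real.exp (-(φ x) ^ 2)) (Set.Ioi 0) := by
    refine Integrable.mono' h1i (Measurable.aestronglyMeasurable (by fun_prop)) ?_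
    refine (ae_restrict_iff' measurableSet_Ioi).2 (Eventually.of_forall fun x hx => ?_)
    have hx0 : 0 < x := hx
    rw [smul_eq_mul, Real.norm_eq_abs, abs_of_nonneg (by positivity), abs_of_nonneg (by positivity)]
    gcongr
    have : 0 < β / x ^ 2 := by positivity
    linarith
  have hi2 : IntegrableOn (fun x => β / x ^ 2 * Real.exp (-(φ x) ^ 2)) (Set.Ioi 0) := by
    refine Integrable.mono' h1i (Measurable.aestronglyMeasurable (by fun_prop)) ?_
    refine (ae_restrict_iff' measurableSet_Ioi).2 (Eventually.of_forall fun x hx => ?_)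
    have hx0 : 0 < x := hx
    rw [smul_eq_mul, Real.norm_eq_abs, abs_of_nonneg (by positivity), abs_of_nonneg (by positivity)]
    gcongr
    linarith
  have h2 : ∫ x in Set.Ioi (0:ℝ), |l + β / x ^ 2| • Real.exp (-(φ x) ^ 2) =
      (∫ x in Set.Ioi (0:ℝ), l * Real.exp (-(φ x) ^ 2)) +
      ∫ x in Set.Ioi (0:ℝ), β / x ^ 2 * Real.exp (-(φ x) ^ 2) := by
    rw [← integral_add hi1 hi2]
    refine setIntegral_congr_fun measurableSet_Ioi fun x hx => ?_
    have hx0 : 0 < x := hx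
    simp only [smul_eq_mul]
    rw [abs_of_nonneg (by positivity)]; ring
  -- reflection
  have h3 : ∫ x in Set.Ioi (0:ℝ), Real.exp (-(φ x) ^ 2) =
      (1 / l) * ∫ x in Set.Ioi (0:ℝ), β / x ^ 2 * Real.exp (-(φ x) ^ 2) := by
    have e1 := integral_comp_rpow_Ioi (fun x : ℝ => Real.exp (-(φ x) ^ 2)) (p := -1) (by norm_num)
    have e2 := integral_comp_mul_left_Ioi' (fun x : ℝ => 
      (|(-1:ℝ)| * x ^ ((-1:ℝ) - 1)) • Real.exp (-(φ (x ^ (-1:ℝ))) ^ 2)) 0 (b := l / β) (by positivity)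
    rw [mul_zero, e1] at e2
    rw [← e2, smul_eq_mul, ← integral_const_mul, ← integral_const_mul]
    refine setIntegral_congr_fun measurableSet_Ioi fun x hx => ?_
    have hx0 : 0 < x := hx
    have q1 : (l / β * x) ^ ((-1:ℝ) - 1) = ((l / β * x) ^ 2)⁻¹ := by
      rw [show (-1:ℝ) - 1 = -(2:ℕ) by norm_num, Real.rpow_neg (by positivity), Real.rpow_natCast]
    have q2 : φ ((l / β * x) ^ (-1:ℝ)) = -φ x := by
      rw [Real.rpow_neg_one]
      simp only [hφ]
      field_simp
      ring
    simp only [smul_eq_mul]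
    rw [q1, q2, neg_sq, abs_neg, abs_one]
    field_simp
  rw [h2, integral_const_mul] at h1
  change ∫ x in Set.Ioi (0:ℝ), Real.exp (-(φ x) ^ 2) = _
  generalize ∫ x in Set.Ioi (0:ℝ), β / x ^ 2 * Real.exp (-(φ x) ^ 2) = B at *
  generalize ∫ x in Set.Ioi (0:ℝ), Real.exp (-(φ x) ^ 2) = A at *
  field_simp at h3
  field_simp
  linarith

lemma J_val {l r : ℝ} (hl : 0 < l) (hr : 0 ≤ r) :
    ∫ s in Set.Ioi (0:ℝ), s ^ (-(1/2) : ℝ) * Real.exp (-(l ^ 2 * s) - r ^ 2 / (4 * s))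
      = √π / l * Real.exp (-(l * r)) := by
  have e1 := integral_comp_rpow_Ioi_of_pos (g := fun s : ℝ =>
    s ^ (-(1/2) : ℝ) * Real.exp (-(l ^ 2 * s) - r ^ 2 / (4 * s))) (p := 2) two_pos
  rw [← e1]
  have h := schlomilch hl (β := r / 2) (by positivity)
  rw [show √π / l * Real.exp (-(l * r)) = 2 * Real.exp (-(l * r)) * (√π / (2 * l)) by field_simp,
    ← h, ← integral_const_mul]
  refine setIntegral_congr_fun measurableSet_Ioi fun x hx => ?_
  have hx0 : 0 < x := hx
  simp only [smul_eq_mul]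
  rw [← Real.rpow_mul hx0.le, show (2:ℝ) - 1 = 1 by norm_num, show (2:ℝ) * -(1/2) = -1 by norm_num,
    Real.rpow_one, Real.rpow_neg_one, Real.rpow_two, mul_assoc 2 (Real.exp _), ← Real.exp_add]
  have : -(l ^ 2 * x ^ 2) - r ^ 2 / (4 * x ^ 2) = -(l * r) + -(l * x - r / 2 / x) ^ 2 := by
    field_simp; ring
  rw [this]
  field_simp

lemma Q_int {l : ℝ} (hl : 0 < l) :
    Integrable (fun ξ : EuclideanSpace ℝ (Fin d) => (l ^ 2 + ‖ξ‖ ^ 2) ^ (-(((d:ℝ) + 1) / 2))) := by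
  have h := integrable_rpow_neg_one_add_norm_sq (E := EuclideanSpace ℝ (Fin d)) (μ := volume)
    (r := (d : ℝ) + 1) (by simp)
  have h2 := (h.comp_smul (R := l⁻¹) (by positivity)).const_mul ((l ^ 2) ^ (-(((d:ℝ) + 1) / 2)))
  refine h2.congr (Eventually.of_forall fun ξ => ?_)
  simp only
  rw [neg_div, ← Real.mul_rpow (by positivity) (by positivity), norm_smul]
  congr 1
  rw [Real.norm_eq_abs, mul_pow, sq_abs]
  field_simp

lemma gamma_val {κ q : ℝ} (hκ : 0 < κ) (hq : 0 < q) :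
    IntegrableOn (fun s : ℝ => s ^ (κ - 1) * Real.exp (-(q * s))) (Set.Ioi 0) ∧
    ∫ s in Set.Ioi (0:ℝ), s ^ (κ - 1) * Real.exp (-(q * s)) = Real.Gamma κ * q ^ (-κ) := by
  have h := Real.integral_rpow_mul_exp_neg_mul_Ioi hκ hq
  have hG := Real.Gamma_pos_of_pos hκ
  refine ⟨.of_integral_ne_zero (by rw [h]; positivity), ?_⟩
  rw [h, one_div, Real.inv_rpow hq.le, Real.rpow_neg hq.le, mul_comm]

lemma base {l : ℝ} (hl : 0 < l) :
    KK l (fun ξ : EuclideanSpace ℝ (Fin d) => (l ^ 2 + ‖ξ‖ ^ 2) ^ (-(((d:ℝ) + 1) / 2))) := by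
  refine ⟨Q_int hl, ?_⟩
  set κ : ℝ := ((d:ℝ) + 1) / 2 with hκdef
  have hκ : 0 < κ := by positivity
  have hG := Real.Gamma_pos_of_pos hκ
  have hint0 : Integrable (Function.uncurry fun (s : ℝ) (ξ : EuclideanSpace ℝ (Fin d)) =>
      s ^ (κ - 1) * Real.exp (-((l ^ 2 + ‖ξ‖ ^ 2) * s)))
      ((volume.restrict (Set.Ioi 0)).prod volume) := by
    rw [integrable_prod_iff' (Measurable.aestronglyMeasurable (by fun_prop))]
    refine ⟨Eventually.of_forall fun ξ => (gamma_val hκ (q := l ^ 2 + ‖ξ‖ ^ 2) (by positivity)).1, ?_⟩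
    refine ((Q_int (d := d) hl).const_mul (Real.Gamma κ)).congr (Eventually.of_forall fun ξ => ?_)
    simp only [Function.uncurry]
    rw [← hκdef, ← (gamma_val hκ (q := l ^ 2 + ‖ξ‖ ^ 2) (by positivity)).2]
    refine setIntegral_congr_fun measurableSet_Ioi fun s hs => ?_
    have hs0 : 0 < s := hs
    rw [Real.norm_eq_abs, abs_of_nonneg (by positivity)]
  have hint : ∀ x : EuclideanSpace ℝ (Fin d),
      Integrable (Function.uncurry fun (s : ℝ) (ξ : EuclideanSpace ℝ (Fin d)) =>
      Real.cos ⟪x, ξ⟫ * (s ^ (κ - 1) * Real.exp (-((l ^ 2 + ‖ξ‖ ^ 2) * s))))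
      ((volume.restrict (Set.Ioi 0)).prod volume) := by
    intro x
    have hm : AEStronglyMeasurable (fun p : ℝ × EuclideanSpace ℝ (Fin d) => Real.cos ⟪x, p.2⟫)
        ((volume.restrict (Set.Ioi 0)).prod volume) :=
      Measurable.aestronglyMeasurable (by fun_prop)
    have hb := hint0.bdd_mul (c := 1) hm ?_
    · exact hb
    exact Eventually.of_forall fun p => by simpa using Real.abs_cos_le_one _
  have key : ∀ x : EuclideanSpace ℝ (Fin d),
      ∫ ξ : EuclideanSpace ℝ (Fin d), Real.cos ⟪x, ξ⟫ * (l ^ 2 + ‖ξ‖ ^ 2) ^ (-κ) =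
      ((Real.Gamma κ)⁻¹ * π ^ ((d:ℝ) / 2) * (√π / l)) * Real.exp (-(l * ‖x‖)) := by
    intro x
    have h := integral_integral_swap (hint x)
    have hL : ∫ ξ : EuclideanSpace ℝ (Fin d), (∫ s in Set.Ioi (0:ℝ), 
        Real.cos ⟪x, ξ⟫ * (s ^ (κ - 1) * Real.exp (-((l ^ 2 + ‖ξ‖ ^ 2) * s)))) =
        Real.Gamma κ * ∫ ξ : EuclideanSpace ℝ (Fin d), Real.cos ⟪x, ξ⟫ * (l ^ 2 + ‖ξ‖ ^ 2) ^ (-κ) := by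
      rw [← integral_const_mul]
      congr 1; ext ξ
      rw [integral_const_mul, (gamma_val hκ (q := l ^ 2 + ‖ξ‖ ^ 2) (by positivity)).2]
      ring
    have hR : ∫ s in Set.Ioi (0:ℝ), (∫ ξ : EuclideanSpace ℝ (Fin d), 
        Real.cos ⟪x, ξ⟫ * (s ^ (κ - 1) * Real.exp (-((l ^ 2 + ‖ξ‖ ^ 2) * s)))) =
        π ^ ((d:ℝ) / 2) * (√π / l * Real.exp (-(l * ‖x‖))) := by
      rw [← J_val hl (norm_nonneg x), ← integral_const_mul]
      refine setIntegral_congr_fun measurableSet_Ioi fun s hs => ?_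
      have hs0 : 0 < s := hs
      have e : ∀ ξ : EuclideanSpace ℝ (Fin d),
          Real.cos ⟪x, ξ⟫ * (s ^ (κ - 1) * Real.exp (-((l ^ 2 + ‖ξ‖ ^ 2) * s))) =
          (s ^ (κ - 1) * Real.exp (-(l ^ 2 * s))) * (Real.cos ⟪x, ξ⟫ * Real.exp (-s * ‖ξ‖ ^ 2)) := by
        intro ξ
        rw [show -((l ^ 2 + ‖ξ‖ ^ 2) * s) = -(l ^ 2 * s) + -s * ‖ξ‖ ^ 2 by ring, Real.exp_add]
        ring
      simp only [e]
      rw [integral_const_mul, gauss_cos hs0, sub_eq_add_neg (-(l ^ 2 * s)), Real.exp_add,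
        Real.div_rpow pi_pos.le hs0.le]
      have : s ^ (κ - 1) = s ^ (-(1/2) : ℝ) * s ^ ((d:ℝ) / 2) := by
        rw [← Real.rpow_add hs0]; congr 1; rw [hκdef]; ring
      rw [this]
      have : s ^ ((d:ℝ) / 2) ≠ 0 := by positivity
      field_simp
    rw [hL, hR] at h
    field_simp
    field_simp at h
    linarith
  intro x y
  rw [key, key, mul_left_comm, ← Real.exp_add]
  gcongr
  have := norm_sub_norm_le y x
  rw [norm_sub_rev] at this
  nlinarith

/-- The Lévy density after removing the gamma part. -/
noncomputable def mm (c a κ l s : ℝ) : ℝ := c * s ^ (-1 - a) - κ * (Real.exp (-(l ^ 2 * s)) / s)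

lemma gam_le {c a κ l s : ℝ} (ha : 0 < a) (ha1 : a < 1) (hκ : 0 ≤ κ) (hl : 0 < l)
    (hc : κ ≤ c * (l ^ 2) ^ a) (hs : 0 < s) :
    κ * (Real.exp (-(l ^ 2 * s)) / s) ≤ c * s ^ (-1 - a) := by
  have h1 : (l ^ 2 * s) ^ a * Real.exp (-(l ^ 2 * s)) ≤ 1 := by
    have hp : 0 < l ^ 2 * s := by positivity
    have : (l ^ 2 * s) ^ a ≤ Real.exp (l ^ 2 * s) := by
      have h2 : Real.log (l ^ 2 * s) ≤ l ^ 2 * s - 1 := Real.log_le_sub_one_of_pos hp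
      rw [Real.rpow_def_of_pos hp]
      apply Real.exp_le_exp.2
      nlinarith
    calc _ ≤ Real.exp (l ^ 2 * s) * Real.exp (-(l ^ 2 * s)) := by gcongr
      _ = 1 := by rw [← Real.exp_add]; simp
  rw [Real.mul_rpow (by positivity) hs.le] at h1
  have hc0 : 0 ≤ c := by
    by_contra hcon
    push Not at hcon
    have : 0 < (l ^ 2) ^ a := by positivity
    nlinarith
  have hsa : s ^ (-1 - a) = (s * s ^ a)⁻¹ := by
    rw [show -1 - a = -(1 + a) by ring, Real.rpow_neg hs.le, Real.rpow_add hs, Real.rpow_one]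
  have hsap : 0 < s ^ a := by positivity
  rw [hsa]
  have e1 : κ * (Real.exp (-(l ^ 2 * s)) / s) = (κ * (s ^ a * Real.exp (-(l ^ 2 * s)))) * (s * s ^ a)⁻¹ := by
    field_simp
  rw [e1]
  gcongr
  calc κ * (s ^ a * Real.exp (-(l ^ 2 * s))) ≤ (c * (l ^ 2) ^ a) * (s ^ a * Real.exp (-(l ^ 2 * s))) := by gcongr
    _ = c * ((l ^ 2) ^ a * s ^ a * Real.exp (-(l ^ 2 * s))) := by ring
    _ ≤ c * 1 := by gcongr
    _ = c := mul_one c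

lemma mm_meas (c a κ l : ℝ) : Measurable (mm c a κ l) := by
  unfold mm; fun_prop

lemma mm_val {c a κ l u : ℝ} (ha : 0 < a) (ha1 : a < 1) (hκ : 0 < κ) (hl : 0 < l)
    (hc : κ ≤ c * (l ^ 2) ^ a) (hu : 0 ≤ u) :
    IntegrableOn (fun s => (1 - Real.exp (-(s * u))) * mm c a κ l s) (Set.Ioi 0) ∧
    ∫ s in Set.Ioi (0:ℝ), (1 - Real.exp (-(s * u))) * mm c a κ l s
      = c * II a * u ^ a - κ * Real.log ((l ^ 2 + u) / l ^ 2) := by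
  have h1 := (stable_int ha ha1 hu).const_mul c
  have h2' : IntegrableOn (fun s => κ * ((1 - Real.exp (-(s * u))) * (Real.exp (-(l ^ 2 * s)) / s)))
      (Set.Ioi 0) := by
    refine Integrable.mono' h1 (Measurable.aestronglyMeasurable (by fun_prop)) ?_
    refine (ae_restrict_iff' measurableSet_Ioi).2 (Eventually.of_forall fun s hs => ?_)
    have hs0 : 0 < s := hs
    have h0 : 0 ≤ 1 - Real.exp (-(s * u)) := by
      have : Real.exp (-(s * u)) ≤ 1 := Real.exp_le_one_iff.2 (by nlinarith)
      linarith
    rw [Real.norm_eq_abs, abs_of_nonneg (by positivity)]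
    have := mul_le_mul_of_nonneg_left (gam_le ha ha1 hκ.le hl hc hs0) h0
    linarith
  have h2 : IntegrableOn (fun s => ((1 - Real.exp (-(s * u))) * (Real.exp (-(l ^ 2 * s)) / s)))
      (Set.Ioi 0) := by
    refine (h2'.const_mul κ⁻¹).congr (Eventually.of_forall fun s => ?_)
    simp only
    field_simp
  have e : (fun s => (1 - Real.exp (-(s * u))) * mm c a κ l s) = fun s =>
      c * ((1 - Real.exp (-(s * u))) * s ^ (-1 - a)) -
      κ * ((1 - Real.exp (-(s * u))) * (Real.exp (-(l ^ 2 * s)) / s)) := by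
    ext s; unfold mm; ring
  rw [e]
  refine ⟨h1.sub h2', ?_⟩
  rw [integral_sub h1 h2', integral_const_mul, integral_const_mul, stable_val ha hu,
    log_val (by positivity) hu h2]
  ring

lemma PP.trunc {w : ℝ → ℝ} {ε : ℝ} (hε : 0 < ε) (hw : IntegrableOn w (Set.Ioi ε))
    (hw0 : ∀ s, 0 < s → 0 ≤ w s) :
    PP l (fun ξ : EuclideanSpace ℝ (Fin d) =>
      Real.exp (-∫ s in Set.Ioi ε, (1 - Real.exp (-(s * ‖ξ‖ ^ 2))) * w s)) := by
  have hw0' : ∀ᵐ s ∂(volume.restrict (Set.Ioi ε)), 0 ≤ w s :=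
    (ae_restrict_iff' measurableSet_Ioi).2 (Eventually.of_forall fun s hs => hw0 s (lt_trans hε hs))
  have h := PP.mix (l := l) (ν := volume.restrict (Set.Ioi ε))
    (ψ := fun s (ξ : EuclideanSpace ℝ (Fin d)) => Real.exp (-|s| * ‖ξ‖ ^ 2)) (w := w)
    (by fun_prop) hw hw0'
    ((ae_restrict_iff' measurableSet_Ioi).2 (Eventually.of_forall fun s hs => by
      have hs0 : 0 < s := lt_trans hε hs
      exact PP.gauss (abs_pos.2 hs0.ne')))
    (fun s ξ => by
      rw [abs_of_pos (Real.exp_pos _), Real.exp_le_one_iff, neg_mul]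
      exact neg_nonpos.2 (by positivity))
  set φ : EuclideanSpace ℝ (Fin d) → ℝ :=
    fun ξ => ∫ s in Set.Ioi ε, w s * Real.exp (-|s| * ‖ξ‖ ^ 2) with hφ
  set M : ℝ := ∫ s in Set.Ioi ε, w s with hM
  have hb1 : ∀ s (ξ : EuclideanSpace ℝ (Fin d)), Real.exp (-|s| * ‖ξ‖ ^ 2) ≤ 1 := by
    intro s ξ
    rw [Real.exp_le_one_iff, neg_mul]
    exact neg_nonpos.2 (by positivity)
  have hiφ : ∀ ξ : EuclideanSpace ℝ (Fin d),
      IntegrableOn (fun s => w s * Real.exp (-|s| * ‖ξ‖ ^ 2)) (Set.Ioi ε) := by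
    intro ξ
    refine Integrable.mul_bdd (c := 1) hw (Measurable.aestronglyMeasurable (by fun_prop)) ?_
    refine Eventually.of_forall fun s => ?_
    rw [Real.norm_eq_abs, abs_of_pos (Real.exp_pos _)]
    exact hb1 s ξ
  have hφ0 : ∀ ξ, 0 ≤ φ ξ := by
    intro ξ
    refine integral_nonneg_of_ae ?_
    filter_upwards [hw0'] with s hs
    positivity
  have hφM : ∀ ξ, φ ξ ≤ M := by
    intro ξ
    refine integral_mono_ae (hiφ ξ) hw ?_
    filter_upwards [hw0'] with s hs
    exact mul_le_of_le_one_right hs (hb1 s ξ)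
  have heq : ∀ ξ : EuclideanSpace ℝ (Fin d),
      ∫ s in Set.Ioi ε, (1 - Real.exp (-(s * ‖ξ‖ ^ 2))) * w s = M - φ ξ := by
    intro ξ
    rw [hM, hφ, ← integral_sub hw (hiφ ξ)]
    refine setIntegral_congr_fun measurableSet_Ioi fun s hs => ?_
    have hs0 : 0 < s := lt_trans hε hs
    rw [abs_of_pos hs0, neg_mul]; ring
  have hev : ∀ᶠ n : ℕ in atTop, M ≤ n ∧ 0 < n :=
    ((tendsto_natCast_atTop_atTop (R := ℝ)).eventually_ge_atTop M).and (eventually_gt_atTop 0)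
  refine PP.lim (F := fun n ξ => (1 + (-(M - φ ξ)) / n) ^ n) ?_ ?_ ?_
  · filter_upwards [hev] with n hn
    have hn0 : (0:ℝ) < n := by exact_mod_cast hn.2
    have h1 : 0 ≤ 1 - M / n := by
      rw [sub_nonneg, div_le_one hn0]; exact hn.1
    have h2 : (0:ℝ) ≤ 1 / n := by positivity
    have h3 := ((PP.const (d := d) (l := l) h1).add ((PP.const (d := d) (l := l) h2).mul h)).pow n
    convert h3 using 3 with ξ
    ring
  · filter_upwards [hev] with n hn ξ
    have hn0 : (0:ℝ) < n := by exact_mod_cast hn.2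
    have h1 : (M - φ ξ) / n ≤ 1 := by
      rw [div_le_one hn0]; linarith [hφ0 ξ, hn.1]
    have h2 : 0 ≤ (M - φ ξ) / n := div_nonneg (by linarith [hφM ξ]) hn0.le
    rw [neg_div, abs_of_nonneg (pow_nonneg (by linarith) n)]
    exact pow_le_one₀ (by linarith) (by linarith)
  · intro ξ
    rw [heq]
    exact Real.tendsto_one_add_div_pow_exp _

lemma PP.levy {w : ℝ → ℝ} (hw : ∀ ε, 0 < ε → IntegrableOn w (Set.Ioi ε))
    (hw0 : ∀ s, 0 < s → 0 ≤ w s)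
    (hi : ∀ u, 0 ≤ u → IntegrableOn (fun s => (1 - Real.exp (-(s * u))) * w s) (Set.Ioi 0)) :
    PP l (fun ξ : EuclideanSpace ℝ (Fin d) =>
      Real.exp (-∫ s in Set.Ioi 0, (1 - Real.exp (-(s * ‖ξ‖ ^ 2))) * w s)) := by
  have hN : ∀ n : ℕ, (0:ℝ) < 1 / ((n:ℝ) + 1) := fun n => by positivity
  refine PP.lim (F := fun (n : ℕ) ξ =>
    Real.exp (-∫ s in Set.Ioi (1 / ((n:ℝ) + 1)), (1 - Real.exp (-(s * ‖ξ‖ ^ 2))) * w s)) ?_ ?_ ?_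
  · exact Eventually.of_forall fun n => PP.trunc (hN n) (hw _ (hN n)) hw0
  · refine Eventually.of_forall fun n ξ => ?_
    rw [abs_of_pos (Real.exp_pos _), Real.exp_le_one_iff, neg_nonpos]
    refine setIntegral_nonneg measurableSet_Ioi fun s hs => ?_
    have hs0 : 0 < s := lt_trans (hN n) hs
    refine mul_nonneg ?_ (hw0 s hs0)
    rw [sub_nonneg, Real.exp_le_one_iff]
    exact neg_nonpos.2 (by positivity)
  · intro ξ
    refine (Real.continuous_exp.tendsto _).comp (Tendsto.neg ?_)
    have hU : (⋃ n : ℕ, Set.Ioi (1 / ((n:ℝ) + 1))) = Set.Ioi 0 := by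
      ext s
      simp only [Set.mem_iUnion, Set.mem_Ioi]
      exact ⟨fun ⟨n, h⟩ => lt_trans (hN n) h, fun h => exists_nat_one_div_lt h⟩
    have h := tendsto_setIntegral_of_monotone (μ := volume)
      (f := fun s => (1 - Real.exp (-(s * ‖ξ‖ ^ 2))) * w s)
      (s := fun n : ℕ => Set.Ioi (1 / ((n:ℝ) + 1))) (fun _ => measurableSet_Ioi) ?_ ?_
    · rw [hU] at h; exact h
    · intro m n hmn
      exact Set.Ioi_subset_Ioi (one_div_le_one_div_of_le (by positivity) (by gcongr))
    · rw [hU]; exact hi _ (by positivity)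

lemma KK.main {t α l : ℝ} (ht : 0 < t) (hα : α ∈ Set.Ioo (1:ℝ) 2) (hl : 0 < l)
    (hlα : l ^ α = ((d:ℝ) + 1) / 2 * II (α / 2) / t) :
    KK l (fun ξ : EuclideanSpace ℝ (Fin d) => Real.exp (-t * ‖ξ‖ ^ α)) := by
  have ha : 0 < α / 2 := by linarith [hα.1]
  have ha1 : α / 2 < 1 := by linarith [hα.2]
  set κ : ℝ := ((d:ℝ) + 1) / 2 with hκdef
  have hκ : 0 < κ := by positivity
  have hI := II_pos ha ha1
  set c : ℝ := t / II (α / 2) with hcdef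
  have hl2 : (l ^ 2) ^ (α / 2) = l ^ α := by
    rw [← Real.rpow_natCast, ← Real.rpow_mul hl.le]; congr 1; push_cast; ring
  have hc : κ ≤ c * (l ^ 2) ^ (α / 2) := by
    rw [hl2, hlα, hcdef]; apply le_of_eq; field_simp
  have hval := fun u (hu : (0:ℝ) ≤ u) => mm_val ha ha1 hκ hl hc hu
  have hnn : ∀ s, 0 < s → 0 ≤ mm c (α / 2) κ l s := fun s hs =>
    sub_nonneg.2 (gam_le ha ha1 hκ.le hl hc hs)
  have hP := PP.levy (d := d) (l := l) (w := mm c (α / 2) κ l) ?_ hnn (fun u hu => (hval u hu).1)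
  · have h := ((hP _ (base hl)).smul (c := (l ^ 2) ^ κ) (by positivity))
    convert h using 2 with ξ
    simp only
    rw [(hval (‖ξ‖ ^ 2) (by positivity)).2]
    have e1 : c * II (α / 2) = t := by rw [hcdef]; field_simp
    have e2 : (‖ξ‖ ^ 2) ^ (α / 2) = ‖ξ‖ ^ α := by
      rw [← Real.rpow_natCast, ← Real.rpow_mul (norm_nonneg _)]; congr 1; push_cast; ring
    have hp : 0 < l ^ 2 + ‖ξ‖ ^ 2 := by positivity
    have hp2 : 0 < l ^ 2 := by positivity
    rw [e1, e2, Real.log_div hp.ne' hp2.ne', Real.rpow_def_of_pos hp, Real.rpow_def_of_pos hp2,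
      ← Real.exp_add, ← Real.exp_add]
    congr 1
    ring
  · intro ε hε
    have h1 := (integrableOn_Ioi_rpow_of_lt (a := -1 - α / 2) (c := ε) (by linarith) hε).const_mul c
    refine Integrable.mono' h1 (mm_meas _ _ _ _).aestronglyMeasurable ?_
    refine (ae_restrict_iff' measurableSet_Ioi).2 (Eventually.of_forall fun s hs => ?_)
    have hs0 : 0 < s := lt_trans hε hs
    rw [Real.norm_eq_abs, abs_of_nonneg (hnn s hs0)]
    unfold mm
    have : 0 ≤ κ * (Real.exp (-(l ^ 2 * s)) / s) := by positivity
    linarith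

end HKB

/-- Directional derivative bound: `|b · ∇_y p(t, x − y)| ≤ C t^{-1/α} p(t, x − y)`. -/
theorem heatKer_directional_gradient_bound (d : ℕ) (hd : 1 ≤ d)
    (α : ℝ) (hα : α ∈ Set.Ioo (1:ℝ) 2) (b : EuclideanSpace ℝ (Fin d)) :
    ∃ C : ℝ, 0 < C ∧ ∀ t, 0 < t → ∀ x y : EuclideanSpace ℝ (Fin d),
      |(fderiv ℝ (fun y' => heatKer d α t (x - y')) y) b| ≤
        C * t ^ (-(1 / α)) * heatKer d α t (x - y) := by
  have hI := HKB.II_pos (a := α / 2) (by linarith [hα.1]) (by linarith [hα.2])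
  have hα0 : 0 < α := by linarith [hα.1]
  set A : ℝ := (((d:ℝ) + 1) / 2 * HKB.II (α / 2)) ^ (1 / α) with hA
  have hA0 : 0 < A := by positivity
  refine ⟨A * (‖b‖ + 1), by positivity, fun t ht x y => ?_⟩
  set l : ℝ := A * t ^ (-(1 / α)) with hl
  have hl0 : 0 < l := by positivity
  have hlα : l ^ α = ((d:ℝ) + 1) / 2 * HKB.II (α / 2) / t := by
    rw [hl, hA, Real.mul_rpow (by positivity) (by positivity), ← Real.rpow_mul (by positivity),
      ← Real.rpow_mul ht.le, neg_mul, one_div_mul_cancel hα0.ne', Real.rpow_one, Real.rpow_neg_one]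
    rfl
  have hK := (HKB.KK.main (d := d) ht hα hl0 hlα).2
  have hH : ∀ x y, heatKer d α t x ≤ Real.exp (l * ‖x - y‖) * heatKer d α t y := by
    intro x y
    unfold heatKer
    rw [mul_left_comm]
    exact mul_le_mul_of_nonneg_left (hK x y) (by positivity)
  have hnn : ∀ x, 0 ≤ heatKer d α t x := by
    intro x
    have : Nonempty (Fin d) := ⟨⟨0, hd⟩⟩
    obtain ⟨v, hv⟩ := exists_ne (0 : EuclideanSpace ℝ (Fin d))
    have h1 := hH x (x + v)
    have h2 := hH (x + v) x
    have hv0 : 0 < ‖v‖ := norm_pos_iff.2 hv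
    rw [show x - (x + v) = -v by abel, norm_neg] at h1
    rw [show x + v - x = v by abel] at h2
    have hE : 1 < Real.exp (l * ‖v‖) := Real.one_lt_exp_iff.2 (by positivity)
    generalize Real.exp (l * ‖v‖) = E at *
    by_contra hneg
    push Not at hneg
    have h3 : E * heatKer d α t (x + v) ≤ E * (E * heatKer d α t x) :=
      mul_le_mul_of_nonneg_left h2 (by linarith)
    have h5 : 0 < (E * E - 1) * (-heatKer d α t x) := mul_pos (by nlinarith) (by linarith)
    nlinarith
  have hfin : |(fderiv ℝ (fun y' => heatKer d α t (x - y')) y) b| ≤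
      l * ‖b‖ * heatKer d α t (x - y) := by
    by_cases hdiff : DifferentiableAt ℝ (fun y' => heatKer d α t (x - y')) y
    swap
    · rw [fderiv_zero_of_not_differentiableAt hdiff]
      simp only [_root_.zero_apply, abs_zero]
      exact mul_nonneg (by positivity) (hnn _)
    have one : ∀ v : EuclideanSpace ℝ (Fin d),
        (fderiv ℝ (fun y' => heatKer d α t (x - y')) y) v ≤ l * ‖v‖ * heatKer d α t (x - y) := by
      intro v
      have hder : HasDerivAt (fun s : ℝ => heatKer d α t (x - (y + s • v)))
          ((fderiv ℝ (fun y' => heatKer d α t (x - y')) y) v) 0 :=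
        hdiff.hasFDerivAt.hasLineDerivAt v
      have hder2 : HasDerivAt (fun s : ℝ => Real.exp (l * (s * ‖v‖)) * heatKer d α t (x - y))
          (l * ‖v‖ * heatKer d α t (x - y)) 0 := by
        have h0 : HasDerivAt (fun s : ℝ => l * (s * ‖v‖)) (l * (1 * ‖v‖)) 0 :=
          ((hasDerivAt_id (0:ℝ)).mul_const ‖v‖).const_mul l
        have h1 := (h0.exp).mul_const (heatKer d α t (x - y))
        refine h1.congr_deriv ?_
        simp
      have h3 := (hder2.sub hder).hasDerivWithinAt (s := Set.Ici (0:ℝ))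
      have h4 : 0 ≤ l * ‖v‖ * heatKer d α t (x - y) -
          (fderiv ℝ (fun y' => heatKer d α t (x - y')) y) v := by
        rw [hasDerivWithinAt_iff_tendsto_slope] at h3
        have : (nhdsWithin (0:ℝ) (Set.Ici 0 \ {0})).NeBot := by
          rw [Set.Ici_sdiff_left]; infer_instance
        refine ge_of_tendsto h3 ?_
        filter_upwards [self_mem_nhdsWithin] with s hs
        have hs0 : 0 < s := lt_of_le_of_ne hs.1 (Ne.symm hs.2)
        have hh := hH (x - (y + s • v)) (x - y)
        rw [show x - (y + s • v) - (x - y) = -(s • v) by abel, norm_neg, norm_smul,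
          Real.norm_eq_abs, abs_of_pos hs0] at hh
        rw [slope_def_field]
        refine div_nonneg ?_ (by linarith)
        simp only [Pi.sub_apply, zero_mul, mul_zero, Real.exp_zero, one_mul, zero_smul, add_zero,
          sub_self, sub_zero]
        linarith
      linarith
    rw [abs_le]
    refine ⟨?_, one b⟩
    have := one (-b)
    rw [map_neg, norm_neg] at this
    linarith
  refine hfin.trans ?_
  have h0 := hnn (x - y)
  have : l * ‖b‖ ≤ A * (‖b‖ + 1) * t ^ (-(1 / α)) := by
    rw [show A * (‖b‖ + 1) * t ^ (-(1 / α)) = l * ‖b‖ + l by rw [hl]; ring]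
    linarith
  exact mul_le_mul_of_nonneg_right this h0
end

section
/- Let β ∈ (0,1) and let f : ℝ^d → [0,∞) be such that all integrals below converge. Then for every t > 0 and x ∈ ℝ^d, ∫_0^1 ∫_{ℝ^d} h_β(r,x,w) (P*_{r^α t} f)(w) dw dr = C_2 (P*_t f)(x), where C_2 = ∫_0^1 r^{-β} (1 − r^α)^{-1/α} dr is a finite constant depending only on α and β. -/
open MeasureTheory Real Filter
open scoped ENNReal RealInnerProductSpace

/-- The stable semigroup `P_t f(x) = ∫ p(t, x−y) f(y) dy`. -/
noncomputable def heatSg (d : ℕ) (α t : ℝ) (f : EuclideanSpace ℝ (Fin d) → ℝ)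
    (x : EuclideanSpace ℝ (Fin d)) : ℝ :=
  ∫ y, heatKer d α t (x - y) * f y

/-- The rescaled operator `P*_s f(x) = s^{d/α} (P_s f)(s^{1/α} x)`. -/
noncomputable def heatSgStar (d : ℕ) (α s : ℝ) (f : EuclideanSpace ℝ (Fin d) → ℝ)
    (x : EuclideanSpace ℝ (Fin d)) : ℝ :=
  s ^ ((d : ℝ) / α) * heatSg d α s f ((s ^ (1 / α)) • x)

/-- `h_β(r,x,w) = r^{-β} (1-r^α)^{-1/α} p(1-r^α, x - r w)`. -/
noncomputable def hker (d : ℕ) (α β r : ℝ) (x w : EuclideanSpace ℝ (Fin d)) : ℝ :=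
  r ^ (-β) * (1 - r ^ α) ^ (-(1 / α)) * heatKer d α (1 - r ^ α) (x - r • w)


set_option maxHeartbeats 1000000 in
open scoped FourierTransform in
lemma aux_L2_fourier {d : ℕ} (g : EuclideanSpace ℝ (Fin d) → ℂ) (h1 : Integrable g)
    (h2 : MemLp g 2) :
    ((𝓕 (h2.toLp g) : Lp ℂ 2 (volume : Measure (EuclideanSpace ℝ (Fin d)))) :
      EuclideanSpace ℝ (Fin d) → ℂ) =ᵐ[volume] 𝓕 g := by
  have hcont : Continuous (𝓕 g) :=
    VectorFourier.fourierIntegral_continuous Real.continuous_fourierChar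
      (by exact continuous_inner) h1
  apply ae_eq_of_integral_contDiff_smul_eq
  · exact (Lp.memLp _).locallyIntegrable (by norm_num)
  · exact hcont.locallyIntegrable
  intro φ hφ hφc
  have hc' : HasCompactSupport (fun x => ((φ x : ℝ) : ℂ)) := hφc.comp_left (g := fun y : ℝ => (y : ℂ)) Complex.ofReal_zero
  have hs' : ContDiff ℝ (⊤ : ℕ∞) (fun x => ((φ x : ℝ) : ℂ)) := Complex.ofRealCLM.contDiff.comp hφ
  let ψ := hc'.toSchwartzMap hs'
  have key := congrArg (fun T => T ψ) (Lp.fourier_toTemperedDistribution_eq (h2.toLp g))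
  simp only [TemperedDistribution.fourier_apply, Lp.toTemperedDistribution_apply] at key
  have e1 : ∫ x, (𝓕 ψ) x • (h2.toLp g) x = ∫ x, (𝓕 ψ) x • g x := by
    apply integral_congr_ae
    filter_upwards [h2.coeFn_toLp] with x hx
    rw [hx]
  have e2 : ∫ x, (𝓕 ψ) x • g x = ∫ x, ψ x • (𝓕 g) x := by
    have := VectorFourier.integral_fourierIntegral_smul_eq_flip (μ := volume) (ν := volume)
      (L := innerₗ (EuclideanSpace ℝ (Fin d)))
      Real.continuous_fourierChar continuous_inner ψ.integrable h1
    simpa using! this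
  rw [e1, e2] at key
  exact key.symm


lemma aux_int {d : ℕ} (hd : 1 ≤ d) {α s : ℝ} (hα : 0 < α) (hs : 0 < s) :
    Integrable (fun ξ : EuclideanSpace ℝ (Fin d) => Real.exp (-s * ‖ξ‖ ^ α)) := by
  have : Nonempty (Fin d) := ⟨⟨0, hd⟩⟩
  rw [integrable_fun_norm_addHaar volume (f := fun y => Real.exp (-s * y ^ α))]
  have := integrableOn_rpow_mul_exp_neg_mul_rpow (s := (d : ℝ) - 1) (p := α) (b := s)
    (by have : (1:ℝ) ≤ d := by exact_mod_cast hd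
        linarith) hα hs
  refine this.congr_fun (fun y hy => ?_) measurableSet_Ioi
  simp only [finrank_euclideanSpace, Fintype.card_fin, smul_eq_mul]
  rw [← Real.rpow_natCast, Nat.cast_sub hd]; simp

lemma aux_beta {α β : ℝ} (hα : α ∈ Set.Ioo (1:ℝ) 2) (hβ : β ∈ Set.Ioo (0:ℝ) 1) :
    IntegrableOn (fun r : ℝ => r ^ (-β) * (1 - r ^ α) ^ (-(1 / α))) (Set.Ioo 0 1) := by
  have hα0 : 0 < α := by linarith [hα.1]
  have h1α : 1 / α < 1 := by rw [div_lt_one hα0]; exact hα.1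
  have hb := Complex.betaIntegral_convergent (u := ((1 - β : ℝ) : ℂ)) (v := ((1 - 1 / α : ℝ) : ℂ))
    (by rw [Complex.ofReal_re]; linarith [hβ.2]) (by rw [Complex.ofReal_re]; linarith)
  rw [intervalIntegrable_iff_integrableOn_Ioo_of_le zero_le_one] at hb
  refine Integrable.mono hb ?_ ?_
  · apply Measurable.aestronglyMeasurable
    fun_prop
  · filter_upwards [self_mem_ae_restrict measurableSet_Ioo] with r hr
    have h1 : 0 < 1 - r := by linarith [hr.2]
    have h2 : 1 - r ≤ 1 - r ^ α := by
      have := Real.rpow_le_rpow_of_exponent_ge hr.1 hr.2.le hα.1.le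
      rw [Real.rpow_one] at this
      linarith
    have e : ((r : ℂ) ^ (((1 - β : ℝ) : ℂ) - 1) * (1 - (r : ℂ)) ^ (((1 - 1 / α : ℝ) : ℂ) - 1))
        = ((r ^ (-β) * (1 - r) ^ (-(1 / α)) : ℝ) : ℂ) := by
      rw [Complex.ofReal_mul, Complex.ofReal_cpow hr.1.le, Complex.ofReal_cpow h1.le]
      congr 2 <;> push_cast <;> ring
    rw [e, Complex.norm_real, norm_mul, norm_mul]
    gcongr
    rw [Real.norm_of_nonneg (by apply Real.rpow_nonneg; linarith),
      Real.norm_of_nonneg (by positivity)]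
    exact Real.rpow_le_rpow_of_nonpos h1 h2 (by rw [neg_nonpos]; positivity)


lemma heatKer_neg (d : ℕ) (α t : ℝ) (x : EuclideanSpace ℝ (Fin d)) :
    heatKer d α t (-x) = heatKer d α t x := by
  simp [heatKer, inner_neg_left]

lemma aux_ker_complex {d : ℕ} (hd : 1 ≤ d) {α s : ℝ} (hα : 0 < α) (hs : 0 < s)
    (y : EuclideanSpace ℝ (Fin d)) :
    ∫ ξ : EuclideanSpace ℝ (Fin d), Complex.exp ((⟪y, (2 * π) • ξ⟫ : ℝ) * Complex.I) *
      (Real.exp (-s * ‖(2 * π) • ξ‖ ^ α) : ℝ) = (heatKer d α s y : ℝ) := by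
  have hI := aux_int hd hα hs
  have hcos : Integrable (fun ξ : EuclideanSpace ℝ (Fin d) =>
      Real.cos ⟪y, ξ⟫ * Real.exp (-s * ‖ξ‖ ^ α)) := by
    refine hI.bdd_mul (c := 1) ?_ (Eventually.of_forall fun ξ => ?_)
    · exact (by fun_prop : Continuous _).aestronglyMeasurable
    · exact Real.abs_cos_le_one _
  have hsin : Integrable (fun ξ : EuclideanSpace ℝ (Fin d) =>
      Real.sin ⟪y, ξ⟫ * Real.exp (-s * ‖ξ‖ ^ α)) := by
    refine hI.bdd_mul (c := 1) ?_ (Eventually.of_forall fun ξ => ?_)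
    · exact (by fun_prop : Continuous _).aestronglyMeasurable
    · exact Real.abs_sin_le_one _
  have hsin0 : ∫ ξ : EuclideanSpace ℝ (Fin d),
      Real.sin ⟪y, ξ⟫ * Real.exp (-s * ‖ξ‖ ^ α) = 0 := by
    have h := integral_neg_eq_self (fun ξ : EuclideanSpace ℝ (Fin d) =>
      Real.sin ⟪y, ξ⟫ * Real.exp (-s * ‖ξ‖ ^ α)) volume
    simp only [inner_neg_right, Real.sin_neg, norm_neg, neg_mul, integral_neg] at h
    simp only [neg_mul]
    linarith
  rw [Measure.integral_comp_smul volume (fun ξ : EuclideanSpace ℝ (Fin d) =>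
    Complex.exp ((⟪y, ξ⟫ : ℝ) * Complex.I) * (Real.exp (-s * ‖ξ‖ ^ α) : ℝ)) (2 * π)]
  have e : (fun ξ : EuclideanSpace ℝ (Fin d) =>
      Complex.exp ((⟪y, ξ⟫ : ℝ) * Complex.I) * (Real.exp (-s * ‖ξ‖ ^ α) : ℝ)) =
      fun ξ => ((Real.cos ⟪y, ξ⟫ * Real.exp (-s * ‖ξ‖ ^ α) : ℝ) : ℂ) +
        ((Real.sin ⟪y, ξ⟫ * Real.exp (-s * ‖ξ‖ ^ α) : ℝ) : ℂ) * Complex.I := by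
    funext ξ
    rw [Complex.exp_mul_I, ← Complex.ofReal_cos, ← Complex.ofReal_sin]
    push_cast
    ring
  rw [e, integral_add hcos.ofReal (hsin.ofReal.mul_const _), integral_mul_const,
    integral_complex_ofReal, integral_complex_ofReal, hsin0]
  simp only [heatKer, finrank_euclideanSpace, Fintype.card_fin]
  rw [abs_of_nonneg (by positivity), Real.rpow_neg (by positivity), Real.rpow_natCast]
  simp

/-- The modulated Fourier symbol. -/
noncomputable def auxG (d : ℕ) (α s : ℝ) (x ξ : EuclideanSpace ℝ (Fin d)) : ℂ :=
  Complex.exp ((⟪x, (2 * π) • ξ⟫ : ℝ) * Complex.I) * (Real.exp (-s * ‖(2 * π) • ξ‖ ^ α) : ℝ)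

lemma auxG_cont {d : ℕ} {α s : ℝ} (hα : 0 < α) (x : EuclideanSpace ℝ (Fin d)) :
    Continuous (auxG d α s x) := by
  have : Continuous fun ξ : EuclideanSpace ℝ (Fin d) => ‖(2 * π) • ξ‖ ^ α :=
    Continuous.rpow_const (by fun_prop) (fun _ => Or.inr hα.le)
  unfold auxG
  fun_prop

lemma auxG_norm {d : ℕ} {α s : ℝ} (x ξ : EuclideanSpace ℝ (Fin d)) :
    ‖auxG d α s x ξ‖ = Real.exp (-s * ‖(2 * π) • ξ‖ ^ α) := by
  unfold auxG
  rw [norm_mul, Complex.norm_exp_ofReal_mul_I, one_mul, Complex.norm_real,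
    Real.norm_of_nonneg (Real.exp_pos _).le]

lemma auxG_int {d : ℕ} (hd : 1 ≤ d) {α s : ℝ} (hα : 0 < α) (hs : 0 < s)
    (x : EuclideanSpace ℝ (Fin d)) : Integrable (auxG d α s x) := by
  rw [← integrable_norm_iff (auxG_cont hα x).aestronglyMeasurable]
  simp only [auxG_norm]
  exact (integrable_comp_smul_iff volume (fun ξ : EuclideanSpace ℝ (Fin d) =>
    Real.exp (-s * ‖ξ‖ ^ α)) (by positivity : (2 * π) ≠ 0)).2 (aux_int hd hα hs)

lemma auxG_memLp {d : ℕ} (hd : 1 ≤ d) {α s : ℝ} (hα : 0 < α) (hs : 0 < s)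
    (x : EuclideanSpace ℝ (Fin d)) : MemLp (auxG d α s x) 2 := by
  rw [memLp_two_iff_integrable_sq_norm (auxG_cont hα x).aestronglyMeasurable]
  have := (auxG_int hd hα (s := 2 * s) (by positivity) x).norm
  refine this.congr (Eventually.of_forall fun ξ => ?_)
  simp only [auxG_norm]
  rw [← Real.exp_nat_mul]
  push_cast; ring_nf

open scoped FourierTransform in
lemma auxG_fourier {d : ℕ} (hd : 1 ≤ d) {α s : ℝ} (hα : 0 < α) (hs : 0 < s)
    (x z : EuclideanSpace ℝ (Fin d)) :
    𝓕 (auxG d α s x) z = (heatKer d α s (x - z) : ℝ) := by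
  rw [Real.fourier_eq', ← aux_ker_complex hd hα hs]
  congr 1
  funext ξ
  rw [auxG, smul_eq_mul, ← mul_assoc, ← Complex.exp_add, inner_sub_left, inner_smul_right,
    inner_smul_right, real_inner_comm ξ z]
  congr 2
  push_cast; ring

lemma heatKer_cont {d : ℕ} (hd : 1 ≤ d) {α s : ℝ} (hα : 0 < α) (hs : 0 < s) :
    Continuous (heatKer d α s) := by
  have h : Continuous (FourierTransform.fourier (auxG d α s 0)) :=
    VectorFourier.fourierIntegral_continuous Real.continuous_fourierChar
      (by exact continuous_inner) (auxG_int hd hα hs 0)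
  have e : heatKer d α s = fun z => (FourierTransform.fourier (auxG d α s 0) z).re := by
    funext z
    rw [auxG_fourier hd hα hs, Complex.ofReal_re, zero_sub, heatKer_neg]
  rw [e]
  exact Complex.continuous_re.comp h

lemma heatKer_ae {d : ℕ} (hd : 1 ≤ d) {α s : ℝ} (hα : 0 < α) (hs : 0 < s)
    (x : EuclideanSpace ℝ (Fin d)) :
    ∀ᵐ z, (FourierTransform.fourier ((auxG_memLp hd hα hs x).toLp _) :
      Lp ℂ 2 (volume : Measure (EuclideanSpace ℝ (Fin d)))) z
      = ((heatKer d α s (x - z) : ℝ) : ℂ) := by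
  filter_upwards [aux_L2_fourier _ (auxG_int hd hα hs x) (auxG_memLp hd hα hs x)] with z hz
  rw [hz, auxG_fourier hd hα hs]

lemma heatKer_sq {d : ℕ} (hd : 1 ≤ d) {α s : ℝ} (hα : 0 < α) (hs : 0 < s) :
    Integrable (fun z => heatKer d α s z ^ 2) := by
  have h := (memLp_congr_ae (heatKer_ae hd hα hs 0)).1 (Lp.memLp _)
  rw [memLp_two_iff_integrable_sq_norm h.1] at h
  refine h.congr (Eventually.of_forall fun z => ?_)
  simp only [Complex.norm_real, Real.norm_eq_abs, sq_abs, zero_sub, heatKer_neg]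

lemma heatKer_semigroup {d : ℕ} (hd : 1 ≤ d) {α s τ : ℝ} (hα : 0 < α) (hs : 0 < s) (hτ : 0 < τ)
    (x y : EuclideanSpace ℝ (Fin d)) :
    ∫ z, heatKer d α s (x - z) * heatKer d α τ (z - y) = heatKer d α (s + τ) (x - y) := by
  have h := Lp.inner_fourier_eq ((auxG_memLp hd hα hτ y).toLp _) ((auxG_memLp hd hα hs x).toLp _)
  rw [L2.inner_def, L2.inner_def] at h
  have e1 : ∫ z, inner ℂ ((FourierTransform.fourier ((auxG_memLp hd hα hτ y).toLp _) :
      Lp ℂ 2 (volume : Measure (EuclideanSpace ℝ (Fin d)))) z)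
      ((FourierTransform.fourier ((auxG_memLp hd hα hs x).toLp _) :
      Lp ℂ 2 (volume : Measure (EuclideanSpace ℝ (Fin d)))) z) =
      ((∫ z, heatKer d α s (x - z) * heatKer d α τ (z - y) : ℝ) : ℂ) := by
    rw [← integral_complex_ofReal]
    apply integral_congr_ae
    filter_upwards [heatKer_ae hd hα hs x, heatKer_ae hd hα hτ y] with z h1 h2
    rw [h1, h2, ← heatKer_neg d α τ (z - y), neg_sub]
    simp
  have e2 : ∫ z, inner ℂ (((auxG_memLp hd hα hτ y).toLp _ :
      Lp ℂ 2 (volume : Measure (EuclideanSpace ℝ (Fin d)))) z)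
      (((auxG_memLp hd hα hs x).toLp _ :
      Lp ℂ 2 (volume : Measure (EuclideanSpace ℝ (Fin d)))) z) =
      ((heatKer d α (s + τ) (x - y) : ℝ) : ℂ) := by
    rw [← aux_ker_complex hd hα (by positivity)]
    apply integral_congr_ae
    filter_upwards [(auxG_memLp hd hα hs x).coeFn_toLp, (auxG_memLp hd hα hτ y).coeFn_toLp]
      with z h1 h2
    rw [h1, h2, RCLike.inner_apply, auxG, auxG, map_mul, Complex.conj_ofReal, ← Complex.exp_conj,
      map_mul, Complex.conj_ofReal, Complex.conj_I]
    have : -(s + τ) * ‖(2 * π) • z‖ ^ α = -s * ‖(2 * π) • z‖ ^ α + -τ * ‖(2 * π) • z‖ ^ α := by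
      ring
    rw [this, Real.exp_add, inner_sub_left, Complex.ofReal_sub, sub_mul, sub_eq_add_neg,
      Complex.exp_add, Complex.ofReal_mul]
    ring_nf
  rw [e1, e2] at h
  exact_mod_cast h

lemma heatSg_semigroup {d : ℕ} (hd : 1 ≤ d) {α s τ : ℝ} (hα : 0 < α) (hs : 0 < s) (hτ : 0 < τ)
    (f : EuclideanSpace ℝ (Fin d) → ℝ) (hf : Integrable f) (x : EuclideanSpace ℝ (Fin d)) :
    ∫ z, heatKer d α s (x - z) * heatSg d α τ f z = heatSg d α (s + τ) f x := by
  have hcs := heatKer_cont hd hα hs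
  have hcτ := heatKer_cont hd hα hτ
  have hsq : Integrable (fun z => heatKer d α s (x - z) ^ 2) :=
    (heatKer_sq hd hα hs).comp_sub_left x
  have i1 : Integrable (fun p : EuclideanSpace ℝ (Fin d) × EuclideanSpace ℝ (Fin d) =>
      heatKer d α s (x - p.1) ^ 2 * ‖f p.2‖) (volume.prod volume) := hsq.mul_prod hf.norm
  have i2 : Integrable (fun p : EuclideanSpace ℝ (Fin d) × EuclideanSpace ℝ (Fin d) =>
      ‖f p.2‖ * heatKer d α τ (p.1 - p.2) ^ 2) (volume.prod volume) :=
    Integrable.convolution_integrand (ContinuousLinearMap.mul ℝ ℝ) hf.norm (heatKer_sq hd hα hτ)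
  have hF : Integrable (Function.uncurry fun z y : EuclideanSpace ℝ (Fin d) =>
      heatKer d α s (x - z) * (heatKer d α τ (z - y) * f y)) (volume.prod volume) := by
    refine (i1.add i2).mono' ?_ (Eventually.of_forall fun p => ?_)
    · have m1 : Continuous (fun p : EuclideanSpace ℝ (Fin d) × EuclideanSpace ℝ (Fin d) =>
        heatKer d α s (x - p.1)) := by fun_prop
      have m2 : Continuous (fun p : EuclideanSpace ℝ (Fin d) × EuclideanSpace ℝ (Fin d) =>
        heatKer d α τ (p.1 - p.2)) := by fun_prop
      exact m1.aestronglyMeasurable.mul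
        (m2.aestronglyMeasurable.mul hf.aestronglyMeasurable.comp_snd)
    · simp only [Function.uncurry, Pi.add_apply, norm_mul]
      have h0 := norm_nonneg (f p.2)
      have h1 := sq_nonneg (‖heatKer d α s (x - p.1)‖ - ‖heatKer d α τ (p.1 - p.2)‖)
      have h2 : ‖heatKer d α s (x - p.1)‖ ^ 2 = heatKer d α s (x - p.1) ^ 2 := sq_abs _
      have h3 : ‖heatKer d α τ (p.1 - p.2)‖ ^ 2 = heatKer d α τ (p.1 - p.2) ^ 2 := sq_abs _
      rw [← h2, ← h3]
      have h4 : ‖heatKer d α s (x - p.1)‖ * ‖heatKer d α τ (p.1 - p.2)‖ ≤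
        ‖heatKer d α s (x - p.1)‖ ^ 2 + ‖heatKer d α τ (p.1 - p.2)‖ ^ 2 := by nlinarith
      nlinarith [mul_le_mul_of_nonneg_right h4 h0]
  simp only [heatSg, ← integral_const_mul]
  rw [integral_integral_swap hF]
  congr 1
  funext y
  simp only [← mul_assoc]
  rw [integral_mul_const, heatKer_semigroup hd hα hs hτ]

lemma heatKer_scale {d : ℕ} {α s c : ℝ} (hc : 0 < c)
    (x : EuclideanSpace ℝ (Fin d)) :
    heatKer d α (c ^ α * s) (c • x) = (c ^ d)⁻¹ * heatKer d α s x := by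
  have h := Measure.integral_comp_smul volume (fun ξ : EuclideanSpace ℝ (Fin d) =>
    Real.cos ⟪x, ξ⟫ * Real.exp (-s * ‖ξ‖ ^ α)) c
  simp only [finrank_euclideanSpace, Fintype.card_fin] at h
  rw [abs_of_nonneg (by positivity), smul_eq_mul] at h
  simp only [heatKer]
  rw [mul_left_comm, ← h]
  congr 2
  funext ξ
  rw [inner_smul_left, inner_smul_right, norm_smul, Real.mul_rpow (by positivity) (by positivity),
    Real.norm_of_nonneg hc.le]
  simp only [conj_trivial]
  ring_nf

lemma aux_main {d : ℕ} (hd : 1 ≤ d) {α : ℝ} (hα : 0 < α)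
    (f : EuclideanSpace ℝ (Fin d) → ℝ) (hf : Integrable f) {t : ℝ} (ht : 0 < t)
    (x : EuclideanSpace ℝ (Fin d)) {r : ℝ} (hr : r ∈ Set.Ioo (0:ℝ) 1) :
    ∫ w, heatKer d α (1 - r ^ α) (x - r • w) * heatSgStar d α (r ^ α * t) f w
      = heatSgStar d α t f x := by
  have hr0 := hr.1
  have hrα : 0 < r ^ α := Real.rpow_pos_of_pos hr.1 _
  have hrα1 : r ^ α < 1 := Real.rpow_lt_one hr.1.le hr.2 hα
  obtain ⟨c, hc, rfl⟩ : ∃ c : ℝ, 0 < c ∧ c ^ α = t :=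
    ⟨t ^ (1 / α), by positivity, by rw [← Real.rpow_mul ht.le, one_div_mul_cancel hα.ne', rpow_one]⟩
  have e1 : (r ^ α * c ^ α) ^ (1 / α) = r * c := by
    rw [← Real.mul_rpow hr0.le hc.le, ← Real.rpow_mul (by positivity), mul_one_div_cancel hα.ne',
      rpow_one]
  have e2 : (r ^ α * c ^ α) ^ ((d : ℝ) / α) = (r * c) ^ d := by
    rw [← Real.mul_rpow hr0.le hc.le, ← Real.rpow_mul (by positivity), mul_div_cancel₀ _ hα.ne',
      Real.rpow_natCast]
  have e3 : (c ^ α) ^ (1 / α) = c := by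
    rw [← Real.rpow_mul (by positivity), mul_one_div_cancel hα.ne', rpow_one]
  have e4 : (c ^ α) ^ ((d : ℝ) / α) = c ^ d := by
    rw [← Real.rpow_mul (by positivity), mul_div_cancel₀ _ hα.ne', Real.rpow_natCast]
  simp only [heatSgStar, e1, e2, e3, e4]
  have h := heatSg_semigroup hd hα (s := c ^ α * (1 - r ^ α)) (τ := r ^ α * c ^ α)
    (mul_pos ht (by linarith)) (by positivity) f hf (c • x)
  rw [show c ^ α * (1 - r ^ α) + r ^ α * c ^ α = c ^ α by ring] at h
  rw [← h]
  have h' := Measure.integral_comp_smul volume (fun z : EuclideanSpace ℝ (Fin d) =>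
    heatKer d α (c ^ α * (1 - r ^ α)) (c • x - z) * heatSg d α (r ^ α * c ^ α) f z) (r * c)
  simp only [finrank_euclideanSpace, Fintype.card_fin] at h'
  rw [abs_of_nonneg (by positivity), smul_eq_mul] at h'
  have h'' : ∀ w : EuclideanSpace ℝ (Fin d),
      heatKer d α (c ^ α * (1 - r ^ α)) (c • x - (r * c) • w) =
        (c ^ d)⁻¹ * heatKer d α (1 - r ^ α) (x - r • w) := by
    intro w
    rw [← heatKer_scale hc, smul_sub, smul_smul, mul_comm c r]
  simp only [h'', mul_assoc] at h'
  rw [integral_const_mul] at h'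
  have h3 : ∀ w : EuclideanSpace ℝ (Fin d), heatKer d α (1 - r ^ α) (x - r • w) *
      ((r * c) ^ d * heatSg d α (r ^ α * c ^ α) f ((r * c) • w)) = (r * c) ^ d *
      (heatKer d α (1 - r ^ α) (x - r • w) * heatSg d α (r ^ α * c ^ α) f ((r * c) • w)) := by
    intro w; ring
  simp only [h3]
  rw [integral_const_mul]
  field_simp at h'
  rw [mul_comm ((r * c) ^ d), h', mul_comm (c ^ α) (1 - r ^ α)]

/-- Lemma 4.1 (i): `∫_0^1 ∫ h_β(r,x,w) (P*_{r^α t} f)(w) dw dr = C₂ (P*_t f)(x)` with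
`C₂ = ∫_0^1 r^{-β} (1−r^α)^{-1/α} dr` a finite constant. -/
theorem hker_int_heatSgStar (d : ℕ) (hd : 1 ≤ d) (α : ℝ) (hα : α ∈ Set.Ioo (1:ℝ) 2)
    (β : ℝ) (hβ : β ∈ Set.Ioo (0:ℝ) 1)
    (f : EuclideanSpace ℝ (Fin d) → ℝ) (hf : Integrable f) (hf0 : ∀ x, 0 ≤ f x)
    (hconv1 : ∀ t, 0 < t → ∀ x : EuclideanSpace ℝ (Fin d), ∀ r ∈ Set.Ioo (0:ℝ) 1,
      Integrable (fun w => hker d α β r x w * heatSgStar d α (r ^ α * t) f w))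
    (hconv2 : ∀ t, 0 < t → ∀ x : EuclideanSpace ℝ (Fin d),
      IntegrableOn
        (fun r => ∫ w, hker d α β r x w * heatSgStar d α (r ^ α * t) f w) (Set.Ioo 0 1))
    (t : ℝ) (ht : 0 < t) (x : EuclideanSpace ℝ (Fin d)) :
    IntegrableOn (fun r : ℝ => r ^ (-β) * (1 - r ^ α) ^ (-(1 / α))) (Set.Ioo 0 1) ∧
    (∫ r in Set.Ioo (0:ℝ) 1, ∫ w, hker d α β r x w * heatSgStar d α (r ^ α * t) f w)
      = (∫ r in Set.Ioo (0:ℝ) 1, r ^ (-β) * (1 - r ^ α) ^ (-(1 / α))) *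
          heatSgStar d α t f x := by
  refine ⟨aux_beta hα hβ, ?_⟩
  rw [← integral_mul_const]
  refine setIntegral_congr_fun measurableSet_Ioo fun r hr => ?_
  simp only [hker, mul_assoc]
  rw [integral_const_mul, integral_const_mul, aux_main hd (by linarith [hα.1]) f hf ht x hr]
end
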